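/- Let n ≥ 5, a ≥ 0 and p > (n+4+2a)/(n-4) with p·ℓ₁ > n(n-4)/2 and p·ℓ₂ > n²(n-4)²/16, and let u be a smooth solution of Δ²u = |x|^a |u|^{p-1} u on ℝ^n that is stable outside some compact set of ℝ^n. Then lim_{r → +∞} E(r; 0, u) = 0. -/

import Mathlib

open MeasureTheory Metric Set Filter
open scoped RealInnerProductSpace Topology

noncomputable section

/-- The Laplacian of `u : ℝⁿ → ℝ` at `x`, as the sum of the pure second
partial derivatives in the coordinate directions. -/
def lap (n : ℕ) (u : EuclideanSpace ℝ (Fin n) → ℝ) (x : EuclideanSpace ℝ (Fin n)) : ℝ :=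
  ∑ i : Fin n, iteratedFDeriv ℝ 2 u x ![EuclideanSpace.single i 1, EuclideanSpace.single i 1]

/-- `u` solves `Δ²u = |x|^a |u|^(p-1) u` pointwise on `Ω`. -/
def IsSolutionOn (n : ℕ) (a p : ℝ) (u : EuclideanSpace ℝ (Fin n) → ℝ)
    (Ω : Set (EuclideanSpace ℝ (Fin n))) : Prop :=
  ∀ x ∈ Ω, lap n (lap n u) x = ‖x‖ ^ a * |u x| ^ (p - 1) * u x

/-- `u` is a stable solution on `Ω`:
`p ∫ |x|^a |u|^(p-1) ψ² ≤ ∫ (Δψ)²` for every test function `ψ ∈ C_c^∞(Ω)`. -/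
def StableOn (n : ℕ) (a p : ℝ) (u : EuclideanSpace ℝ (Fin n) → ℝ)
    (Ω : Set (EuclideanSpace ℝ (Fin n))) : Prop :=
  ∀ ψ : EuclideanSpace ℝ (Fin n) → ℝ, ContDiff ℝ (⊤ : ℕ∞) ψ → HasCompactSupport ψ →
    tsupport ψ ⊆ Ω →
    p * ∫ x, ‖x‖ ^ a * |u x| ^ (p - 1) * ψ x ^ 2 ≤ ∫ x, lap n ψ x ^ 2

/-- Surface integral of `f` over the sphere `∂B_r(x)`, with respect to the
`(n-1)`-dimensional Hausdorff measure. -/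
def sphInt (n : ℕ) (x : EuclideanSpace ℝ (Fin n)) (r : ℝ)
    (f : EuclideanSpace ℝ (Fin n) → ℝ) : ℝ :=
  ∫ y in sphere x r, f y ∂(Measure.hausdorffMeasure ((n : ℝ) - 1))

/-- Radial derivative of `u` at `y`, relative to the center `x`. -/
def radDeriv (n : ℕ) (x : EuclideanSpace ℝ (Fin n))
    (u : EuclideanSpace ℝ (Fin n) → ℝ) (y : EuclideanSpace ℝ (Fin n)) : ℝ :=
  ⟪gradient u y, ‖y - x‖⁻¹ • (y - x)⟫

/-- `ℓ₁ = (β+2)(n-4-β) + β(n-2-β)` with `β = (4+a)/(p-1)`. -/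
def ell1 (n : ℕ) (a p : ℝ) : ℝ :=
  let β : ℝ := (4 + a) / (p - 1)
  (β + 2) * ((n : ℝ) - 4 - β) + β * ((n : ℝ) - 2 - β)

/-- `ℓ₂ = β(β+2)(n-4-β)(n-2-β)` with `β = (4+a)/(p-1)`. -/
def ell2 (n : ℕ) (a p : ℝ) : ℝ :=
  let β : ℝ := (4 + a) / (p - 1)
  β * (β + 2) * ((n : ℝ) - 4 - β) * ((n : ℝ) - 2 - β)

/-- The constant `c(n,p,a) = 2(ρ - γ - 1)`, `ρ = n-1-2β`, `γ = β(β-n+2)`. -/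
def cConst (n : ℕ) (a p : ℝ) : ℝ :=
  let β : ℝ := (4 + a) / (p - 1)
  2 * (((n : ℝ) - 1 - 2 * β) - β * (β - (n : ℝ) + 2) - 1)

/-- The rescaled energy `E(r; x, u)` from the monotonicity formula. -/
def energyE (n : ℕ) (a p : ℝ) (u : EuclideanSpace ℝ (Fin n) → ℝ)
    (x : EuclideanSpace ℝ (Fin n)) (r : ℝ) : ℝ :=
  let β : ℝ := (4 + a) / (p - 1)
  r ^ (2 * β + 4 - (n : ℝ)) *
      (∫ y in ball x r,
        (1 / 2) * lap n u y ^ 2 - (1 / (p + 1)) * ‖y‖ ^ a * |u y| ^ (p + 1))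
    + β / 2 * ((n : ℝ) - 2 - β) *
        deriv (fun ρ : ℝ => ρ ^ (2 * β + 1 - (n : ℝ)) * sphInt n x ρ fun y => u y ^ 2) r
    + β / 2 * ((n : ℝ) - 2 - β) *
        deriv (fun ρ : ℝ => ρ ^ (2 * β + 2 - (n : ℝ)) * sphInt n x ρ fun y => u y ^ 2) r
    + r ^ 3 / 2 *
        deriv (fun ρ : ℝ => ρ ^ (2 * β + 1 - (n : ℝ)) *
          sphInt n x ρ fun y => (β * ρ⁻¹ * u y + radDeriv n x u y) ^ 2) r
    + 1 / 2 *
        deriv (fun ρ : ℝ => ρ ^ (2 * β + 4 - (n : ℝ)) *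
          sphInt n x ρ fun y => ‖gradient u y‖ ^ 2 - radDeriv n x u y ^ 2) r
    + 1 / 2 * r ^ (2 * β + 3 - (n : ℝ)) *
        (sphInt n x r fun y => ‖gradient u y‖ ^ 2 - radDeriv n x u y ^ 2)

end

/-- Integrals over the unit sphere of products of the Emden–Fowler transform `w` of a solution,
as functions of `t = log r`: `a i j`, `b i j` stand for `∫ ∂ₜⁱw ∂ₜʲw` and
`∫ ⟪∇∂ₜⁱw, ∇∂ₜʲw⟫`, while `c`, `c'` stand for `∫ (Δw)²` and `∫ Δw Δ∂ₜw`, all derivatives in the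
angular variable; `N` stands for `∫ |w|^(p+1)` and `V` for the rescaled bulk energy. -/
structure SphericalMoments (k γ κ p : ℝ) where
  a : ℕ → ℕ → ℝ → ℝ
  b : ℕ → ℕ → ℝ → ℝ
  c : ℝ → ℝ
  c' : ℝ → ℝ
  N : ℝ → ℝ
  V : ℝ → ℝ
  area : ℝ
  area_nonneg : 0 ≤ area
  a_symm : ∀ i j, a i j = a j i
  b_symm : ∀ i j, b i j = b j i
  a_nonneg : ∀ i t, 0 ≤ a i i t
  b_nonneg : ∀ i t, 0 ≤ b i i t
  c_nonneg : ∀ t, 0 ≤ c t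
  N_nonneg : ∀ t, 0 ≤ N t
  a_sq_le : ∀ i j t, a i j t ^ 2 ≤ a i i t * a j j t
  b_sq_le : ∀ i j t, b i j t ^ 2 ≤ b i i t * b j j t
  b_sq_le_a_mul_c : ∀ i t, b i 0 t ^ 2 ≤ a i i t * c t
  hasDerivAt_a : ∀ i j t, HasDerivAt (a i j) (a (i + 1) j t + a i (j + 1) t) t
  hasDerivAt_b : ∀ i j t, HasDerivAt (b i j) (b (i + 1) j t + b i (j + 1) t) t
  hasDerivAt_c : ∀ t, HasDerivAt c (2 * c' t) t
  N_eq : ∀ t, N t = a 4 0 t + 2 * k * a 3 0 t + ((k + 2) * (k - 2) - 2 * γ - 2 * k) * a 2 0 t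
    - 2 * b 2 0 t - (2 * k * γ + 2 * k * (k + 2)) * a 1 0 t - 2 * k * b 1 0 t + c t
    + (2 * γ + 2 * k) * b 0 0 t + γ * (γ + 2 * k) * a 0 0 t
  hasDerivAt_N : ∀ t, HasDerivAt N ((p + 1) * (a 4 1 t + 2 * k * a 3 1 t
    + ((k + 2) * (k - 2) - 2 * γ - 2 * k) * a 2 1 t
    - 2 * b 2 1 t - (2 * k * γ + 2 * k * (k + 2)) * a 1 1 t - 2 * k * b 1 1 t + c' t
    + (2 * γ + 2 * k) * b 0 1 t + γ * (γ + 2 * k) * a 0 1 t)) t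
  hasDerivAt_V : ∀ t, HasDerivAt V (-k * V t + 1 / 2 * (a 2 2 t + (k + 2) ^ 2 * a 1 1 t
    + γ ^ 2 * a 0 0 t + c t + 2 * (k + 2) * a 2 1 t - 2 * γ * a 2 0 t - 2 * b 2 0 t
    - 2 * (k + 2) * γ * a 1 0 t - 2 * (k + 2) * b 1 0 t + 2 * γ * b 0 0 t)
    - N t / (p + 1)) t
  a_le_N : ∀ s > 0, ∀ t, a 0 0 t ≤ s ^ (p - 1) * N t + s ^ (-2 : ℝ) * area
  T₀ : ℝ
  stable : ∀ η : ℝ → ℝ, ContDiff ℝ (⊤ : ℕ∞) η → HasCompactSupport η → tsupport η ⊆ Ioi T₀ →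
    p * ∫ t, N t * η t ^ 2 ≤ ∫ t,
      ((a 2 2 t + 4 * a 1 1 t + κ ^ 2 * a 0 0 t + c t + 4 * a 2 1 t - 2 * κ * a 2 0 t
          - 2 * b 2 0 t - 4 * κ * a 1 0 t - 4 * b 1 0 t + 2 * κ * b 0 0 t) * η t ^ 2
        + 2 * (2 * (a 2 1 t + 2 * a 1 1 t - κ * a 1 0 t - b 1 0 t)
          + 2 * (a 2 0 t + 2 * a 1 0 t - κ * a 0 0 t - b 0 0 t)) * (η t * deriv η t)
        + 2 * (a 2 0 t + 2 * a 1 0 t - κ * a 0 0 t - b 0 0 t) * (η t * deriv (deriv η) t)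
        + (4 * a 1 1 t + 8 * a 1 0 t + 4 * a 0 0 t) * deriv η t ^ 2
        + 2 * (2 * a 1 0 t + 2 * a 0 0 t) * (deriv η t * deriv (deriv η) t)
        + a 0 0 t * deriv (deriv η) t ^ 2)

namespace SphericalMoments

variable {k γ κ p : ℝ} (S : SphericalMoments k γ κ p)

lemma continuous_a (i j : ℕ) : Continuous (S.a i j) :=
  continuous_iff_continuousAt.2 fun t => (S.hasDerivAt_a i j t).continuousAt

lemma continuous_b (i j : ℕ) : Continuous (S.b i j) :=
  continuous_iff_continuousAt.2 fun t => (S.hasDerivAt_b i j t).continuousAt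

lemma continuous_c : Continuous S.c :=
  continuous_iff_continuousAt.2 fun t => (S.hasDerivAt_c t).continuousAt

lemma continuous_N : Continuous S.N :=
  continuous_iff_continuousAt.2 fun t => (S.hasDerivAt_N t).continuousAt

lemma continuous_V : Continuous S.V :=
  continuous_iff_continuousAt.2 fun t => (S.hasDerivAt_V t).continuousAt

/-- The sum of the zeroth and top order moments. -/
def Q (t : ℝ) : ℝ := S.c t + S.a 2 2 t + S.b 1 1 t + S.b 0 0 t + S.a 0 0 t

lemma continuous_Q : Continuous S.Q :=
  (((S.continuous_c.add (S.continuous_a 2 2)).add (S.continuous_b 1 1)).add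
    (S.continuous_b 0 0)).add (S.continuous_a 0 0)

lemma Q_nonneg (t : ℝ) : 0 ≤ S.Q t := by
  have := S.c_nonneg t
  have := S.a_nonneg 2 t
  have := S.b_nonneg 1 t
  have := S.b_nonneg 0 t
  have := S.a_nonneg 0 t
  unfold Q
  positivity

/-- The remainder terms in the stability estimate with cut-off values `e₀, e₁, e₂`. -/
def R (e₀ e₁ e₂ t : ℝ) : ℝ :=
  |S.a 2 1 t| * (e₀ ^ 2 + |e₀ * e₁|) + |S.a 2 0 t| * (e₀ ^ 2 + |e₀ * e₁| + |e₀ * e₂| + e₁ ^ 2)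
    + |S.a 1 0 t| * (e₀ ^ 2 + |e₀ * e₁| + |e₁ * e₂|) + S.a 1 1 t * (e₀ ^ 2 + e₁ ^ 2)
    + |S.b 1 0 t| * (e₀ ^ 2 + |e₀ * e₁|) + S.b 0 0 t * e₁ ^ 2 + S.a 0 0 t * (e₁ ^ 2 + e₂ ^ 2)

lemma continuous_R {e₀ e₁ e₂ : ℝ → ℝ} (h₀ : Continuous e₀) (h₁ : Continuous e₁)
    (h₂ : Continuous e₂) : Continuous fun t => S.R (e₀ t) (e₁ t) (e₂ t) t := by
  have := S.continuous_a
  have := S.continuous_b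
  unfold R
  fun_prop

end SphericalMoments

/-- A continuous function vanishing off the support of a compactly supported one is integrable. -/
lemma Continuous.integrable_of_forall_notMem_tsupport {f η : ℝ → ℝ} (hf : Continuous f)
    (hη : HasCompactSupport η) (h : ∀ t, t ∉ tsupport η → f t = 0) : Integrable f :=
  hf.integrable_of_hasCompactSupport (HasCompactSupport.intro hη h)

lemma deriv_eq_zero_of_notMem_tsupport {η : ℝ → ℝ} {t : ℝ} (ht : t ∉ tsupport η) :
    deriv η t = 0 := by
  by_contra h
  exact ht (support_deriv_subset h)

lemma deriv_deriv_eq_zero_of_notMem_tsupport {η : ℝ → ℝ} {t : ℝ} (ht : t ∉ tsupport η) :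
    deriv (deriv η) t = 0 :=
  deriv_eq_zero_of_notMem_tsupport fun h =>
    ht (closure_minimal support_deriv_subset (isClosed_tsupport η) h)

namespace SphericalMoments

variable {k γ κ p : ℝ} (S : SphericalMoments k γ κ p)

/-- The exact remainder in the stability estimate. -/
def exactR (S : SphericalMoments k γ κ p) (e₀ e₁ e₂ t : ℝ) : ℝ :=
  4 * S.a 1 1 t * e₁ ^ 2 + S.a 0 0 t * e₂ ^ 2 + 4 * S.a 2 1 t * (e₀ * e₁)
    + 2 * S.a 2 0 t * (e₀ * e₂) + 4 * S.a 1 0 t * (e₁ * e₂)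
    + (4 + 2 * κ) * (S.a 1 1 t * e₀ ^ 2 + 2 * S.a 1 0 t * (e₀ * e₁) + S.a 0 0 t * e₁ ^ 2)
    + 4 * S.b 1 0 t * (e₀ * e₁) + 2 * S.b 0 0 t * e₁ ^ 2

def exactR' (S : SphericalMoments k γ κ p) (e₀ e₁ e₂ t : ℝ) : ℝ :=
  4 * S.a 2 1 t * (e₀ * e₁) + S.a 2 0 t * (2 * e₁ ^ 2 + 2 * (e₀ * e₂))
    - 2 * k * (S.a 2 1 t * e₀ ^ 2 + 2 * S.a 2 0 t * (e₀ * e₁))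
    + ((k + 2) * (k - 2) - 2 * γ - 2 * k) * S.a 2 0 t * e₀ ^ 2 + 4 * S.b 1 0 t * (e₀ * e₁)
    - (2 * k * γ + 2 * k * (k + 2)) * S.a 1 0 t * e₀ ^ 2 - 2 * k * S.b 1 0 t * e₀ ^ 2

lemma integral_stable_le {η : ℝ → ℝ} (hη : ContDiff ℝ (⊤ : ℕ∞) η)
    (hc : HasCompactSupport η) (hs : tsupport η ⊆ Ioi S.T₀) :
    p * ∫ t, S.N t * η t ^ 2 ≤ ∫ t, ((S.c t + S.a 2 2 t + 2 * S.b 1 1 t + 2 * κ * S.b 0 0 t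
      + κ ^ 2 * S.a 0 0 t) * η t ^ 2 + S.exactR (η t) (deriv η t) (deriv (deriv η) t) t) := by
  have hη1 : ContDiff ℝ (⊤ : ℕ∞) (deriv η) := ContDiff.iterate_deriv 1 hη
  have hη2 : ContDiff ℝ (⊤ : ℕ∞) (deriv (deriv η)) := ContDiff.iterate_deriv 2 hη
  have d0 : ∀ t, HasDerivAt η (deriv η t) t := fun t =>
    (hη.differentiable (by simp) t).hasDerivAt
  have d1 : ∀ t, HasDerivAt (deriv η) (deriv (deriv η) t) t := fun t =>
    (hη1.differentiable (by simp) t).hasDerivAt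
  have ca := S.continuous_a
  have cb := S.continuous_b
  have cc := S.continuous_c
  have k0 := hη.continuous
  have k1 := hη1.continuous
  have k2 := hη2.continuous
  have z0 : ∀ t, t ∉ tsupport η → η t = 0 := fun t ht => image_eq_zero_of_notMem_tsupport ht
  have z1 : ∀ t, t ∉ tsupport η → deriv η t = 0 := fun t => deriv_eq_zero_of_notMem_tsupport
  have z2 : ∀ t, t ∉ tsupport η → deriv (deriv η) t = 0 :=
    fun t => deriv_deriv_eq_zero_of_notMem_tsupport
  have key : ∀ t, HasDerivAt (fun t =>
      2 * (S.a 1 1 t * η t ^ 2 + 2 * S.a 1 0 t * (η t * deriv η t) + S.a 0 0 t * deriv η t ^ 2)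
      - 2 * (κ * (S.a 1 0 t * η t ^ 2 + S.a 0 0 t * (η t * deriv η t)) + S.b 1 0 t * η t ^ 2
        + S.b 0 0 t * (η t * deriv η t))
      - 2 * ((κ * S.a 0 0 t + S.b 0 0 t) * η t ^ 2)) _ t := fun t =>
    (((((S.hasDerivAt_a 1 1 t).mul ((d0 t).pow 2)).add
      (((S.hasDerivAt_a 1 0 t).const_mul 2).mul ((d0 t).mul (d1 t)))).add
      ((S.hasDerivAt_a 0 0 t).mul ((d1 t).pow 2))).const_mul 2).sub
      ((((((S.hasDerivAt_a 1 0 t).mul ((d0 t).pow 2)).add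
        ((S.hasDerivAt_a 0 0 t).mul ((d0 t).mul (d1 t)))).const_mul κ).add
        ((S.hasDerivAt_b 1 0 t).mul ((d0 t).pow 2))).add
        ((S.hasDerivAt_b 0 0 t).mul ((d0 t).mul (d1 t))) |>.const_mul 2) |>.sub
      (((((S.hasDerivAt_a 0 0 t).const_mul κ).add (S.hasDerivAt_b 0 0 t)).mul
        ((d0 t).pow 2)).const_mul 2)
  have hz := integral_eq_zero_of_hasDerivAt_of_integrable key
    (Continuous.integrable_of_forall_notMem_tsupport (by fun_prop) hc
      fun t ht => by simp [z0 t ht, z1 t ht, z2 t ht])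
    (Continuous.integrable_of_forall_notMem_tsupport (by fun_prop) hc
      fun t ht => by simp [z0 t ht, z1 t ht])
  refine (S.stable η hη hc hs).trans (le_of_eq ?_)
  rw [← sub_eq_zero, ← integral_sub, ← hz]
  · refine integral_congr_ae (Eventually.of_forall fun t => ?_)
    simp only [exactR, Pi.add_apply, Pi.mul_apply, Pi.pow_apply, S.a_symm 0 1, S.b_symm 0 1, S.a_symm 1 2,
      Nat.reduceAdd]
    push_cast
    ring
  · exact Continuous.integrable_of_forall_notMem_tsupport (by fun_prop) hc
      fun t ht => by simp [z0 t ht, z1 t ht, z2 t ht]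
  · exact Continuous.integrable_of_forall_notMem_tsupport (by unfold exactR; fun_prop) hc
      fun t ht => by simp [exactR, z0 t ht, z1 t ht, z2 t ht]

lemma integral_N_eq {η : ℝ → ℝ} (hη : ContDiff ℝ (⊤ : ℕ∞) η) (hc : HasCompactSupport η) :
    ∫ t, S.N t * η t ^ 2 = ∫ t, ((S.c t + S.a 2 2 t + 2 * S.b 1 1 t
      + (2 * γ + 2 * k) * S.b 0 0 t + γ * (γ + 2 * k) * S.a 0 0 t) * η t ^ 2
      + S.exactR' (η t) (deriv η t) (deriv (deriv η) t) t) := by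
  have hη1 : ContDiff ℝ (⊤ : ℕ∞) (deriv η) := ContDiff.iterate_deriv 1 hη
  have hη2 : ContDiff ℝ (⊤ : ℕ∞) (deriv (deriv η)) := ContDiff.iterate_deriv 2 hη
  have d0 : ∀ t, HasDerivAt η (deriv η t) t := fun t =>
    (hη.differentiable (by simp) t).hasDerivAt
  have d1 : ∀ t, HasDerivAt (deriv η) (deriv (deriv η) t) t := fun t =>
    (hη1.differentiable (by simp) t).hasDerivAt
  have ca := S.continuous_a
  have cb := S.continuous_b
  have cc := S.continuous_c
  have cN := S.continuous_N
  have k0 := hη.continuous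
  have k1 := hη1.continuous
  have k2 := hη2.continuous
  have z0 : ∀ t, t ∉ tsupport η → η t = 0 := fun t ht => image_eq_zero_of_notMem_tsupport ht
  have z1 : ∀ t, t ∉ tsupport η → deriv η t = 0 := fun t => deriv_eq_zero_of_notMem_tsupport
  have z2 : ∀ t, t ∉ tsupport η → deriv (deriv η) t = 0 :=
    fun t => deriv_deriv_eq_zero_of_notMem_tsupport
  have key : ∀ t, HasDerivAt (fun t =>
      S.a 3 0 t * η t ^ 2 - S.a 2 1 t * η t ^ 2 - 2 * S.a 2 0 t * (η t * deriv η t)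
        + 2 * k * S.a 2 0 t * η t ^ 2 - 2 * S.b 1 0 t * η t ^ 2) _ t := fun t =>
    (((((S.hasDerivAt_a 3 0 t).mul ((d0 t).pow 2)).sub
      ((S.hasDerivAt_a 2 1 t).mul ((d0 t).pow 2))).sub
      (((S.hasDerivAt_a 2 0 t).const_mul 2).mul ((d0 t).mul (d1 t)))).add
      (((S.hasDerivAt_a 2 0 t).const_mul (2 * k)).mul ((d0 t).pow 2))).sub
      (((S.hasDerivAt_b 1 0 t).const_mul 2).mul ((d0 t).pow 2))
  have hz := integral_eq_zero_of_hasDerivAt_of_integrable key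
    (Continuous.integrable_of_forall_notMem_tsupport (by fun_prop) hc
      fun t ht => by simp [z0 t ht, z1 t ht, z2 t ht])
    (Continuous.integrable_of_forall_notMem_tsupport (by fun_prop) hc
      fun t ht => by simp [z0 t ht, z1 t ht])
  rw [← sub_eq_zero, ← integral_sub, ← hz]
  · refine integral_congr_ae (Eventually.of_forall fun t => ?_)
    simp only [exactR', Pi.mul_apply, Pi.pow_apply, S.N_eq t, Nat.reduceAdd, zero_add]
    push_cast
    ring
  · exact Continuous.integrable_of_forall_notMem_tsupport (by fun_prop) hc
      fun t ht => by simp [z0 t ht]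
  · exact Continuous.integrable_of_forall_notMem_tsupport (by unfold exactR'; fun_prop) hc
      fun t ht => by simp [exactR', z0 t ht, z1 t ht, z2 t ht]

end SphericalMoments

namespace SphericalMoments

variable {k γ κ p : ℝ} (S : SphericalMoments k γ κ p)

lemma R_nonneg (e₀ e₁ e₂ t : ℝ) : 0 ≤ S.R e₀ e₁ e₂ t := by
  have := S.a_nonneg 1 t
  have := S.a_nonneg 0 t
  have := S.b_nonneg 0 t
  unfold R
  positivity

lemma mul_mul_le_mul_abs {c K : ℝ} (h : |c| ≤ K) (x y : ℝ) : c * x * y ≤ K * (|x| * |y|) := by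
  calc c * x * y ≤ |c * x * y| := le_abs_self _
    _ = |c| * (|x| * |y|) := by rw [abs_mul, abs_mul, mul_assoc]
    _ ≤ _ := by gcongr

lemma exactR_le (e₀ e₁ e₂ t : ℝ) :
    S.exactR e₀ e₁ e₂ t ≤ (8 + 4 * |κ|) * S.R e₀ e₁ e₂ t := by
  have k4 : |(4 : ℝ)| ≤ 8 + 4 * |κ| := by
    rw [abs_of_nonneg] <;> [skip; norm_num]
    have := abs_nonneg κ
    linarith
  have k2 : |(2 : ℝ)| ≤ 8 + 4 * |κ| := by
    rw [abs_of_nonneg] <;> [skip; norm_num]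
    have := abs_nonneg κ
    linarith
  have k8 : |8 + 4 * κ| ≤ 8 + 4 * |κ| := by
    refine (abs_add_le _ _).trans ?_
    rw [abs_mul]
    norm_num
  have k' : 8 + 2 * κ ≤ 8 + 4 * |κ| := by
    have := le_abs_self κ
    have := abs_nonneg κ
    linarith
  have k'' : 4 + 2 * κ ≤ 8 + 4 * |κ| := by linarith
  have k1 : 1 ≤ 8 + 4 * |κ| := by linarith [abs_nonneg κ]
  have k3 : 2 ≤ 8 + 4 * |κ| := by linarith [abs_nonneg κ]
  have i1 := mul_mul_le_mul_abs k4 (S.a 2 1 t) (e₀ * e₁)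
  have i2 := mul_mul_le_mul_abs k2 (S.a 2 0 t) (e₀ * e₂)
  have i3 := mul_mul_le_mul_abs k4 (S.a 1 0 t) (e₁ * e₂)
  have i4 := mul_mul_le_mul_abs k8 (S.a 1 0 t) (e₀ * e₁)
  have i5 := mul_mul_le_mul_abs k4 (S.b 1 0 t) (e₀ * e₁)
  have i6 := mul_le_mul_of_nonneg_right k3 (mul_nonneg (S.b_nonneg 0 t) (sq_nonneg e₁))
  have i7 := mul_le_mul_of_nonneg_right k' (mul_nonneg (S.a_nonneg 1 t) (sq_nonneg e₁))
  have i8 := mul_le_mul_of_nonneg_right k'' (mul_nonneg (S.a_nonneg 1 t) (sq_nonneg e₀))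
  have i9 := mul_le_mul_of_nonneg_right k'' (mul_nonneg (S.a_nonneg 0 t) (sq_nonneg e₁))
  have i10 := mul_le_mul_of_nonneg_right k1 (mul_nonneg (S.a_nonneg 0 t) (sq_nonneg e₂))
  have i11 : 8 * (S.a 1 1 t * e₁ ^ 2) = (8 + 2 * κ) * (S.a 1 1 t * e₁ ^ 2)
    - 2 * κ * (S.a 1 1 t * e₁ ^ 2) := by ring
  have K0 : 0 ≤ 8 + 4 * |κ| := by positivity
  have p1 := mul_nonneg K0 (mul_nonneg (abs_nonneg (S.a 2 1 t)) (sq_nonneg e₀))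
  have p2 := mul_nonneg K0 (mul_nonneg (abs_nonneg (S.a 2 0 t))
    (add_nonneg (add_nonneg (sq_nonneg e₀) (abs_nonneg (e₀ * e₁))) (sq_nonneg e₁)))
  have p3 := mul_nonneg K0 (mul_nonneg (abs_nonneg (S.a 1 0 t)) (sq_nonneg e₀))
  have p4 := mul_nonneg K0 (mul_nonneg (abs_nonneg (S.b 1 0 t)) (sq_nonneg e₀))
  have p5 := mul_le_mul_of_nonneg_right (show (4 : ℝ) ≤ 8 + 4 * |κ| by linarith [abs_nonneg κ])
    (mul_nonneg (S.a_nonneg 1 t) (sq_nonneg e₁))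
  unfold exactR R
  linarith

lemma exists_neg_exactR'_le : ∃ K, 0 ≤ K ∧ ∀ e₀ e₁ e₂ t : ℝ,
    -S.exactR' e₀ e₁ e₂ t ≤ K * S.R e₀ e₁ e₂ t := by
  obtain ⟨K, h1, h2, h3, h4, h5, h6, h7⟩ : ∃ K : ℝ, 4 ≤ K ∧ |2 * k| ≤ K ∧ |2 * k * 2| ≤ K ∧
      |-((k + 2) * (k - 2) - 2 * γ - 2 * k)| ≤ K ∧ |2 * k * γ + 2 * k * (k + 2)| ≤ K ∧
      |(-4 : ℝ)| ≤ K ∧ |(-2 : ℝ)| ≤ K := by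
    refine ⟨4 + |2 * k| + |2 * k * 2| + |-((k + 2) * (k - 2) - 2 * γ - 2 * k)| +
      |2 * k * γ + 2 * k * (k + 2)|, ?_, ?_, ?_, ?_, ?_, ?_, ?_⟩ <;>
    [skip; skip; skip; skip; skip; rw [show |(-4 : ℝ)| = 4 by norm_num];
      rw [show |(-2 : ℝ)| = 2 by norm_num]] <;>
    linarith [abs_nonneg (2 * k), abs_nonneg (2 * k * 2),
      abs_nonneg (-((k + 2) * (k - 2) - 2 * γ - 2 * k)), abs_nonneg (2 * k * γ + 2 * k * (k + 2))]
  have K0 : 0 ≤ K := by linarith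
  refine ⟨2 * K, by linarith, fun e₀ e₁ e₂ t => ?_⟩
  have i1 := mul_mul_le_mul_abs h6 (S.a 2 1 t) (e₀ * e₁)
  have i2 := mul_mul_le_mul_abs h7 (S.a 2 0 t) (e₁ ^ 2)
  have i3 := mul_mul_le_mul_abs h7 (S.a 2 0 t) (e₀ * e₂)
  have i4 := mul_mul_le_mul_abs h2 (S.a 2 1 t) (e₀ ^ 2)
  have i5 := mul_mul_le_mul_abs h3 (S.a 2 0 t) (e₀ * e₁)
  have i6 := mul_mul_le_mul_abs h4 (S.a 2 0 t) (e₀ ^ 2)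
  have i7 := mul_mul_le_mul_abs h6 (S.b 1 0 t) (e₀ * e₁)
  have i8 := mul_mul_le_mul_abs h5 (S.a 1 0 t) (e₀ ^ 2)
  have i9 := mul_mul_le_mul_abs h2 (S.b 1 0 t) (e₀ ^ 2)
  rw [abs_of_nonneg (sq_nonneg e₁)] at i2
  rw [abs_of_nonneg (sq_nonneg e₀)] at i4 i6 i8 i9
  have hR : 0 ≤ K * (S.a 1 1 t * (e₀ ^ 2 + e₁ ^ 2) + S.b 0 0 t * e₁ ^ 2
      + S.a 0 0 t * (e₁ ^ 2 + e₂ ^ 2) + |S.a 1 0 t| * (|e₀ * e₁| + |e₁ * e₂|)) := by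
    have := S.a_nonneg 1 t
    have := S.a_nonneg 0 t
    have := S.b_nonneg 0 t
    positivity
  have hR' := mul_nonneg K0 (S.R_nonneg e₀ e₁ e₂ t)
  have : K * S.R e₀ e₁ e₂ t ≥ -S.exactR' e₀ e₁ e₂ t := by
    unfold exactR' R
    linarith
  linarith

/-- The combination of the stability inequality and the equation tested with `w η²`. -/
theorem exists_integral_le (hp : 1 < p) (h₁ : 2 * κ < p * (2 * γ + 2 * k))
    (h₂ : κ ^ 2 < p * (γ * (γ + 2 * k))) :
    ∃ K, 0 < K ∧ ∀ η : ℝ → ℝ, ContDiff ℝ (⊤ : ℕ∞) η → HasCompactSupport η →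
      tsupport η ⊆ Ioi S.T₀ → ∫ t, (S.N t + S.Q t) * η t ^ 2 ≤
        K * ∫ t, S.R (η t) (deriv η t) (deriv (deriv η) t) t := by
  obtain ⟨K₂, hK₂, hR'⟩ := S.exists_neg_exactR'_le
  set K₁ := 8 + 4 * |κ| with hK₁
  have hK₁0 : 0 < K₁ := by positivity
  obtain ⟨ε, hε, e1, e2, e3⟩ : ∃ ε > 0, ε ≤ p - 1 ∧ ε ≤ p * (2 * γ + 2 * k) - 2 * κ ∧
      ε ≤ p * (γ * (γ + 2 * k)) - κ ^ 2 :=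
    ⟨min (p - 1) (min (p * (2 * γ + 2 * k) - 2 * κ) (p * (γ * (γ + 2 * k)) - κ ^ 2)),
      lt_min (by linarith) (lt_min (by linarith) (by linarith)), min_le_left _ _,
      (min_le_right _ _).trans (min_le_left _ _), (min_le_right _ _).trans (min_le_right _ _)⟩
  set K₃ := 2 + 2 * |κ| + κ ^ 2 with hK₃
  have hK₃0 : 0 < K₃ := by positivity
  refine ⟨(K₃ * ((K₁ + p * K₂) / ε) + K₁) / p + (K₁ + p * K₂) / ε, by positivity,
    fun η hη hc hs => ?_⟩
  have hη1 : ContDiff ℝ (⊤ : ℕ∞) (deriv η) := ContDiff.iterate_deriv 1 hη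
  have hη2 : ContDiff ℝ (⊤ : ℕ∞) (deriv (deriv η)) := ContDiff.iterate_deriv 2 hη
  have ca := S.continuous_a
  have cb := S.continuous_b
  have cc := S.continuous_c
  have cN := S.continuous_N
  have cQ := S.continuous_Q
  have k0 := hη.continuous
  have k1 := hη1.continuous
  have k2 := hη2.continuous
  have z0 : ∀ t, t ∉ tsupport η → η t = 0 := fun t ht => image_eq_zero_of_notMem_tsupport ht
  have z1 : ∀ t, t ∉ tsupport η → deriv η t = 0 := fun t => deriv_eq_zero_of_notMem_tsupport
  have z2 : ∀ t, t ∉ tsupport η → deriv (deriv η) t = 0 :=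
    fun t => deriv_deriv_eq_zero_of_notMem_tsupport
  have iN : Integrable fun t => S.N t * η t ^ 2 :=
    Continuous.integrable_of_forall_notMem_tsupport (by fun_prop) hc fun t ht => by simp [z0 t ht]
  have iQ : Integrable fun t => S.Q t * η t ^ 2 :=
    Continuous.integrable_of_forall_notMem_tsupport (by fun_prop) hc fun t ht => by simp [z0 t ht]
  have iR : Integrable fun t => S.R (η t) (deriv η t) (deriv (deriv η) t) t :=
    Continuous.integrable_of_forall_notMem_tsupport (S.continuous_R k0 k1 k2) hc
      fun t ht => by simp [R, z0 t ht, z1 t ht, z2 t ht]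
  have A := S.integral_stable_le hη hc hs
  have iA : Integrable fun t => (S.c t + S.a 2 2 t + 2 * S.b 1 1 t + 2 * κ * S.b 0 0 t
      + κ ^ 2 * S.a 0 0 t) * η t ^ 2 + S.exactR (η t) (deriv η t) (deriv (deriv η) t) t :=
    Continuous.integrable_of_forall_notMem_tsupport (by unfold exactR; fun_prop) hc
      fun t ht => by simp [exactR, z0 t ht, z1 t ht, z2 t ht]
  have iB : Integrable fun t => (S.c t + S.a 2 2 t + 2 * S.b 1 1 t
      + (2 * γ + 2 * k) * S.b 0 0 t + γ * (γ + 2 * k) * S.a 0 0 t) * η t ^ 2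
      + S.exactR' (η t) (deriv η t) (deriv (deriv η) t) t :=
    Continuous.integrable_of_forall_notMem_tsupport (by unfold exactR'; fun_prop) hc
      fun t ht => by simp [exactR', z0 t ht, z1 t ht, z2 t ht]
  have hQ : ε * ∫ t, S.Q t * η t ^ 2 ≤
      (K₁ + p * K₂) * ∫ t, S.R (η t) (deriv η t) (deriv (deriv η) t) t := by
    have A' := A
    rw [S.integral_N_eq hη hc, ← integral_const_mul] at A'
    have : ∫ t, (ε * (S.Q t * η t ^ 2) -
        (K₁ + p * K₂) * S.R (η t) (deriv η t) (deriv (deriv η) t) t) ≤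
        (∫ t, p * ((S.c t + S.a 2 2 t + 2 * S.b 1 1 t
          + (2 * γ + 2 * k) * S.b 0 0 t + γ * (γ + 2 * k) * S.a 0 0 t) * η t ^ 2
          + S.exactR' (η t) (deriv η t) (deriv (deriv η) t) t)) -
        ∫ t, ((S.c t + S.a 2 2 t + 2 * S.b 1 1 t + 2 * κ * S.b 0 0 t
          + κ ^ 2 * S.a 0 0 t) * η t ^ 2 + S.exactR (η t) (deriv η t) (deriv (deriv η) t) t) := by
      rw [← integral_sub (iB.const_mul p) iA]
      refine integral_mono ((iQ.const_mul _).sub (iR.const_mul _)) ((iB.const_mul p).sub iA)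
        fun t => ?_
      have r1 := S.exactR_le (η t) (deriv η t) (deriv (deriv η) t) t
      have r2 := mul_le_mul_of_nonneg_left
        (hR' (η t) (deriv η t) (deriv (deriv η) t) t) (by linarith : 0 ≤ p)
      have q1 := mul_le_mul_of_nonneg_right e1 (mul_nonneg (S.c_nonneg t) (sq_nonneg (η t)))
      have q2 := mul_le_mul_of_nonneg_right e1 (mul_nonneg (S.a_nonneg 2 t) (sq_nonneg (η t)))
      have q3 := mul_le_mul_of_nonneg_right (show ε ≤ 2 * (p - 1) by linarith)
        (mul_nonneg (S.b_nonneg 1 t) (sq_nonneg (η t)))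
      have q4 := mul_le_mul_of_nonneg_right e2 (mul_nonneg (S.b_nonneg 0 t) (sq_nonneg (η t)))
      have q5 := mul_le_mul_of_nonneg_right e3 (mul_nonneg (S.a_nonneg 0 t) (sq_nonneg (η t)))
      simp only [Q]
      linarith
    rw [integral_sub (iQ.const_mul _) (iR.const_mul _), integral_const_mul, integral_const_mul]
      at this
    linarith
  have hQ' : ∫ t, S.Q t * η t ^ 2 ≤
      (K₁ + p * K₂) / ε * ∫ t, S.R (η t) (deriv η t) (deriv (deriv η) t) t := by
    rw [div_mul_eq_mul_div, le_div_iff₀ hε]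
    linarith
  have hN : p * ∫ t, S.N t * η t ^ 2 ≤ K₃ * (∫ t, S.Q t * η t ^ 2) +
      K₁ * ∫ t, S.R (η t) (deriv η t) (deriv (deriv η) t) t := by
    refine A.trans ?_
    rw [← integral_const_mul, ← integral_const_mul,
      ← integral_add (iQ.const_mul _) (iR.const_mul _)]
    refine integral_mono iA ((iQ.const_mul _).add (iR.const_mul _)) fun t => ?_
    have r1 := S.exactR_le (η t) (deriv η t) (deriv (deriv η) t) t
    have f1 : 1 ≤ K₃ := by linarith [abs_nonneg κ, sq_nonneg κ]
    have f2 : 2 ≤ K₃ := by linarith [abs_nonneg κ, sq_nonneg κ]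
    have f3 : 2 * κ ≤ K₃ := by linarith [le_abs_self κ, sq_nonneg κ]
    have f4 : κ ^ 2 ≤ K₃ := by linarith [abs_nonneg κ, sq_nonneg κ]
    have q1 := mul_le_mul_of_nonneg_right f1 (mul_nonneg (S.c_nonneg t) (sq_nonneg (η t)))
    have q2 := mul_le_mul_of_nonneg_right f1 (mul_nonneg (S.a_nonneg 2 t) (sq_nonneg (η t)))
    have q3 := mul_le_mul_of_nonneg_right f2 (mul_nonneg (S.b_nonneg 1 t) (sq_nonneg (η t)))
    have q4 := mul_le_mul_of_nonneg_right f3 (mul_nonneg (S.b_nonneg 0 t) (sq_nonneg (η t)))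
    have q5 := mul_le_mul_of_nonneg_right f4 (mul_nonneg (S.a_nonneg 0 t) (sq_nonneg (η t)))
    simp only [Q]
    linarith
  have hN' : ∫ t, S.N t * η t ^ 2 ≤ (K₃ * ((K₁ + p * K₂) / ε) + K₁) / p *
      ∫ t, S.R (η t) (deriv η t) (deriv (deriv η) t) t := by
    rw [div_mul_eq_mul_div, le_div_iff₀ (by linarith)]
    have := mul_le_mul_of_nonneg_left hQ' hK₃0.le
    linarith
  have : ∫ t, (S.N t + S.Q t) * η t ^ 2 = (∫ t, S.N t * η t ^ 2) + ∫ t, S.Q t * η t ^ 2 := by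
    rw [← integral_add iN iQ]
    simp only [add_mul]
  rw [this]
  linarith

end SphericalMoments

/-- Weighted arithmetic–geometric mean inequality for a form dominated by Cauchy–Schwarz. -/
lemma abs_mul_mul_le_of_sq_le {u A B δ x y : ℝ} (hA : 0 ≤ A) (hB : 0 ≤ B) (hδ : 0 < δ)
    (h : u ^ 2 ≤ A * B) : |u| * (x * y) ≤ δ * (A * x ^ 2) + 1 / (4 * δ) * (B * y ^ 2) := by
  have hP : 0 ≤ δ * (A * x ^ 2) := by positivity
  have hQ : 0 ≤ 1 / (4 * δ) * (B * y ^ 2) := by positivity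
  refine (le_abs_self _).trans (abs_le_of_sq_le_sq ?_ (by positivity))
  have e : 4 * ((δ * (A * x ^ 2)) * (1 / (4 * δ) * (B * y ^ 2))) = A * B * (x * y) ^ 2 := by
    field_simp
  have h2 : (|u| * (x * y)) ^ 2 ≤ A * B * (x * y) ^ 2 := by
    rw [mul_pow, sq_abs]
    gcongr
  nlinarith [sq_nonneg (δ * (A * x ^ 2) - 1 / (4 * δ) * (B * y ^ 2))]

namespace SphericalMoments

variable {k γ κ p : ℝ} (S : SphericalMoments k γ κ p)

lemma R_le_of_abs_le {B t p₀ p₁ p₂ e₀ e₁ e₂ : ℝ} (hB : 1 ≤ B) (h2 : 0 ≤ p₂) (h21 : p₂ ≤ p₁)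
    (h10 : p₁ ≤ p₀) (hsq : p₁ ^ 2 = p₂ * p₀) (he₀ : |e₀| ≤ p₂) (he₁ : |e₁| ≤ B * p₁)
    (he₂ : |e₂| ≤ B * p₀) :
    S.R e₀ e₁ e₂ t ≤ 4 * B ^ 2 * (|S.a 2 1 t| * (p₂ * p₁) + |S.a 2 0 t| * (p₂ * p₀)
      + |S.a 1 0 t| * (p₁ * p₀) + S.a 1 1 t * p₁ ^ 2 + |S.b 1 0 t| * (p₂ * p₁)
      + S.b 0 0 t * p₁ ^ 2 + S.a 0 0 t * p₀ ^ 2) := by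
  have h1 : 0 ≤ p₁ := h2.trans h21
  have h0 : 0 ≤ p₀ := h1.trans h10
  have hBB : 1 ≤ B ^ 2 := one_le_pow₀ hB
  have hB' : B ≤ B ^ 2 := by nlinarith
  have m21 : p₂ ^ 2 ≤ B ^ 2 * (p₂ * p₁) := by
    have : p₂ * p₂ ≤ p₂ * p₁ := by gcongr
    nlinarith [mul_nonneg h2 h1]
  have m20 : p₂ ^ 2 ≤ B ^ 2 * (p₂ * p₀) := by
    have : p₂ * p₂ ≤ p₂ * p₀ := by gcongr; linarith
    nlinarith [mul_nonneg h2 h0]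
  have m2110 : p₂ * p₁ ≤ p₁ * p₀ := by rw [mul_comm p₂]; gcongr; linarith
  have m2120 : p₂ * p₁ ≤ p₂ * p₀ := by gcongr
  have n00 : e₀ ^ 2 ≤ p₂ ^ 2 := sq_le_sq' (by linarith [neg_le_of_abs_le he₀])
    (le_of_abs_le he₀)
  have n11 : e₁ ^ 2 ≤ B ^ 2 * p₁ ^ 2 := by
    rw [← mul_pow]
    exact sq_le_sq' (by linarith [neg_le_of_abs_le he₁]) (le_of_abs_le he₁)
  have n22 : e₂ ^ 2 ≤ B ^ 2 * p₀ ^ 2 := by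
    rw [← mul_pow]
    exact sq_le_sq' (by linarith [neg_le_of_abs_le he₂]) (le_of_abs_le he₂)
  have n01 : |e₀ * e₁| ≤ B ^ 2 * (p₂ * p₁) := by
    rw [abs_mul]
    calc |e₀| * |e₁| ≤ p₂ * (B * p₁) := by gcongr
      _ = B * (p₂ * p₁) := by ring
      _ ≤ _ := by gcongr
  have n02 : |e₀ * e₂| ≤ B ^ 2 * (p₂ * p₀) := by
    rw [abs_mul]
    calc |e₀| * |e₂| ≤ p₂ * (B * p₀) := by gcongr
      _ = B * (p₂ * p₀) := by ring
      _ ≤ _ := by gcongr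
  have n12 : |e₁ * e₂| ≤ B ^ 2 * (p₁ * p₀) := by
    rw [abs_mul]
    calc |e₁| * |e₂| ≤ (B * p₁) * (B * p₀) := by gcongr
      _ = _ := by ring
  have a11 := S.a_nonneg 1 t
  have a00 := S.a_nonneg 0 t
  have b00 := S.b_nonneg 0 t
  have m22 : p₂ ^ 2 ≤ B ^ 2 * p₁ ^ 2 := by
    have : p₂ ^ 2 ≤ p₁ ^ 2 := by gcongr
    nlinarith [sq_nonneg p₁]
  have m10 : B ^ 2 * p₁ ^ 2 ≤ B ^ 2 * p₀ ^ 2 := by gcongr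
  have k1 : B ^ 2 * (p₂ * p₁) ≤ B ^ 2 * (p₁ * p₀) := by gcongr
  have k2 : B ^ 2 * (p₂ * p₁) ≤ B ^ 2 * (p₂ * p₀) := by gcongr
  have q : 0 ≤ B ^ 2 * (p₂ * p₁) := by positivity
  have q' : 0 ≤ B ^ 2 * p₁ ^ 2 := by positivity
  have r1 := mul_le_mul_of_nonneg_left (show e₀ ^ 2 + |e₀ * e₁| ≤ 4 * (B ^ 2 * (p₂ * p₁)) by
    linarith) (abs_nonneg (S.a 2 1 t))
  have r2 := mul_le_mul_of_nonneg_left (show e₀ ^ 2 + |e₀ * e₁| + |e₀ * e₂| + e₁ ^ 2 ≤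
    4 * (B ^ 2 * (p₂ * p₀)) by rw [hsq] at n11; linarith) (abs_nonneg (S.a 2 0 t))
  have r3 := mul_le_mul_of_nonneg_left (show e₀ ^ 2 + |e₀ * e₁| + |e₁ * e₂| ≤
    4 * (B ^ 2 * (p₁ * p₀)) by linarith) (abs_nonneg (S.a 1 0 t))
  have r4 := mul_le_mul_of_nonneg_left (show e₀ ^ 2 + e₁ ^ 2 ≤ 4 * (B ^ 2 * p₁ ^ 2) by
    linarith) a11
  have r5 := mul_le_mul_of_nonneg_left (show e₀ ^ 2 + |e₀ * e₁| ≤ 4 * (B ^ 2 * (p₂ * p₁)) by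
    linarith) (abs_nonneg (S.b 1 0 t))
  have r6 := mul_le_mul_of_nonneg_left (show e₁ ^ 2 ≤ 4 * (B ^ 2 * p₁ ^ 2) by linarith) b00
  have r7 := mul_le_mul_of_nonneg_left (show e₁ ^ 2 + e₂ ^ 2 ≤ 4 * (B ^ 2 * p₀ ^ 2) by
    linarith) a00
  unfold R
  linarith

lemma exists_R_le {B δ : ℝ} (hB : 1 ≤ B) (hδ : 0 < δ) : ∃ C, 0 ≤ C ∧
    ∀ t p₀ p₁ p₂ e₀ e₁ e₂ : ℝ, 0 ≤ p₂ → p₂ ≤ p₁ → p₁ ≤ p₀ → p₁ ^ 2 = p₂ * p₀ → |e₀| ≤ p₂ →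
      |e₁| ≤ B * p₁ → |e₂| ≤ B * p₀ → S.R e₀ e₁ e₂ t ≤
        δ * (S.Q t * p₂ ^ 2) + C * (S.a 1 1 t * p₁ ^ 2 + S.a 0 0 t * p₀ ^ 2) := by
  obtain ⟨ε, hε, hεδ⟩ : ∃ ε > 0, 4 * B ^ 2 * (2 * ε) = δ :=
    ⟨δ / (8 * B ^ 2), by positivity, by field_simp; norm_num⟩
  set E := 1 / (4 * ε) with hE
  have hE0 : 0 < E := by positivity
  set ε' := ε / (1 + E) with hε'
  have hε'0 : 0 < ε' := by positivity
  set E' := 1 / (4 * ε') with hE'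
  have hE'0 : 0 < E' := by positivity
  have hee : (1 + E) * ε' = ε := by rw [hε']; field_simp
  refine ⟨4 * B ^ 2 * (E + 1 + 1 + (1 + E) * E' + 1), by positivity, ?_⟩
  intro t p₀ p₁ p₂ e₀ e₁ e₂ h2 h21 h10 hsq he₀ he₁ he₂
  refine (S.R_le_of_abs_le hB h2 h21 h10 hsq he₀ he₁ he₂).trans ?_
  have a00 := S.a_nonneg 0 t
  have a11 := S.a_nonneg 1 t
  have a22 := S.a_nonneg 2 t
  have b00 := S.b_nonneg 0 t
  have b11 := S.b_nonneg 1 t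
  have c0 := S.c_nonneg t
  have y1 := abs_mul_mul_le_of_sq_le (x := p₂) (y := p₁) a22 a11 hε (S.a_sq_le 2 1 t)
  have y2 := abs_mul_mul_le_of_sq_le (x := p₂) (y := p₀) a22 a00 hε (S.a_sq_le 2 0 t)
  have y3 := abs_mul_mul_le_of_sq_le (x := p₁) (y := p₀) a11 a00 one_pos (S.a_sq_le 1 0 t)
  have y4 := abs_mul_mul_le_of_sq_le (x := p₂) (y := p₁) b11 b00 hε (S.b_sq_le 1 0 t)
  have y5 := abs_mul_mul_le_of_sq_le (x := p₂) (y := p₀) c0 a00 hε'0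
    ((S.b_sq_le_a_mul_c 0 t).trans_eq (mul_comm _ _))
  rw [abs_of_nonneg b00, ← hsq, ← hE'] at y5
  rw [← hE] at y1 y2 y4
  have y6 := mul_le_mul_of_nonneg_left y5 (show 0 ≤ 1 + E by linarith)
  have z : (1 + E) * (ε' * (S.c t * p₂ ^ 2) + E' * (S.a 0 0 t * p₀ ^ 2)) =
      ε * (S.c t * p₂ ^ 2) + (1 + E) * E' * (S.a 0 0 t * p₀ ^ 2) := by
    rw [← hee]; ring
  rw [z] at y6
  have f1 : 0 ≤ S.a 0 0 t * p₀ ^ 2 := by positivity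
  have f2 : 0 ≤ S.a 1 1 t * p₁ ^ 2 := by positivity
  have f3 : 0 ≤ S.c t * p₂ ^ 2 := by positivity
  have f4 : 0 ≤ S.b 0 0 t * p₂ ^ 2 := by positivity
  have f5 : 0 ≤ S.a 0 0 t * p₂ ^ 2 := by positivity
  have f6 : 0 ≤ S.b 1 1 t * p₂ ^ 2 := by positivity
  have g1 : 0 ≤ (1 + E) * E' * (S.a 1 1 t * p₁ ^ 2) := by positivity
  have l1 := mul_nonneg hE0.le f1
  have l2 := mul_nonneg hE0.le f2
  have l3 := mul_nonneg hε.le f3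
  have l4 := mul_nonneg hε.le f4
  have l5 := mul_nonneg hε.le f5
  have l6 := mul_nonneg hε.le f6
  rw [← hεδ, mul_assoc (4 * B ^ 2), mul_assoc (4 * B ^ 2) (E + 1 + 1 + (1 + E) * E' + 1), ← mul_add]
  refine mul_le_mul_of_nonneg_left ?_ (by positivity)
  have hQ : S.Q t * p₂ ^ 2 = S.c t * p₂ ^ 2 + S.a 2 2 t * p₂ ^ 2 + S.b 1 1 t * p₂ ^ 2
    + S.b 0 0 t * p₂ ^ 2 + S.a 0 0 t * p₂ ^ 2 := by unfold Q; ring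
  rw [hQ]
  linarith

/-- Interpolation between the moment of order `p + 1` and a constant, in the presence of powers of
a cut-off function. -/
lemma exists_a_mul_pow_le (hp : 1 < p) {m : ℕ} (hm : 4 ≤ m * (p - 1)) {δ : ℝ} (hδ : 0 < δ) :
    ∃ C, 0 ≤ C ∧ ∀ t x : ℝ, 0 ≤ x → x ≤ 1 →
      S.a 0 0 t * (x ^ m) ^ 2 ≤ δ * (S.N t * (x ^ (m + 2)) ^ 2) + C := by
  have hp' : 0 < p - 1 := by linarith
  refine ⟨(δ ^ (1 / (p - 1))) ^ (-2 : ℝ) * S.area, by have := S.area_nonneg; positivity, ?_⟩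
  intro t x hx hx1
  have hm0 : m ≠ 0 := by
    rintro rfl
    norm_num at hm
  have hN := S.N_nonneg t
  have ha := S.area_nonneg
  rcases hx.eq_or_lt with rfl | hx
  · rw [zero_pow hm0]
    simp only [ne_eq, OfNat.ofNat_ne_zero, not_false_eq_true, zero_pow, mul_zero]
    positivity
  have h := S.a_le_N (δ ^ (1 / (p - 1)) * x ^ (4 / (p - 1))) (by positivity) t
  have e1 : (δ ^ (1 / (p - 1)) * x ^ (4 / (p - 1))) ^ (p - 1) = δ * x ^ 4 := by
    rw [Real.mul_rpow (by positivity) (by positivity), ← Real.rpow_mul hδ.le,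
      ← Real.rpow_mul hx.le, one_div_mul_cancel hp'.ne', div_mul_cancel₀ _ hp'.ne', Real.rpow_one]
    norm_cast
  have e3 : (δ ^ (1 / (p - 1)) * x ^ (4 / (p - 1))) ^ (-2 : ℝ) * (x ^ m) ^ 2 ≤
      (δ ^ (1 / (p - 1))) ^ (-2 : ℝ) := by
    rw [Real.mul_rpow (by positivity) (by positivity), mul_assoc]
    refine mul_le_of_le_one_right (by positivity) ?_
    rw [← Real.rpow_mul hx.le, ← pow_mul, ← Real.rpow_natCast, ← Real.rpow_add hx]
    refine Real.rpow_le_one hx.le hx1 ?_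
    push_cast
    have : 4 / (p - 1) ≤ m := by rw [div_le_iff₀ hp']; exact hm
    linarith
  rw [e1] at h
  calc S.a 0 0 t * (x ^ m) ^ 2
      ≤ (δ * x ^ 4 * S.N t + (δ ^ (1 / (p - 1)) * x ^ (4 / (p - 1))) ^ (-2 : ℝ) * S.area)
        * (x ^ m) ^ 2 := by gcongr
    _ = δ * (S.N t * (x ^ (m + 2)) ^ 2)
        + (δ ^ (1 / (p - 1)) * x ^ (4 / (p - 1))) ^ (-2 : ℝ) * (x ^ m) ^ 2 * S.area := by ring
    _ ≤ _ := by gcongr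

end SphericalMoments

/-- Existence of a smooth cut-off function on the line. -/
lemma exists_smooth_cutoff : ∃ (ξ : ℝ → ℝ) (B : ℝ), ContDiff ℝ (⊤ : ℕ∞) ξ ∧ 1 ≤ B ∧
    tsupport ξ = Icc (-2) 2 ∧ (∀ t ∈ Icc (-1 : ℝ) 1, ξ t = 1) ∧ (∀ t, 0 ≤ ξ t) ∧
    (∀ t, ξ t ≤ 1) ∧ (∀ t, |deriv ξ t| ≤ B) ∧ ∀ t, |deriv (deriv ξ) t| ≤ B := by
  let f : ContDiffBump (0 : ℝ) := ⟨1, 2, one_pos, one_lt_two⟩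
  have hf : ContDiff ℝ (⊤ : ℕ∞) f := f.contDiff
  have h1 : ContDiff ℝ (⊤ : ℕ∞) (deriv f) := ContDiff.iterate_deriv 1 hf
  have h2 : ContDiff ℝ (⊤ : ℕ∞) (deriv (deriv f)) := ContDiff.iterate_deriv 2 hf
  obtain ⟨B₁, hB₁⟩ := f.hasCompactSupport.deriv.exists_bound_of_continuous h1.continuous
  obtain ⟨B₂, hB₂⟩ := f.hasCompactSupport.deriv.deriv.exists_bound_of_continuous h2.continuous
  refine ⟨f, max 1 (max B₁ B₂), hf, le_max_left _ _, ?_, ?_, fun t => f.nonneg, fun t => f.le_one,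
    fun t => (hB₁ t).trans ((le_max_left _ _).trans (le_max_right _ _)),
    fun t => (hB₂ t).trans ((le_max_right _ _).trans (le_max_right _ _))⟩
  · rw [f.tsupport_eq, Real.closedBall_eq_Icc]
    norm_num [f]
  · intro t ht
    refine f.one_of_mem_closedBall ?_
    rw [Real.closedBall_eq_Icc]
    simpa [f] using ht

lemma exists_abs_deriv_pow_le {ξ : ℝ → ℝ} {B : ℝ} (hξ : ContDiff ℝ (⊤ : ℕ∞) ξ) (hB : 1 ≤ B)
    (h0 : ∀ t, 0 ≤ ξ t) (h1 : ∀ t, ξ t ≤ 1) (hd : ∀ t, |deriv ξ t| ≤ B)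
    (hdd : ∀ t, |deriv (deriv ξ) t| ≤ B) (m : ℕ) : ∃ C, 1 ≤ C ∧
      (∀ t, |deriv (fun t => ξ t ^ (m + 2)) t| ≤ C * ξ t ^ (m + 1)) ∧
      ∀ t, |deriv (deriv fun t => ξ t ^ (m + 2)) t| ≤ C * ξ t ^ m := by
  have hξ' : ContDiff ℝ (⊤ : ℕ∞) (deriv ξ) := ContDiff.iterate_deriv 1 hξ
  have d0 : ∀ t, HasDerivAt ξ (deriv ξ t) t := fun t =>
    ((hξ.differentiable (by simp)).differentiableAt).hasDerivAt
  have d1 : ∀ t, HasDerivAt (deriv ξ) (deriv (deriv ξ) t) t := fun t =>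
    ((hξ'.differentiable (by simp)).differentiableAt).hasDerivAt
  have e1 : deriv (fun t => ξ t ^ (m + 2)) =
      fun t => ((m : ℝ) + 2) * ξ t ^ (m + 1) * deriv ξ t := by
    funext t
    refine HasDerivAt.deriv (((d0 t).pow (m + 2)).congr_deriv ?_)
    push_cast
    simp
  have e2 : ∀ t, deriv (deriv fun t => ξ t ^ (m + 2)) t =
      ((m : ℝ) + 2) * (((m : ℝ) + 1) * ξ t ^ m * deriv ξ t) * deriv ξ t
        + ((m : ℝ) + 2) * ξ t ^ (m + 1) * deriv (deriv ξ) t := by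
    intro t
    rw [e1]
    refine HasDerivAt.deriv
      (((((d0 t).pow (m + 1)).const_mul ((m : ℝ) + 2)).mul (d1 t)).congr_deriv ?_)
    push_cast
    simp
  refine ⟨((m : ℝ) + 2) * (((m : ℝ) + 1) * B ^ 2 + B), ?_, fun t => ?_, fun t => ?_⟩
  · nlinarith [(Nat.cast_nonneg m : (0 : ℝ) ≤ m), mul_nonneg (Nat.cast_nonneg m : (0 : ℝ) ≤ m)
      (sq_nonneg B), sq_nonneg B]
  · rw [e1, abs_mul, abs_of_nonneg (mul_nonneg (by positivity) (pow_nonneg (h0 t) _))]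
    have := mul_le_mul_of_nonneg_left (hd t)
      (mul_nonneg (by positivity : (0 : ℝ) ≤ (m : ℝ) + 2) (pow_nonneg (h0 t) (m + 1)))
    refine this.trans ?_
    have h := mul_nonneg (by positivity : (0 : ℝ) ≤ ((m : ℝ) + 2) * (((m : ℝ) + 1) * B ^ 2))
      (pow_nonneg (h0 t) (m + 1))
    linarith
  · rw [e2]
    have hb0 : 0 ≤ B := by linarith
    have p0 := pow_nonneg (h0 t) m
    have p1 : ξ t ^ (m + 1) ≤ ξ t ^ m := pow_le_pow_of_le_one (h0 t) (h1 t) (by omega)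
    have p1' := pow_nonneg (h0 t) (m + 1)
    calc _ ≤ |((m : ℝ) + 2) * (((m : ℝ) + 1) * ξ t ^ m * deriv ξ t) * deriv ξ t|
        + |((m : ℝ) + 2) * ξ t ^ (m + 1) * deriv (deriv ξ) t| := abs_add_le _ _
      _ = ((m : ℝ) + 2) * (((m : ℝ) + 1) * ξ t ^ m * |deriv ξ t|) * |deriv ξ t|
        + ((m : ℝ) + 2) * ξ t ^ (m + 1) * |deriv (deriv ξ) t| := by
          simp only [abs_mul, abs_of_nonneg p0, abs_of_nonneg p1',
            abs_of_nonneg (by positivity : (0 : ℝ) ≤ (m : ℝ) + 2),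
            abs_of_nonneg (by positivity : (0 : ℝ) ≤ (m : ℝ) + 1)]
      _ ≤ ((m : ℝ) + 2) * (((m : ℝ) + 1) * ξ t ^ m * B) * B
        + ((m : ℝ) + 2) * ξ t ^ m * B := by
          gcongr <;> first | exact hd t | exact hdd t
      _ = _ := by ring

lemma integral_le_of_forall_le_add {f g₁ g₂ g₃ : ℝ → ℝ} {c₁ c₂ c₃ : ℝ} (hf : Integrable f)
    (h₁ : Integrable g₁) (h₂ : Integrable g₂) (h₃ : Integrable g₃)
    (h : ∀ t, f t ≤ c₁ * g₁ t + c₂ * g₂ t + c₃ * g₃ t) :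
    ∫ t, f t ≤ c₁ * (∫ t, g₁ t) + c₂ * (∫ t, g₂ t) + c₃ * ∫ t, g₃ t := by
  have h12 : Integrable fun t => c₁ * g₁ t + c₂ * g₂ t := (h₁.const_mul c₁).add (h₂.const_mul c₂)
  have h3 : Integrable fun t => c₃ * g₃ t := h₃.const_mul c₃
  refine (integral_mono hf (h12.add h3) h).trans_eq ?_
  rw [← integral_const_mul, ← integral_const_mul, ← integral_const_mul,
    ← integral_add (h₁.const_mul c₁) (h₂.const_mul c₂), ← integral_add h12 h3]
  rfl

namespace SphericalMoments

variable {k γ κ p : ℝ} (S : SphericalMoments k γ κ p)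

lemma integral_a_one_one_eq {ν : ℝ → ℝ} (hν : ContDiff ℝ (⊤ : ℕ∞) ν) (hc : HasCompactSupport ν) :
    Integrable (fun t => S.a 1 1 t * ν t - 1 / 2 * S.a 0 0 t * deriv (deriv ν) t
      + S.a 2 0 t * ν t) ∧
    ∫ t, (S.a 1 1 t * ν t - 1 / 2 * S.a 0 0 t * deriv (deriv ν) t + S.a 2 0 t * ν t) = 0 := by
  have hν1 : ContDiff ℝ (⊤ : ℕ∞) (deriv ν) := ContDiff.iterate_deriv 1 hν
  have hν2 : ContDiff ℝ (⊤ : ℕ∞) (deriv (deriv ν)) := ContDiff.iterate_deriv 2 hν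
  have c0 := hν.continuous
  have c1 := hν1.continuous
  have c2 := hν2.continuous
  have ca := S.continuous_a
  have d0 : ∀ t, HasDerivAt ν (deriv ν t) t := fun t =>
    ((hν.differentiable (by simp)).differentiableAt).hasDerivAt
  have d1 : ∀ t, HasDerivAt (deriv ν) (deriv (deriv ν) t) t := fun t =>
    ((hν1.differentiable (by simp)).differentiableAt).hasDerivAt
  have key : ∀ t, HasDerivAt (fun t => S.a 1 0 t * ν t - 1 / 2 * S.a 0 0 t * deriv ν t)
      (S.a 1 1 t * ν t - 1 / 2 * S.a 0 0 t * deriv (deriv ν) t + S.a 2 0 t * ν t) t := by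
    intro t
    have h := ((S.hasDerivAt_a 1 0 t).mul (d0 t)).sub
      (((S.hasDerivAt_a 0 0 t).const_mul (1 / 2)).mul (d1 t))
    refine h.congr_deriv ?_
    rw [S.a_symm 0 1]
    ring
  have i1 : Integrable (fun t => S.a 1 1 t * ν t - 1 / 2 * S.a 0 0 t * deriv (deriv ν) t
      + S.a 2 0 t * ν t) := by
    refine Continuous.integrable_of_forall_notMem_tsupport (by fun_prop) hc fun t ht => ?_
    rw [image_eq_zero_of_notMem_tsupport ht, deriv_deriv_eq_zero_of_notMem_tsupport ht]
    ring
  refine ⟨i1, integral_eq_zero_of_hasDerivAt_of_integrable key i1 ?_⟩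
  refine Continuous.integrable_of_forall_notMem_tsupport (by fun_prop) hc fun t ht => ?_
  rw [image_eq_zero_of_notMem_tsupport ht, deriv_eq_zero_of_notMem_tsupport ht]
  ring

set_option maxHeartbeats 1000000 in
/-- Uniform local bounds far from the origin. -/
theorem exists_integral_interval_le (hp : 1 < p) (h₁ : 2 * κ < p * (2 * γ + 2 * k))
    (h₂ : κ ^ 2 < p * (γ * (γ + 2 * k))) : ∃ C, ∀ T, S.T₀ + 2 < T →
      ∫ t in (T - 1)..(T + 1), (S.N t + S.Q t + S.a 1 1 t) ≤ C := by
  obtain ⟨K, hK, hS⟩ := S.exists_integral_le hp h₁ h₂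
  obtain ⟨m, hm⟩ : ∃ m : ℕ, 4 ≤ m * (p - 1) := by
    obtain ⟨m, hm⟩ := exists_nat_ge (4 / (p - 1))
    exact ⟨m, by rwa [div_le_iff₀ (by linarith)] at hm⟩
  obtain ⟨ξ, B, hξ, hB, hsupp, hone, h0, h1, hd, hdd⟩ := exists_smooth_cutoff
  obtain ⟨B₁, hB₁, hη1, hη2⟩ := exists_abs_deriv_pow_le hξ hB h0 h1 hd hdd m
  obtain ⟨B₂, hB₂, -, hν2⟩ := exists_abs_deriv_pow_le hξ hB h0 h1 hd hdd (2 * m)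
  obtain ⟨C₁, hC₁, hR⟩ := S.exists_R_le hB₁ (show 0 < 1 / (4 * K) by positivity)
  set δ := 1 / (4 * K * (C₁ + 1)) with hδ
  have hδ0 : 0 < δ := by positivity
  set C₂ := B₂ / 2 + 1 / (4 * δ) with hC₂
  have hC₂0 : 0 ≤ C₂ := by positivity
  set δ' := 1 / (2 * K * (C₁ * (C₂ + 1) + 1)) with hδ'
  have hδ'0 : 0 < δ' := by positivity
  obtain ⟨C₃, hC₃, ha⟩ := S.exists_a_mul_pow_le hp hm hδ'0
  refine ⟨(1 + (δ + C₂ * δ')) * (2 * K * (C₁ * (C₂ + 1) * C₃) * 4) + C₂ * C₃ * 4, fun T hT => ?_⟩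
  set χ : ℝ → ℝ := fun t => ξ (t - T) with hχ
  set η : ℝ → ℝ := fun t => χ t ^ (m + 2) with hη
  set ν : ℝ → ℝ := fun t => χ t ^ (2 * m + 2) with hν
  have hχs : ContDiff ℝ (⊤ : ℕ∞) χ := hξ.comp (contDiff_id.sub contDiff_const)
  have hηs : ContDiff ℝ (⊤ : ℕ∞) η := hχs.pow _
  have hνs : ContDiff ℝ (⊤ : ℕ∞) ν := hχs.pow _
  have hχ0 : ∀ t, t ∉ Icc (T - 2) (T + 2) → χ t = 0 := fun t ht => by
    refine image_eq_zero_of_notMem_tsupport (f := ξ) ?_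
    rw [hsupp]
    exact fun h => ht ⟨by linarith [h.1], by linarith [h.2]⟩
  have hη0 : ∀ t, t ∉ Icc (T - 2) (T + 2) → η t = 0 := fun t ht => by
    simp only [hη, hχ0 t ht]
    exact zero_pow (by omega)
  have hν0 : ∀ t, t ∉ Icc (T - 2) (T + 2) → ν t = 0 := fun t ht => by
    simp only [hν, hχ0 t ht]
    exact zero_pow (by omega)
  have hηc : HasCompactSupport η := HasCompactSupport.intro isCompact_Icc hη0
  have hνc : HasCompactSupport ν := HasCompactSupport.intro isCompact_Icc hν0
  have hηt : tsupport η ⊆ Icc (T - 2) (T + 2) :=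
    closure_minimal (fun t ht => by by_contra h; exact ht (hη0 t h)) isClosed_Icc
  have hνt : tsupport ν ⊆ Icc (T - 2) (T + 2) :=
    closure_minimal (fun t ht => by by_contra h; exact ht (hν0 t h)) isClosed_Icc
  have key := hS η hηs hηc (hηt.trans fun t ht => by
    have := ht.1
    simp only [mem_Ioi]
    linarith)
  have dη1 : deriv η = fun t => deriv (fun s => ξ s ^ (m + 2)) (t - T) := by
    funext t
    exact deriv_comp_sub_const (fun s => ξ s ^ (m + 2)) T t
  have dη2 : deriv (deriv η) = fun t => deriv (deriv fun s => ξ s ^ (m + 2)) (t - T) := by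
    rw [dη1]
    funext t
    exact deriv_comp_sub_const (deriv fun s => ξ s ^ (m + 2)) T t
  have dν2 : deriv (deriv ν) = fun t => deriv (deriv fun s => ξ s ^ (2 * m + 2)) (t - T) := by
    have : deriv ν = fun t => deriv (fun s => ξ s ^ (2 * m + 2)) (t - T) := by
      funext t
      exact deriv_comp_sub_const (fun s => ξ s ^ (2 * m + 2)) T t
    rw [this]
    funext t
    exact deriv_comp_sub_const (deriv fun s => ξ s ^ (2 * m + 2)) T t
  obtain ⟨iZ, hZ⟩ := S.integral_a_one_one_eq hνs hνc
  set Z := fun t => S.a 1 1 t * ν t - 1 / 2 * S.a 0 0 t * deriv (deriv ν) t + S.a 2 0 t * ν t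
    with hZdef
  set J : ℝ → ℝ := (Icc (T - 2) (T + 2)).indicator fun _ => 1 with hJ
  have hJi : Integrable J := by
    refine (integrable_indicator_iff measurableSet_Icc).2 ?_
    exact continuous_const.integrableOn_Icc
  have hJint : ∫ t, J t = 4 := by
    rw [hJ, integral_indicator measurableSet_Icc]
    simp [Real.volume_real_Icc]
    norm_num
  have hJ0 : ∀ t, 0 ≤ J t := fun t => indicator_nonneg (fun _ _ => zero_le_one) t
  have cη := hηs.continuous
  have cη1 : Continuous (deriv η) :=
    (ContDiff.iterate_deriv 1 hηs : ContDiff ℝ (⊤ : ℕ∞) _).continuous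
  have cη2 : Continuous (deriv (deriv η)) :=
    (ContDiff.iterate_deriv 2 hηs : ContDiff ℝ (⊤ : ℕ∞) _).continuous
  have cN := S.continuous_N
  have cQ := S.continuous_Q
  have ca := S.continuous_a
  have cν := hνs.continuous
  have iNQ : Integrable fun t => (S.N t + S.Q t) * η t ^ 2 := by
    refine Continuous.integrable_of_forall_notMem_tsupport (by fun_prop) hηc fun t ht => ?_
    rw [image_eq_zero_of_notMem_tsupport ht]
    ring
  have iR : Integrable fun t => S.R (η t) (deriv η t) (deriv (deriv η) t) t := by
    refine Continuous.integrable_of_forall_notMem_tsupport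
      (S.continuous_R cη cη1 cη2) hηc fun t ht => ?_
    rw [image_eq_zero_of_notMem_tsupport ht, deriv_eq_zero_of_notMem_tsupport ht,
      deriv_deriv_eq_zero_of_notMem_tsupport ht]
    simp [R]
  have ia : Integrable fun t => S.a 1 1 t * ν t := by
    refine Continuous.integrable_of_forall_notMem_tsupport (by fun_prop) hνc fun t ht => ?_
    rw [image_eq_zero_of_notMem_tsupport ht]
    ring
  have hNη : ∀ t, 0 ≤ S.N t * η t ^ 2 := fun t => mul_nonneg (S.N_nonneg t) (sq_nonneg _)
  have hQη : ∀ t, 0 ≤ S.Q t * η t ^ 2 := fun t => mul_nonneg (S.Q_nonneg t) (sq_nonneg _)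
  have b1 : ∀ t, S.a 1 1 t * ν t ≤ Z t + (δ + C₂ * δ') * ((S.N t + S.Q t) * η t ^ 2)
      + C₂ * C₃ * J t ∧ S.R (η t) (deriv η t) (deriv (deriv η) t) t ≤
      1 / (2 * K) * ((S.N t + S.Q t) * η t ^ 2) + C₁ * Z t + C₁ * (C₂ + 1) * C₃ * J t := by
    intro t
    by_cases ht : t ∈ Icc (T - 2) (T + 2)
    · have hx0 := h0 (t - T)
      have hx1 := h1 (t - T)
      have hJt : J t = 1 := indicator_of_mem ht _
      have ea : S.a 0 0 t * (χ t ^ m) ^ 2 ≤ δ' * (S.N t * η t ^ 2) + C₃ := ha t (χ t) hx0 hx1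
      have ey := abs_mul_mul_le_of_sq_le (x := η t) (y := χ t ^ m) (S.a_nonneg 2 t)
        (S.a_nonneg 0 t) hδ0 (S.a_sq_le 2 0 t)
      have eν : η t * χ t ^ m = ν t := by simp only [hη, hν]; ring
      have eν' : ν t = (χ t ^ (m + 1)) ^ 2 := by simp only [hν]; ring
      have hν0 : 0 ≤ ν t := by rw [eν']; positivity
      rw [eν] at ey
      have ey' : -(S.a 2 0 t * ν t) ≤ |S.a 2 0 t| * ν t := by
        rw [← neg_mul]
        gcongr
        exact neg_le_abs _
      have eQ : S.a 2 2 t * η t ^ 2 ≤ S.Q t * η t ^ 2 := by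
        refine mul_le_mul_of_nonneg_right ?_ (sq_nonneg _)
        have := S.c_nonneg t
        have := S.b_nonneg 1 t
        have := S.b_nonneg 0 t
        have := S.a_nonneg 0 t
        unfold Q
        linarith
      have eν2 : S.a 0 0 t * deriv (deriv ν) t ≤ B₂ * (S.a 0 0 t * (χ t ^ m) ^ 2) := by
        have := (le_abs_self _).trans (hν2 (t - T))
        rw [dν2]
        calc _ ≤ S.a 0 0 t * (B₂ * ξ (t - T) ^ (2 * m)) :=
              mul_le_mul_of_nonneg_left this (S.a_nonneg 0 t)
          _ = _ := by simp only [hχ]; ring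
      have a1 : S.a 1 1 t * ν t ≤ Z t + δ * (S.Q t * η t ^ 2)
          + C₂ * (S.a 0 0 t * (χ t ^ m) ^ 2) := by
        have := mul_le_mul_of_nonneg_left eQ hδ0.le
        simp only [hZdef, hC₂, add_mul]
        linarith
      have a2 : S.R (η t) (deriv η t) (deriv (deriv η) t) t ≤ 1 / (4 * K) * (S.Q t * η t ^ 2)
          + C₁ * (S.a 1 1 t * ν t + S.a 0 0 t * (χ t ^ m) ^ 2) := by
        rw [eν']
        refine hR t (χ t ^ m) (χ t ^ (m + 1)) (χ t ^ (m + 2)) (η t) _ _ (by positivity)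
          (pow_le_pow_of_le_one hx0 hx1 (by omega)) (pow_le_pow_of_le_one hx0 hx1 (by omega))
          (by ring) ?_ ?_ ?_
        · rw [abs_of_nonneg (pow_nonneg hx0 _)]
        · rw [dη1]; exact hη1 _
        · rw [dη2]; exact hη2 _
      have a3 := mul_le_mul_of_nonneg_left ea hC₂0
      have a4 := mul_le_mul_of_nonneg_left ea (show 0 ≤ C₁ * (C₂ + 1) by positivity)
      have a5 := mul_le_mul_of_nonneg_left a1 hC₁
      have n1 := mul_nonneg hδ0.le (hNη t)
      have n2 := mul_nonneg (mul_nonneg hC₂0 hδ'0.le) (hQη t)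
      have d1 : C₁ * δ ≤ 1 / (4 * K) := by
        rw [hδ, mul_one_div, div_le_div_iff₀ (by positivity) (by positivity)]
        nlinarith
      have d2 : C₁ * (C₂ + 1) * δ' ≤ 1 / (2 * K) := by
        rw [hδ', mul_one_div, div_le_div_iff₀ (by positivity) (by positivity)]
        nlinarith [mul_nonneg hC₁ hC₂0]
      have d3 := mul_le_mul_of_nonneg_right d1 (hQη t)
      have d4 := mul_le_mul_of_nonneg_right d2 (hNη t)
      have d5 : 1 / (2 * K) = 1 / (4 * K) + 1 / (4 * K) := by field_simp; norm_num
      rw [hJt]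
      constructor
      · linarith
      · have : 1 / (2 * K) * ((S.N t + S.Q t) * η t ^ 2) = 1 / (2 * K) * (S.N t * η t ^ 2)
          + (1 / (4 * K) * (S.Q t * η t ^ 2) + 1 / (4 * K) * (S.Q t * η t ^ 2)) := by
          rw [← add_mul, ← d5]; ring
        rw [this]
        linarith
    · have t1 : t ∉ tsupport η := fun h => ht (hηt h)
      have t2 : t ∉ tsupport ν := fun h => ht (hνt h)
      have hJt : J t = 0 := indicator_of_notMem ht _
      simp only [hZdef, hJt, image_eq_zero_of_notMem_tsupport t1,
        deriv_eq_zero_of_notMem_tsupport t1, deriv_deriv_eq_zero_of_notMem_tsupport t1,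
        image_eq_zero_of_notMem_tsupport t2, deriv_deriv_eq_zero_of_notMem_tsupport t2]
      simp [R]
  have I1 := integral_le_of_forall_le_add iR iNQ iZ hJi fun t => (b1 t).2
  have I2 := integral_le_of_forall_le_add (c₁ := 1) ia iZ iNQ hJi fun t => by
    rw [one_mul]
    exact (b1 t).1
  rw [hZ, hJint] at I1 I2
  have I3 : ∫ t, (S.N t + S.Q t) * η t ^ 2 ≤ 2 * K * (C₁ * (C₂ + 1) * C₃) * 4 := by
    have := key.trans (mul_le_mul_of_nonneg_left I1 hK.le)
    have e : K * (1 / (2 * K) * (∫ t, (S.N t + S.Q t) * η t ^ 2) + C₁ * 0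
        + C₁ * (C₂ + 1) * C₃ * 4) = 1 / 2 * (∫ t, (S.N t + S.Q t) * η t ^ 2)
        + K * (C₁ * (C₂ + 1) * C₃) * 4 := by
      field_simp
      ring
    rw [e] at this
    linarith
  have I4 : ∫ t in (T - 1)..(T + 1), (S.N t + S.Q t + S.a 1 1 t) ≤
      ∫ t, ((S.N t + S.Q t) * η t ^ 2 + S.a 1 1 t * ν t) := by
    rw [intervalIntegral.integral_of_le (by linarith)]
    have : ∫ t in Ioc (T - 1) (T + 1), (S.N t + S.Q t + S.a 1 1 t) =
        ∫ t in Ioc (T - 1) (T + 1), ((S.N t + S.Q t) * η t ^ 2 + S.a 1 1 t * ν t) := by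
      refine setIntegral_congr_fun measurableSet_Ioc fun t ht => ?_
      have : χ t = 1 := hone _ ⟨by linarith [ht.1], by linarith [ht.2]⟩
      simp [hη, hν, this]
    rw [this]
    refine setIntegral_le_integral (iNQ.add ia) (ae_of_all _ fun t => ?_)
    have : 0 ≤ ν t := pow_nonneg (h0 _) _
    have := mul_nonneg (S.a_nonneg 1 t) this
    have := hNη t
    have := hQη t
    simp only [Pi.zero_apply]
    linarith
  rw [integral_add iNQ ia] at I4
  have I5 := mul_le_mul_of_nonneg_left I3 (show 0 ≤ δ + C₂ * δ' by positivity)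
  linarith

end SphericalMoments

section LinearODE

variable {k : ℝ} {V f : ℝ → ℝ}

lemma abs_le_exp_mul_add_integral (hk : 0 ≤ k) (hf : Continuous f)
    (hV : ∀ t, HasDerivAt V (-k * V t + f t) t) {s t : ℝ} (hst : s ≤ t) :
    |V t| ≤ Real.exp (-k * (t - s)) * |V s| + ∫ τ in s..t, |f τ| := by
  have hd : ∀ τ, HasDerivAt (fun τ => Real.exp (k * (τ - t)) * V τ)
      (Real.exp (k * (τ - t)) * f τ) τ := by
    intro τ
    have h1 : HasDerivAt (fun τ => Real.exp (k * (τ - t))) (Real.exp (k * (τ - t)) * (k * 1)) τ :=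
      (((hasDerivAt_id τ).sub_const t).const_mul k).exp
    refine (h1.mul (hV τ)).congr_deriv ?_
    ring
  have hc : Continuous fun τ => Real.exp (k * (τ - t)) * f τ := by fun_prop
  have hI := intervalIntegral.integral_eq_sub_of_hasDerivAt (a := s) (b := t) (fun τ _ => hd τ)
    (hc.intervalIntegrable _ _)
  simp only [sub_self, mul_zero, Real.exp_zero, one_mul] at hI
  have e : V t = Real.exp (-k * (t - s)) * V s + ∫ τ in s..t, Real.exp (k * (τ - t)) * f τ := by
    rw [hI, show -k * (t - s) = k * (s - t) by ring]
    ring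
  have h2 : |∫ τ in s..t, Real.exp (k * (τ - t)) * f τ| ≤ ∫ τ in s..t, |f τ| := by
    refine (intervalIntegral.abs_integral_le_integral_abs hst).trans ?_
    refine intervalIntegral.integral_mono_on hst (hc.abs.intervalIntegrable _ _)
      (hf.abs.intervalIntegrable _ _) fun τ hτ => ?_
    rw [abs_mul, Real.abs_exp]
    refine mul_le_of_le_one_left (abs_nonneg _) (Real.exp_le_one_iff.2 ?_)
    exact mul_nonpos_of_nonneg_of_nonpos hk (by linarith [hτ.2])
  calc |V t| ≤ |Real.exp (-k * (t - s)) * V s| + |∫ τ in s..t, Real.exp (k * (τ - t)) * f τ| := by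
        rw [e]
        exact abs_add_le _ _
    _ ≤ _ := by
        rw [abs_mul, Real.abs_exp]
        gcongr

lemma exists_abs_le_of_integral_le (hk : 0 < k) (hf : Continuous f)
    (hV : ∀ t, HasDerivAt V (-k * V t + f t) t) {T C : ℝ}
    (hC : ∀ t, T ≤ t → ∫ τ in t..(t + 1), |f τ| ≤ C) : ∃ M, 0 ≤ M ∧ ∀ t, T ≤ t → |V t| ≤ M := by
  have hcV : Continuous V := continuous_iff_continuousAt.2 fun t => (hV t).continuousAt
  obtain ⟨M₀, hM₀⟩ := (isCompact_Icc (a := T) (b := T + 1)).exists_bound_of_continuousOn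
    hcV.continuousOn
  have hq : Real.exp (-k) < 1 := Real.exp_lt_one_iff.2 (by linarith)
  have hq0 := Real.exp_pos (-k)
  set M := max 0 (max M₀ (C / (1 - Real.exp (-k)))) with hM
  have hMM₀ : M₀ ≤ M := (le_max_left _ _).trans (le_max_right _ _)
  have hMC : C ≤ (1 - Real.exp (-k)) * M := by
    have : C / (1 - Real.exp (-k)) ≤ M := (le_max_right _ _).trans (le_max_right _ _)
    rwa [div_le_iff₀' (by linarith)] at this
  have key : ∀ n : ℕ, ∀ t, T + n ≤ t → t ≤ T + n + 1 → |V t| ≤ M := by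
    intro n
    induction n with
    | zero =>
      intro t h1 h2
      norm_num at h1 h2
      exact (hM₀ t ⟨h1, h2⟩).trans hMM₀
    | succ n ih =>
      intro t h1 h2
      push_cast at h1 h2
      have h3 := ih (t - 1) (by linarith) (by linarith)
      have h4 := abs_le_exp_mul_add_integral hk.le hf hV (show t - 1 ≤ t by linarith)
      have h5 := hC (t - 1) (by have : (0 : ℝ) ≤ n := Nat.cast_nonneg n
                                linarith)
      rw [sub_add_cancel] at h5
      rw [show -k * (t - (t - 1)) = -k by ring] at h4
      have := mul_le_mul_of_nonneg_left h3 hq0.le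
      linarith
  refine ⟨M, le_max_left _ _, fun t ht => ?_⟩
  exact key ⌊t - T⌋₊ t (by linarith [Nat.floor_le (show 0 ≤ t - T by linarith)])
    (by linarith [Nat.lt_floor_add_one (t - T)])

lemma tendsto_zero_of_integral_tendsto_zero (hk : 0 < k) (hf : Continuous f)
    (hV : ∀ t, HasDerivAt V (-k * V t + f t) t)
    (h : Tendsto (fun t => ∫ τ in t..(t + 1), |f τ|) atTop (𝓝 0)) : Tendsto V atTop (𝓝 0) := by
  have hq : Real.exp (-k) < 1 := Real.exp_lt_one_iff.2 (by linarith)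
  have hq0 := Real.exp_pos (-k)
  rw [Metric.tendsto_atTop]
  intro ε hε
  have hδ : 0 < (1 - Real.exp (-k)) * (ε / 2) := mul_pos (by linarith) (by linarith)
  obtain ⟨T, hT⟩ := eventually_atTop.1 (h.eventually (gt_mem_nhds hδ))
  obtain ⟨M, hM0, hM⟩ := exists_abs_le_of_integral_le hk hf hV fun t ht => (hT t ht).le
  have key : ∀ n : ℕ, ∀ t, T + n ≤ t → |V t| ≤ Real.exp (-k) ^ n * M + ε / 2 := by
    intro n
    induction n with
    | zero =>
      intro t ht
      norm_num at ht
      have := hM t ht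
      simp only [pow_zero, one_mul]
      linarith
    | succ n ih =>
      intro t ht
      push_cast at ht
      have h3 := ih (t - 1) (by linarith)
      have h4 := abs_le_exp_mul_add_integral hk.le hf hV (show t - 1 ≤ t by linarith)
      have h5 := hT (t - 1) (by have : (0 : ℝ) ≤ n := Nat.cast_nonneg n
                                linarith)
      rw [sub_add_cancel] at h5
      rw [show -k * (t - (t - 1)) = -k by ring] at h4
      have := mul_le_mul_of_nonneg_left h3 hq0.le
      rw [pow_succ']
      linarith
  have hlim : Tendsto (fun n : ℕ => Real.exp (-k) ^ n * M) atTop (𝓝 0) := by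
    simpa using (tendsto_pow_atTop_nhds_zero_of_lt_one hq0.le hq).mul_const M
  obtain ⟨n, hn⟩ := (hlim.eventually (gt_mem_nhds (half_pos hε))).exists
  refine ⟨T + n, fun t ht => ?_⟩
  rw [Real.dist_eq, sub_zero]
  linarith [key n t ht]

end LinearODE

lemma tendsto_zero_of_abs_le_of_abs_deriv_le {f f' G : ℝ → ℝ} {C : ℝ}
    (hf : ∀ t, HasDerivAt f (f' t) t) (hf' : Continuous f') (hG : Continuous G)
    (h : ∀ t, |f t| ≤ C * G t) (h' : ∀ t, |f' t| ≤ C * G t)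
    (hlim : Tendsto (fun T => ∫ t in (T - 1)..(T + 1), G t) atTop (𝓝 0)) :
    Tendsto f atTop (𝓝 0) := by
  have hcf : Continuous f := continuous_iff_continuousAt.2 fun t => (hf t).continuousAt
  have key : ∀ T, |f T| ≤ 3 / 2 * C * ∫ t in (T - 1)..(T + 1), G t := by
    intro T
    have h1 : ∀ s ∈ Icc (T - 1) (T + 1),
        |f T| ≤ |f s| + C * ∫ t in (T - 1)..(T + 1), G t := by
      intro s hs
      have e : f T - f s = ∫ t in s..T, f' t :=
        (intervalIntegral.integral_eq_sub_of_hasDerivAt (fun t _ => hf t)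
          (hf'.intervalIntegrable _ _)).symm
      have e1 : |∫ t in s..T, f' t| ≤ ∫ t in (T - 1)..(T + 1), |f' t| := by
        have := intervalIntegral.norm_integral_le_integral_norm_uIoc (f := f') (a := s) (b := T)
          (μ := volume)
        rw [Real.norm_eq_abs] at this
        refine this.trans ?_
        rw [intervalIntegral.integral_of_le (by linarith)]
        refine setIntegral_mono_set (hf'.abs.integrableOn_Ioc)
          (ae_of_all _ fun t => abs_nonneg _) (LE.le.eventuallyLE ?_)
        intro t ht
        rcases le_total s T with hsT | hsT
        · rw [uIoc_of_le hsT] at ht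
          exact ⟨by linarith [ht.1, hs.1], by linarith [ht.2]⟩
        · rw [uIoc_of_ge hsT] at ht
          exact ⟨by linarith [ht.1], by linarith [ht.2, hs.2]⟩
      have e2 : ∫ t in (T - 1)..(T + 1), |f' t| ≤ C * ∫ t in (T - 1)..(T + 1), G t := by
        rw [← intervalIntegral.integral_const_mul]
        exact intervalIntegral.integral_mono_on (by linarith) (hf'.abs.intervalIntegrable _ _)
          ((hG.const_mul C).intervalIntegrable _ _) fun t _ => h' t
      have e3 := abs_add_le (f s) (f T - f s)
      rw [add_sub_cancel, e] at e3
      linarith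
    have h2 : ∫ _ in (T - 1)..(T + 1), |f T| ≤
        ∫ s in (T - 1)..(T + 1), (C * G s + C * ∫ t in (T - 1)..(T + 1), G t) := by
      refine intervalIntegral.integral_mono_on (by linarith)
        (continuous_const.intervalIntegrable _ _)
        (((hG.const_mul C).add continuous_const).intervalIntegrable _ _) fun s hs => ?_
      exact (h1 s hs).trans (by gcongr; exact h s)
    rw [intervalIntegral.integral_add ((hG.const_mul C).intervalIntegrable _ _)
      (continuous_const.intervalIntegrable _ _), intervalIntegral.integral_const,
      intervalIntegral.integral_const, intervalIntegral.integral_const_mul, smul_eq_mul,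
      smul_eq_mul] at h2
    linarith
  refine squeeze_zero_norm key ?_
  simpa using hlim.const_mul (3 / 2 * C)

lemma eq_zero_of_tendsto_of_abs_le {f G : ℝ → ℝ} {C l : ℝ}
    (hG : Continuous G) (h : ∀ t, |f t| ≤ C * G t)
    (hlim : Tendsto (fun T => ∫ t in (T - 1)..(T + 1), G t) atTop (𝓝 0))
    (hl : Tendsto f atTop (𝓝 l)) : l = 0 := by
  by_contra hl0
  have hpos : 0 < |l| := abs_pos.2 hl0
  obtain ⟨T₁, hT₁⟩ := eventually_atTop.1 (hl.abs.eventually (lt_mem_nhds (half_lt_self hpos)))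
  have h2 := hlim.const_mul C
  rw [mul_zero] at h2
  obtain ⟨T₂, hT₂⟩ := eventually_atTop.1 (h2.eventually (gt_mem_nhds hpos))
  set T := max T₁ T₂ + 1
  have a1 := hT₂ T (by linarith [le_max_right T₁ T₂])
  have a2 : ∫ _ in (T - 1)..(T + 1), |l| / 2 ≤ ∫ t in (T - 1)..(T + 1), C * G t := by
    refine intervalIntegral.integral_mono_on (by linarith)
      (continuous_const.intervalIntegrable _ _)
      ((hG.const_mul C).intervalIntegrable _ _) fun s hs => ?_
    refine (hT₁ s ?_).le.trans (h s)
    have := le_max_left T₁ T₂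
    have := hs.1
    simp only [T] at *
    linarith
  rw [intervalIntegral.integral_const, intervalIntegral.integral_const_mul, smul_eq_mul] at a2
  linarith

/-- A nonnegative function with bounded integrals over intervals of length two has at most linearly
growing integrals. -/
lemma integral_le_nat_mul {f : ℝ → ℝ} (hf : Continuous f) {T₁ C : ℝ}
    (h : ∀ T, T₁ < T → ∫ t in (T - 1)..(T + 1), f t ≤ C) (n : ℕ) {T : ℝ} (hT : T₁ - 1 < T) :
    ∫ t in T..(T + 2 * n), f t ≤ n * C := by
  induction n with
  | zero => simp
  | succ n ih =>
    have h1 := h (T + 2 * n + 1) (by have : (0 : ℝ) ≤ n := Nat.cast_nonneg n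
                                     linarith)
    rw [show T + 2 * n + 1 - 1 = T + 2 * (n : ℝ) by ring,
      show T + 2 * n + 1 + 1 = T + 2 * ((n + 1 : ℕ) : ℝ) by push_cast; ring] at h1
    rw [← intervalIntegral.integral_add_adjacent_intervals (hf.intervalIntegrable T (T + 2 * n))
      (hf.intervalIntegrable _ _)]
    push_cast at *
    linarith

namespace SphericalMoments

variable {k γ κ p : ℝ} (S : SphericalMoments k γ κ p)

/-- The boundary part of the monotone energy. -/
def W (t : ℝ) : ℝ :=
  S.a 1 2 t - S.a 1 1 t + γ * S.a 0 1 t + γ * S.a 0 0 t + S.b 0 1 t + S.b 0 0 t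

/-- The dissipation of the monotone energy `V + W`. -/
def D (t : ℝ) : ℝ := 2 * S.a 2 2 t + 2 * (k + 2 + γ) * S.a 1 1 t + 2 * S.b 1 1 t

lemma continuous_W : Continuous S.W := by
  have := S.continuous_a
  have := S.continuous_b
  unfold W
  fun_prop

lemma continuous_D : Continuous S.D := by
  have := S.continuous_a
  have := S.continuous_b
  unfold D
  fun_prop

/-- The forcing term in the linear equation satisfied by the bulk energy. -/
noncomputable def F (t : ℝ) : ℝ := 1 / 2 * (S.a 2 2 t + (k + 2) ^ 2 * S.a 1 1 t
    + γ ^ 2 * S.a 0 0 t + S.c t + 2 * (k + 2) * S.a 2 1 t - 2 * γ * S.a 2 0 t - 2 * S.b 2 0 t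
    - 2 * (k + 2) * γ * S.a 1 0 t - 2 * (k + 2) * S.b 1 0 t + 2 * γ * S.b 0 0 t)
    - S.N t / (p + 1)

lemma continuous_F : Continuous S.F := by
  have := S.continuous_a
  have := S.continuous_b
  have := S.continuous_c
  have := S.continuous_N
  unfold F
  fun_prop

/-- The derivative of the boundary part of the energy. -/
def W' (t : ℝ) : ℝ :=
  S.a 2 2 t + S.a 1 3 t - 2 * S.a 1 2 t + γ * (S.a 1 1 t + S.a 0 2 t) + 2 * γ * S.a 0 1 t
    + (S.b 1 1 t + S.b 0 2 t) + 2 * S.b 0 1 t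

lemma hasDerivAt_W (t : ℝ) : HasDerivAt S.W (S.W' t) t := by
  refine (((((((S.hasDerivAt_a 1 2 t).sub (S.hasDerivAt_a 1 1 t)).add
    ((S.hasDerivAt_a 0 1 t).const_mul γ)).add ((S.hasDerivAt_a 0 0 t).const_mul γ)).add
    (S.hasDerivAt_b 0 1 t)).add (S.hasDerivAt_b 0 0 t))).congr_deriv ?_
  simp only [W', zero_add, Nat.reduceAdd]
  rw [S.a_symm 2 1, S.a_symm 1 0, S.b_symm 1 0]
  ring

lemma hasDerivAt_defect (hp : p + 1 ≠ 0) (t : ℝ) :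
    HasDerivAt (fun t => -k * S.V t + S.F t + S.W' t - S.D t)
      (-k * (-k * S.V t + S.F t + S.W' t - S.D t)) t := by
  have hV : HasDerivAt S.V (-k * S.V t + S.F t) t := by
    refine (S.hasDerivAt_V t).congr_deriv ?_
    unfold F
    ring
  have hF : HasDerivAt S.F _ t :=
    (((((((((((S.hasDerivAt_a 2 2 t).add ((S.hasDerivAt_a 1 1 t).const_mul ((k + 2) ^ 2))).add
      ((S.hasDerivAt_a 0 0 t).const_mul (γ ^ 2))).add (S.hasDerivAt_c t)).add
      ((S.hasDerivAt_a 2 1 t).const_mul (2 * (k + 2)))).sub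
      ((S.hasDerivAt_a 2 0 t).const_mul (2 * γ))).sub ((S.hasDerivAt_b 2 0 t).const_mul 2)).sub
      ((S.hasDerivAt_a 1 0 t).const_mul (2 * (k + 2) * γ))).sub
      ((S.hasDerivAt_b 1 0 t).const_mul (2 * (k + 2)))).add
      ((S.hasDerivAt_b 0 0 t).const_mul (2 * γ))).const_mul (1 / 2)).sub
      ((S.hasDerivAt_N t).div_const (p + 1))
  have hW : HasDerivAt S.W' _ t :=
    ((((((S.hasDerivAt_a 2 2 t).add (S.hasDerivAt_a 1 3 t)).sub
      ((S.hasDerivAt_a 1 2 t).const_mul 2)).add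
      (((S.hasDerivAt_a 1 1 t).add (S.hasDerivAt_a 0 2 t)).const_mul γ)).add
      ((S.hasDerivAt_a 0 1 t).const_mul (2 * γ))).add
      ((S.hasDerivAt_b 1 1 t).add (S.hasDerivAt_b 0 2 t))).add
      ((S.hasDerivAt_b 0 1 t).const_mul 2)
  have hD : HasDerivAt S.D _ t :=
    (((S.hasDerivAt_a 2 2 t).const_mul 2).add
      ((S.hasDerivAt_a 1 1 t).const_mul (2 * (k + 2 + γ)))).add
      ((S.hasDerivAt_b 1 1 t).const_mul 2)
  refine ((((hV.const_mul (-k)).add hF).add hW).sub hD).congr_deriv ?_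
  rw [mul_div_cancel_left₀ _ hp]
  simp only [W', D, zero_add, Nat.reduceAdd]
  rw [S.a_symm 0 1, S.a_symm 0 2, S.a_symm 0 3, S.a_symm 1 2, S.a_symm 1 3, S.a_symm 1 4,
    S.a_symm 2 3, S.b_symm 0 1, S.b_symm 0 2, S.b_symm 0 3, S.b_symm 1 2]
  ring

end SphericalMoments

namespace SphericalMoments

variable {k γ κ p : ℝ} (S : SphericalMoments k γ κ p)

/-- The sum of all the moments controlled by the stability inequality. -/
def G (t : ℝ) : ℝ := S.N t + S.Q t + S.a 1 1 t

lemma continuous_G : Continuous S.G :=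
  (S.continuous_N.add S.continuous_Q).add (S.continuous_a 1 1)

lemma abs_a_le (i j : ℕ) (t : ℝ) : |S.a i j t| ≤ (S.a i i t + S.a j j t) / 2 := by
  have := abs_mul_mul_le_of_sq_le (x := 1) (y := 1) (S.a_nonneg i t) (S.a_nonneg j t)
    (show (0 : ℝ) < 1 / 2 by norm_num) (S.a_sq_le i j t)
  norm_num at this
  linarith

lemma abs_b_le (i j : ℕ) (t : ℝ) : |S.b i j t| ≤ (S.b i i t + S.b j j t) / 2 := by
  have := abs_mul_mul_le_of_sq_le (x := 1) (y := 1) (S.b_nonneg i t) (S.b_nonneg j t)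
    (show (0 : ℝ) < 1 / 2 by norm_num) (S.b_sq_le i j t)
  norm_num at this
  linarith

lemma moments_le_G (t : ℝ) : S.a 0 0 t ≤ S.G t ∧ S.a 1 1 t ≤ S.G t ∧ S.a 2 2 t ≤ S.G t ∧
    S.b 0 0 t ≤ S.G t ∧ S.b 1 1 t ≤ S.G t ∧ S.c t ≤ S.G t ∧ S.N t ≤ S.G t := by
  have := S.a_nonneg 0 t
  have := S.a_nonneg 1 t
  have := S.a_nonneg 2 t
  have := S.b_nonneg 0 t
  have := S.b_nonneg 1 t
  have := S.c_nonneg t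
  have := S.N_nonneg t
  unfold G Q
  refine ⟨?_, ?_, ?_, ?_, ?_, ?_, ?_⟩ <;> linarith

lemma exists_abs_le_G (hp : 0 < p + 1) :
    ∃ C, 0 < C ∧ ∀ t, |S.F t| ≤ C * S.G t ∧ |S.W t| ≤ C * S.G t := by
  refine ⟨1 + (1 + (k + 2) ^ 2 + γ ^ 2 + 1 + |2 * (k + 2)| + |2 * γ| + 2 + |2 * (k + 2) * γ|
    + |2 * (k + 2)| + |2 * γ| + 1 / (p + 1)) + (1 + 1 + |γ| + |γ| + 1 + 1), by positivity,
    fun t => ?_⟩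
  obtain ⟨h0, h1, h2, h3, h4, h5, h6⟩ := S.moments_le_G t
  have a0 := S.a_nonneg 0 t
  have a1 := S.a_nonneg 1 t
  have a2 := S.a_nonneg 2 t
  have b0 := S.b_nonneg 0 t
  have b1 := S.b_nonneg 1 t
  have c0 := S.c_nonneg t
  have n0 := S.N_nonneg t
  have hG : 0 ≤ S.G t := a0.trans h0
  have x21 : |S.a 2 1 t| ≤ S.G t := by linarith [S.abs_a_le 2 1 t]
  have x12 : |S.a 1 2 t| ≤ S.G t := by linarith [S.abs_a_le 1 2 t]
  have x20 : |S.a 2 0 t| ≤ S.G t := by linarith [S.abs_a_le 2 0 t]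
  have x10 : |S.a 1 0 t| ≤ S.G t := by linarith [S.abs_a_le 1 0 t]
  have x01 : |S.a 0 1 t| ≤ S.G t := by linarith [S.abs_a_le 0 1 t]
  have y10 : |S.b 1 0 t| ≤ S.G t := by linarith [S.abs_b_le 1 0 t]
  have y01 : |S.b 0 1 t| ≤ S.G t := by linarith [S.abs_b_le 0 1 t]
  have x00 : |S.a 0 0 t| ≤ S.G t := by rwa [abs_of_nonneg a0]
  have x11 : |S.a 1 1 t| ≤ S.G t := by rwa [abs_of_nonneg a1]
  have x22 : |S.a 2 2 t| ≤ S.G t := by rwa [abs_of_nonneg a2]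
  have y00 : |S.b 0 0 t| ≤ S.G t := by rwa [abs_of_nonneg b0]
  have zc : |S.c t| ≤ S.G t := by rwa [abs_of_nonneg c0]
  have zN : |S.N t| ≤ S.G t := by rwa [abs_of_nonneg n0]
  have y20 : |S.b 2 0 t| ≤ S.G t := by
    have := abs_mul_mul_le_of_sq_le (x := 1) (y := 1) a2 c0
      (show (0 : ℝ) < 1 / 2 by norm_num) (S.b_sq_le_a_mul_c 2 t)
    norm_num at this
    linarith
  have bd : ∀ c x : ℝ, |x| ≤ S.G t → |c * x| ≤ |c| * S.G t := fun c x hx => by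
    rw [abs_mul]
    gcongr
  have u1 := bd ((k + 2) ^ 2) _ x11
  have u2 := bd (γ ^ 2) _ x00
  have u3 := bd (2 * (k + 2)) _ x21
  have u4 := bd (2 * γ) _ x20
  have u6 := bd (2 * (k + 2) * γ) _ x10
  have u7 := bd (2 * (k + 2)) _ y10
  have u8 := bd (2 * γ) _ y00
  have u9 := bd (1 / (p + 1)) _ zN
  have v1 := bd γ _ x01
  have v2 := bd γ _ x00
  rw [abs_of_nonneg (sq_nonneg (k + 2))] at u1
  rw [abs_of_nonneg (sq_nonneg γ)] at u2
  rw [abs_of_nonneg (show 0 ≤ 1 / (p + 1) by positivity), one_div_mul_eq_div] at u9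
  have g1 := mul_nonneg (sq_nonneg (k + 2)) hG
  have g2 := mul_nonneg (sq_nonneg γ) hG
  have g3 := mul_nonneg (abs_nonneg (2 * (k + 2))) hG
  have g4 := mul_nonneg (abs_nonneg (2 * γ)) hG
  have g5 := mul_nonneg (abs_nonneg (2 * (k + 2) * γ)) hG
  have g6 := mul_nonneg (show 0 ≤ 1 / (p + 1) by positivity) hG
  have g7 := mul_nonneg (abs_nonneg γ) hG
  constructor
  · rw [abs_le] at *
    unfold F
    constructor <;> linarith
  · rw [abs_le] at *
    unfold W
    constructor <;> linarith

lemma D_nonneg (hk : 0 < k) (hγ : 0 ≤ γ) (t : ℝ) : 0 ≤ S.D t := by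
  have := S.a_nonneg 1 t
  have := S.a_nonneg 2 t
  have := S.b_nonneg 1 t
  unfold D
  positivity

lemma hasDerivAt_V' (t : ℝ) : HasDerivAt S.V (-k * S.V t + S.F t) t := by
  refine (S.hasDerivAt_V t).congr_deriv ?_
  unfold F
  ring

lemma exists_hasDerivAt_energy (hk : 0 < k) (hp : p + 1 ≠ 0) : ∃ C, ∀ t,
    HasDerivAt (fun t => S.V t + S.W t + C * Real.exp (-k * t)) (S.D t) t := by
  set Z := fun t => -k * S.V t + S.F t + S.W' t - S.D t with hZ
  have hZ' : ∀ t, HasDerivAt (fun t => Z t * Real.exp (k * t)) 0 t := fun t => by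
    have h1 : HasDerivAt (fun t => Real.exp (k * t)) (Real.exp (k * t) * (k * 1)) t :=
      ((hasDerivAt_id t).const_mul k).exp
    refine ((S.hasDerivAt_defect hp t).mul h1).congr_deriv ?_
    ring
  have hconst : ∀ t, Z t * Real.exp (k * t) = Z 0 := fun t => by
    have := is_const_of_deriv_eq_zero (fun t => (hZ' t).differentiableAt)
      (fun t => (hZ' t).deriv) t 0
    simpa using this
  have hZt : ∀ t, Z t = Z 0 * Real.exp (-k * t) := fun t => by
    rw [← hconst t, mul_assoc, ← Real.exp_add]
    simp
  refine ⟨Z 0 / k, fun t => ?_⟩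
  have h1 : HasDerivAt (fun t => Real.exp (-k * t)) (Real.exp (-k * t) * (-k * 1)) t :=
    ((hasDerivAt_id t).const_mul (-k)).exp
  refine (((S.hasDerivAt_V' t).add (S.hasDerivAt_W t)).add
    (h1.const_mul (Z 0 / k))).congr_deriv ?_
  have e : Z 0 / k * (Real.exp (-k * t) * (-k * 1)) = -(Z 0 * Real.exp (-k * t)) := by
    field_simp
  rw [e, ← hZt t]
  simp only [hZ]
  ring

/-- The monotone energy converges and its dissipation tends to zero in the mean. -/
lemma exists_tendsto_energy (hk : 0 < k) (hγ : 0 ≤ γ) (hp : 1 < p)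
    (h₁ : 2 * κ < p * (2 * γ + 2 * k)) (h₂ : κ ^ 2 < p * (γ * (γ + 2 * k))) :
    ∃ l, Tendsto (fun t => S.V t + S.W t) atTop (𝓝 l) ∧
      ∀ L : ℝ, Tendsto (fun T => ∫ t in (T - L)..(T + L), S.D t) atTop (𝓝 0) := by
  obtain ⟨C, hC⟩ := S.exists_integral_interval_le hp h₁ h₂
  have hC' : ∀ T, S.T₀ + 2 < T → ∫ t in (T - 1)..(T + 1), S.G t ≤ C := hC
  obtain ⟨C₁, hC₁, hFW⟩ := S.exists_abs_le_G (by linarith)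
  obtain ⟨C₂, hE⟩ := S.exists_hasDerivAt_energy hk (by linarith)
  set Φ := fun t => S.V t + S.W t + C₂ * Real.exp (-k * t) with hΦ
  have cG := S.continuous_G
  have cW := S.continuous_W
  have cV := S.continuous_V
  have hG0 : ∀ t, 0 ≤ S.G t := fun t => (S.a_nonneg 0 t).trans (S.moments_le_G t).1
  have hmono : Monotone Φ := monotone_of_hasDerivAt_nonneg hE fun t => S.D_nonneg hk hγ t
  have hcΦ : Continuous Φ := continuous_iff_continuousAt.2 fun t => (hE t).continuousAt
  obtain ⟨M, hM0, hM⟩ := exists_abs_le_of_integral_le (T := S.T₀ + 3) (C := C₁ * C) hk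
    S.continuous_F S.hasDerivAt_V' fun t ht => by
      have h3 : ∫ τ in t..(t + 1), |S.F τ| ≤ ∫ τ in t..(t + 1), C₁ * S.G τ :=
        intervalIntegral.integral_mono_on (by linarith)
          (S.continuous_F.abs.intervalIntegrable _ _)
          ((cG.const_mul C₁).intervalIntegrable _ _) fun τ _ => (hFW τ).1
      rw [intervalIntegral.integral_const_mul] at h3
      refine h3.trans (mul_le_mul_of_nonneg_left ?_ hC₁.le)
      refine le_trans ?_ (hC' t (by linarith))
      exact intervalIntegral.integral_mono_interval (by linarith) (by linarith) le_rfl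
        (ae_of_all _ hG0) (cG.intervalIntegrable _ _)
  have hbd : ∀ T, Φ T ≤ (2 * (M + |C₂|) + C₁ * C) / 2 := by
    intro T
    set T' := max (max T (S.T₀ + 3)) 0 + 1 with hT'
    have t1 : T ≤ T' - 1 := by
      have := (le_max_left T (S.T₀ + 3)).trans (le_max_left _ 0)
      linarith
    have t2 : S.T₀ + 3 ≤ T' - 1 := by
      have := (le_max_right T (S.T₀ + 3)).trans (le_max_left _ 0)
      linarith
    have t3 : 0 ≤ T' - 1 := by
      have := le_max_right (max T (S.T₀ + 3)) 0
      linarith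
    have h3 : ∫ _ in (T' - 1)..(T' + 1), Φ T ≤
        ∫ t in (T' - 1)..(T' + 1), ((M + |C₂|) + C₁ * S.G t) := by
      refine intervalIntegral.integral_mono_on (by linarith)
        (continuous_const.intervalIntegrable _ _)
        ((continuous_const.add (cG.const_mul C₁)).intervalIntegrable _ _) fun t ht => ?_
      have e1 := hmono (show T ≤ t by linarith [ht.1])
      have e2 := (le_abs_self _).trans (hM t (by linarith [ht.1]))
      have e3 := (le_abs_self _).trans (hFW t).2
      have e4 : C₂ * Real.exp (-k * t) ≤ |C₂| := by
        have : Real.exp (-k * t) ≤ 1 :=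
          Real.exp_le_one_iff.2 (by nlinarith [mul_nonneg hk.le (t3.trans ht.1)])
        calc C₂ * Real.exp (-k * t) ≤ |C₂| * Real.exp (-k * t) := by
              gcongr
              exact le_abs_self _
          _ ≤ |C₂| * 1 := by gcongr
          _ = _ := mul_one _
      simp only [hΦ] at e1 ⊢
      linarith
    rw [intervalIntegral.integral_add (continuous_const.intervalIntegrable _ _)
      ((cG.const_mul C₁).intervalIntegrable _ _), intervalIntegral.integral_const,
      intervalIntegral.integral_const, intervalIntegral.integral_const_mul, smul_eq_mul,
      smul_eq_mul] at h3
    have := mul_le_mul_of_nonneg_left (hC' T' (by linarith)) hC₁.le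
    rw [le_div_iff₀ two_pos]
    linarith
  have hlim := tendsto_atTop_ciSup hmono ⟨_, forall_mem_range.2 hbd⟩
  refine ⟨⨆ t, Φ t, ?_, fun L => ?_⟩
  · have h3 : Tendsto (fun t => C₂ * Real.exp (-k * t)) atTop (𝓝 0) := by
      have : Tendsto (fun t => -k * t) atTop atBot :=
        tendsto_id.const_mul_atTop_of_neg (by linarith)
      simpa using (Real.tendsto_exp_atBot.comp this).const_mul C₂
    simpa [hΦ] using hlim.sub h3
  · have e : ∀ T, ∫ t in (T - L)..(T + L), S.D t = Φ (T + L) - Φ (T - L) := fun T =>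
      intervalIntegral.integral_eq_sub_of_hasDerivAt (fun t _ => hE t)
        (S.continuous_D.intervalIntegrable _ _)
    simp only [e]
    have l1 := hlim.comp (tendsto_atTop_add_const_right atTop L tendsto_id)
    have l2 := hlim.comp (tendsto_atTop_add_const_right atTop (-L) tendsto_id)
    simpa [Function.comp_def, sub_eq_add_neg] using l1.sub l2

end SphericalMoments

namespace SphericalMoments

variable {k γ κ p : ℝ} (S : SphericalMoments k γ κ p)

lemma R_le_D_add_Q (hk : 0 < k) (hγ : 0 ≤ γ) {B ε e₀ e₁ e₂ t : ℝ} (hB : 1 ≤ B) (hε : 0 < ε)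
    (hε1 : ε ≤ 1) (h₀ : |e₀| ≤ 1) (h₁ : |e₁| ≤ B * ε) (h₂ : |e₂| ≤ B * ε) :
    S.R e₀ e₁ e₂ t ≤ 4 * B ^ 2 * ((2 + 1 / ε ^ 2) * S.D t + 4 * ε ^ 2 * S.Q t) := by
  have a00 := S.a_nonneg 0 t
  have a11 := S.a_nonneg 1 t
  have a22 := S.a_nonneg 2 t
  have b00 := S.b_nonneg 0 t
  have b11 := S.b_nonneg 1 t
  have c0 := S.c_nonneg t
  have hB0 : 0 ≤ B := by linarith
  have hBε : B * ε ≤ B := mul_le_of_le_one_right hB0 hε1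
  have hBε0 : 0 ≤ B * ε := by positivity
  have hBB : B ≤ B ^ 2 := by nlinarith
  have hBB1 : 1 ≤ B ^ 2 := by nlinarith
  have n00 : e₀ ^ 2 ≤ B ^ 2 := by
    rw [← sq_abs]
    nlinarith [abs_nonneg e₀]
  have n11 : e₁ ^ 2 ≤ B ^ 2 * ε ^ 2 := by
    rw [← mul_pow]
    exact sq_le_sq' (by linarith [neg_le_of_abs_le h₁]) (le_of_abs_le h₁)
  have n22 : e₂ ^ 2 ≤ B ^ 2 * ε ^ 2 := by
    rw [← mul_pow]
    exact sq_le_sq' (by linarith [neg_le_of_abs_le h₂]) (le_of_abs_le h₂)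
  have hεε : B ^ 2 * ε ^ 2 ≤ B ^ 2 :=
    mul_le_of_le_one_right (by positivity) (pow_le_one₀ hε.le hε1)
  have n01 : |e₀ * e₁| ≤ B ^ 2 := by
    rw [abs_mul]
    calc |e₀| * |e₁| ≤ 1 * (B * ε) := by gcongr
      _ ≤ _ := by linarith
  have n02 : |e₀ * e₂| ≤ B ^ 2 := by
    rw [abs_mul]
    calc |e₀| * |e₂| ≤ 1 * (B * ε) := by gcongr
      _ ≤ _ := by linarith
  have n12 : |e₁ * e₂| ≤ B ^ 2 := by
    rw [abs_mul]
    calc |e₁| * |e₂| ≤ (B * ε) * (B * ε) := by gcongr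
      _ = B ^ 2 * ε ^ 2 := by ring
      _ ≤ _ := hεε
  have hε2 : 0 < ε ^ 2 := by positivity
  have r1 := mul_le_mul_of_nonneg_left (show e₀ ^ 2 + |e₀ * e₁| ≤ 4 * B ^ 2 by linarith)
    (abs_nonneg (S.a 2 1 t))
  have r2 := mul_le_mul_of_nonneg_left (show e₀ ^ 2 + |e₀ * e₁| + |e₀ * e₂| + e₁ ^ 2 ≤
    4 * B ^ 2 by linarith) (abs_nonneg (S.a 2 0 t))
  have r3 := mul_le_mul_of_nonneg_left (show e₀ ^ 2 + |e₀ * e₁| + |e₁ * e₂| ≤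
    4 * B ^ 2 by linarith) (abs_nonneg (S.a 1 0 t))
  have r4 := mul_le_mul_of_nonneg_left (show e₀ ^ 2 + e₁ ^ 2 ≤ 4 * B ^ 2 by linarith) a11
  have r5 := mul_le_mul_of_nonneg_left (show e₀ ^ 2 + |e₀ * e₁| ≤ 4 * B ^ 2 by linarith)
    (abs_nonneg (S.b 1 0 t))
  have hbe : 0 ≤ B ^ 2 * ε ^ 2 := by positivity
  have r6 := mul_le_mul_of_nonneg_left (show e₁ ^ 2 ≤ 4 * B ^ 2 * ε ^ 2 by linarith) b00
  have r7 := mul_le_mul_of_nonneg_left (show e₁ ^ 2 + e₂ ^ 2 ≤ 4 * B ^ 2 * ε ^ 2 by linarith) a00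
  have x21 := S.abs_a_le 2 1 t
  have x20 := abs_mul_mul_le_of_sq_le (x := 1) (y := 1) a00 a22 hε2
    ((S.a_sq_le 2 0 t).trans_eq (mul_comm _ _))
  have x10 := abs_mul_mul_le_of_sq_le (x := 1) (y := 1) a00 a11 hε2
    ((S.a_sq_le 1 0 t).trans_eq (mul_comm _ _))
  have y10 := abs_mul_mul_le_of_sq_le (x := 1) (y := 1) b00 b11 hε2
    ((S.b_sq_le 1 0 t).trans_eq (mul_comm _ _))
  simp only [one_pow, mul_one] at x20 x10 y10
  have e4 : 1 / (4 * ε ^ 2) = 1 / 4 * (1 / ε ^ 2) := by field_simp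
  rw [e4] at x20 x10 y10
  have hi : 0 ≤ 1 / ε ^ 2 := by positivity
  have g1 := mul_nonneg hi a00
  have g2 := mul_nonneg hi a11
  have g3 := mul_nonneg hi a22
  have g4 := mul_nonneg hi b11
  have g5 := mul_nonneg hi (mul_nonneg (show 0 ≤ k + γ by linarith) a11)
  have g6 := mul_nonneg (show 0 ≤ k + γ by linarith) a11
  have f1 := mul_nonneg hε2.le a00
  have f2 := mul_nonneg hε2.le b00
  have f3 := mul_nonneg hε2.le c0
  have f4 := mul_nonneg hε2.le a22
  have f5 := mul_nonneg hε2.le b11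
  have fin : |S.a 2 1 t| + |S.a 2 0 t| + |S.a 1 0 t| + S.a 1 1 t + |S.b 1 0 t|
      + ε ^ 2 * S.b 0 0 t + ε ^ 2 * S.a 0 0 t ≤
      (2 + 1 / ε ^ 2) * S.D t + 4 * ε ^ 2 * S.Q t := by
    unfold D Q
    linarith
  refine le_trans ?_ (mul_le_mul_of_nonneg_left fin (by positivity))
  unfold R
  linarith

lemma a_one_one_le_D (hk : 0 < k) (hγ : 0 ≤ γ) (t : ℝ) : S.a 1 1 t ≤ S.D t := by
  have a11 := S.a_nonneg 1 t
  have a22 := S.a_nonneg 2 t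
  have b11 := S.b_nonneg 1 t
  have g6 := mul_nonneg (show 0 ≤ k + γ by linarith) a11
  unfold D
  linarith

lemma exists_integral_le_integral_D (hk : 0 < k) (hγ : 0 ≤ γ) (hp : 1 < p)
    (h₁ : 2 * κ < p * (2 * γ + 2 * k)) (h₂ : κ ^ 2 < p * (γ * (γ + 2 * k))) :
    ∃ C, 0 < C ∧ ∀ n : ℕ, 1 ≤ n → ∀ T, S.T₀ + 2 * n + 2 < T →
      ∫ t in (T - 1)..(T + 1), S.G t ≤
        (C * (2 + n ^ 2) + 1) * (∫ t in (T - 2 * n)..(T + 2 * n), S.D t) + C / n := by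
  obtain ⟨C, hC⟩ := S.exists_integral_interval_le hp h₁ h₂
  have hC' : ∀ T, S.T₀ + 2 < T → ∫ t in (T - 1)..(T + 1), S.G t ≤ C := hC
  obtain ⟨K, hK, hS⟩ := S.exists_integral_le hp h₁ h₂
  obtain ⟨ξ, B, hξ, hB, hsupp, hone, h0, h1, hd, hdd⟩ := exists_smooth_cutoff
  refine ⟨K * (4 * B ^ 2) * (1 + 8 * |C|), by positivity, fun n hn T hT => ?_⟩
  have hn1 : (1 : ℝ) ≤ n := by exact_mod_cast hn
  have hn0 : (0 : ℝ) < n := by linarith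
  set η : ℝ → ℝ := fun t => ξ ((t - T) / n) with hη
  have hηs : ContDiff ℝ (⊤ : ℕ∞) η := hξ.comp ((contDiff_id.sub contDiff_const).div_const _)
  have hη0 : ∀ t, t ∉ Icc (T - 2 * n) (T + 2 * n) → η t = 0 := fun t ht => by
    refine image_eq_zero_of_notMem_tsupport (f := ξ) ?_
    rw [hsupp]
    intro h
    have e1 := h.1
    have e2 := h.2
    rw [le_div_iff₀ hn0] at e1
    rw [div_le_iff₀ hn0] at e2
    exact ht ⟨by linarith, by linarith⟩
  have hηc : HasCompactSupport η := HasCompactSupport.intro isCompact_Icc hη0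
  have hηt : tsupport η ⊆ Icc (T - 2 * n) (T + 2 * n) :=
    closure_minimal (fun t ht => by by_contra h; exact ht (hη0 t h)) isClosed_Icc
  have hin : ∀ t, HasDerivAt (fun t : ℝ => (t - T) / n) (1 / n : ℝ) t := fun t =>
    ((hasDerivAt_id t).sub_const T).div_const _
  have hξ' : ContDiff ℝ (⊤ : ℕ∞) (deriv ξ) := ContDiff.iterate_deriv 1 hξ
  have dη1 : deriv η = fun t => deriv ξ ((t - T) / n) * (1 / n) := by
    funext t
    exact (((hξ.differentiable (by simp)).differentiableAt).hasDerivAt.comp t (hin t)).deriv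
  have dη2 : deriv (deriv η) = fun t => deriv (deriv ξ) ((t - T) / n) * (1 / n) * (1 / n) := by
    rw [dη1]
    funext t
    exact ((((hξ'.differentiable (by simp)).differentiableAt).hasDerivAt.comp t
      (hin t)).mul_const _).deriv
  have hinv : (1 : ℝ) / n ≤ 1 := by rw [div_le_one hn0]; exact hn1
  have hinv0 : (0 : ℝ) < 1 / n := by positivity
  have key := hS η hηs hηc (hηt.trans fun t ht => by
    have := ht.1
    simp only [mem_Ioi]
    linarith)
  have cη := hηs.continuous
  have cN := S.continuous_N
  have cQ := S.continuous_Q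
  have cD := S.continuous_D
  have ca := S.continuous_a
  have cG := S.continuous_G
  have iNQ : Integrable fun t => (S.N t + S.Q t) * η t ^ 2 := by
    refine Continuous.integrable_of_forall_notMem_tsupport (by fun_prop) hηc fun t ht => ?_
    rw [image_eq_zero_of_notMem_tsupport ht]
    ring
  have I1 : ∫ t in (T - 1)..(T + 1), (S.N t + S.Q t) ≤ ∫ t, (S.N t + S.Q t) * η t ^ 2 := by
    rw [intervalIntegral.integral_of_le (by linarith)]
    have : ∫ t in Ioc (T - 1) (T + 1), (S.N t + S.Q t) =
        ∫ t in Ioc (T - 1) (T + 1), (S.N t + S.Q t) * η t ^ 2 := by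
      refine setIntegral_congr_fun measurableSet_Ioc fun t ht => ?_
      have : η t = 1 := hone _ ⟨by rw [le_div_iff₀ hn0]; linarith [ht.1],
        by rw [div_le_iff₀ hn0]; linarith [ht.2]⟩
      simp [this]
    rw [this]
    exact setIntegral_le_integral iNQ (ae_of_all _ fun t =>
      mul_nonneg (add_nonneg (S.N_nonneg t) (S.Q_nonneg t)) (sq_nonneg _))
  have I2 : ∫ t, S.R (η t) (deriv η t) (deriv (deriv η) t) t ≤
      ∫ t in (T - 2 * n)..(T + 2 * n), 4 * B ^ 2 * ((2 + n ^ 2) * S.D t + 4 / n ^ 2 * S.Q t) := by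
    have : ∫ t, S.R (η t) (deriv η t) (deriv (deriv η) t) t =
        ∫ t in (T - 2 * n)..(T + 2 * n), S.R (η t) (deriv η t) (deriv (deriv η) t) t := by
      rw [intervalIntegral.integral_of_le (by linarith), ← integral_Icc_eq_integral_Ioc]
      refine (setIntegral_eq_integral_of_forall_compl_eq_zero fun t ht => ?_).symm
      have ht' : t ∉ tsupport η := fun h => ht (hηt h)
      rw [image_eq_zero_of_notMem_tsupport ht', deriv_eq_zero_of_notMem_tsupport ht',
        deriv_deriv_eq_zero_of_notMem_tsupport ht']
      simp [R]
    rw [this]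
    have cη1 : Continuous (deriv η) :=
      (ContDiff.iterate_deriv 1 hηs : ContDiff ℝ (⊤ : ℕ∞) _).continuous
    have cη2 : Continuous (deriv (deriv η)) :=
      (ContDiff.iterate_deriv 2 hηs : ContDiff ℝ (⊤ : ℕ∞) _).continuous
    refine intervalIntegral.integral_mono_on (by linarith)
      ((S.continuous_R cη cη1 cη2).intervalIntegrable _ _)
      (Continuous.intervalIntegrable (by fun_prop) _ _) fun t _ => ?_
    have := S.R_le_D_add_Q (t := t) (e₀ := η t) (e₁ := deriv η t) (e₂ := deriv (deriv η) t)
      hk hγ hB hinv0 hinv ?_ ?_ ?_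
    · refine this.trans_eq ?_
      field_simp
    · rw [abs_of_nonneg (h0 _)]
      exact h1 _
    · rw [dη1, abs_mul, abs_of_pos hinv0]
      gcongr
      exact hd _
    · simp only [dη2]
      rw [mul_assoc, abs_mul, abs_of_pos (mul_pos hinv0 hinv0)]
      gcongr
      · exact hdd _
      · exact mul_le_of_le_one_right hinv0.le hinv
  rw [intervalIntegral.integral_const_mul, intervalIntegral.integral_add
    ((cD.const_mul _).intervalIntegrable _ _) ((cQ.const_mul _).intervalIntegrable _ _),
    intervalIntegral.integral_const_mul, intervalIntegral.integral_const_mul] at I2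
  have hQG : ∀ t, S.Q t ≤ S.G t := fun t => by
    have := S.N_nonneg t
    have := S.a_nonneg 1 t
    unfold G
    linarith
  have I3 : ∫ t in (T - 2 * n)..(T + 2 * n), S.Q t ≤ 2 * n * |C| := by
    have h3 := integral_le_nat_mul cG hC' (2 * n) (T := T - 2 * n) (by linarith)
    rw [show T - 2 * n + 2 * ((2 * n : ℕ) : ℝ) = T + 2 * n by push_cast; ring] at h3
    refine (intervalIntegral.integral_mono_on (by linarith) (cQ.intervalIntegrable _ _)
      (cG.intervalIntegrable _ _) fun t _ => hQG t).trans (h3.trans ?_)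
    push_cast
    gcongr
    exact le_abs_self C
  have I4 : ∫ t in (T - 1)..(T + 1), S.a 1 1 t ≤
      ∫ t in (T - 2 * n)..(T + 2 * n), S.D t := by
    refine (intervalIntegral.integral_mono_on (by linarith) ((ca 1 1).intervalIntegrable _ _)
      (cD.intervalIntegrable _ _) fun t _ => S.a_one_one_le_D hk hγ t).trans ?_
    exact intervalIntegral.integral_mono_interval (by linarith) (by linarith) (by linarith)
      (ae_of_all _ fun t => S.D_nonneg hk hγ t) (cD.intervalIntegrable _ _)
  have I5 : ∫ t in (T - 1)..(T + 1), S.G t = (∫ t in (T - 1)..(T + 1), (S.N t + S.Q t))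
      + ∫ t in (T - 1)..(T + 1), S.a 1 1 t :=
    intervalIntegral.integral_add ((cN.add cQ).intervalIntegrable _ _)
      ((ca 1 1).intervalIntegrable _ _)
  have hD0 : 0 ≤ ∫ t in (T - 2 * n)..(T + 2 * n), S.D t :=
    intervalIntegral.integral_nonneg (by linarith) fun t _ => S.D_nonneg hk hγ t
  rw [I5]
  have J1 := key.trans (mul_le_mul_of_nonneg_left I2 hK.le)
  have J2 : 4 / (n : ℝ) ^ 2 * (∫ t in (T - 2 * n)..(T + 2 * n), S.Q t) ≤ 8 * |C| / n := by
    refine (mul_le_mul_of_nonneg_left I3 (by positivity)).trans_eq ?_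
    field_simp
    ring
  have J3 : K * (4 * B ^ 2 * ((2 + n ^ 2) * (∫ t in (T - 2 * n)..(T + 2 * n), S.D t)
      + 4 / n ^ 2 * ∫ t in (T - 2 * n)..(T + 2 * n), S.Q t)) ≤
      K * (4 * B ^ 2) * (1 + 8 * |C|) * (2 + n ^ 2) *
        (∫ t in (T - 2 * n)..(T + 2 * n), S.D t) + K * (4 * B ^ 2) * (1 + 8 * |C|) / n := by
    calc _ ≤ K * (4 * B ^ 2 * ((2 + n ^ 2) * (∫ t in (T - 2 * n)..(T + 2 * n), S.D t)
        + 8 * |C| / n)) := by gcongr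
      _ = K * (4 * B ^ 2) * 1 * (2 + n ^ 2) * (∫ t in (T - 2 * n)..(T + 2 * n), S.D t)
        + K * (4 * B ^ 2) * (8 * |C|) / n := by ring
      _ ≤ _ := by
        gcongr
        · linarith [abs_nonneg C]
        · linarith
  linarith

lemma tendsto_integral_G (hk : 0 < k) (hγ : 0 ≤ γ) (hp : 1 < p)
    (h₁ : 2 * κ < p * (2 * γ + 2 * k)) (h₂ : κ ^ 2 < p * (γ * (γ + 2 * k))) :
    Tendsto (fun T => ∫ t in (T - 1)..(T + 1), S.G t) atTop (𝓝 0) := by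
  obtain ⟨C, hC, h⟩ := S.exists_integral_le_integral_D hk hγ hp h₁ h₂
  obtain ⟨-, -, hD⟩ := S.exists_tendsto_energy hk hγ hp h₁ h₂
  rw [Metric.tendsto_atTop']
  intro ε hε
  obtain ⟨n, hn⟩ := exists_nat_gt (C / (ε / 2))
  have hn0 : (0 : ℝ) < n := lt_trans (by positivity) hn
  have hn1 : 1 ≤ n := by exact_mod_cast hn0
  have hCn : C / n < ε / 2 := by
    rw [div_lt_iff₀ (by positivity)] at hn ⊢
    linarith
  have h2 := (hD (2 * n)).const_mul (C * (2 + (n : ℝ) ^ 2) + 1)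
  rw [mul_zero] at h2
  obtain ⟨T, hT⟩ := eventually_atTop.1 (h2.eventually (gt_mem_nhds (half_pos hε)))
  refine ⟨max T (S.T₀ + 2 * n + 2), fun t ht => ?_⟩
  have a1 := hT t ((le_max_left _ _).trans ht.le)
  have a2 := h n hn1 t ((le_max_right _ _).trans_lt ht)
  have a3 : 0 ≤ ∫ t in (t - 1)..(t + 1), S.G t :=
    intervalIntegral.integral_nonneg (by linarith) fun t _ =>
      (S.a_nonneg 0 t).trans (S.moments_le_G t).1
  rw [Real.dist_eq, sub_zero, abs_of_nonneg a3]
  linarith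

/-- Decay of the moments entering the monotone energy. -/
theorem tendsto_moments (hk : 0 < k) (hγ : 0 ≤ γ) (hp : 1 < p)
    (h₁ : 2 * κ < p * (2 * γ + 2 * k)) (h₂ : κ ^ 2 < p * (γ * (γ + 2 * k))) :
    Tendsto S.V atTop (𝓝 0) ∧ Tendsto (S.a 0 0) atTop (𝓝 0) ∧ Tendsto (S.a 1 0) atTop (𝓝 0) ∧
    Tendsto (S.a 1 1) atTop (𝓝 0) ∧ Tendsto (S.b 0 0) atTop (𝓝 0) ∧
    Tendsto (fun t => S.a 2 1 t + S.b 1 0 t) atTop (𝓝 0) := by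
  have hG := S.tendsto_integral_G hk hγ hp h₁ h₂
  obtain ⟨C, hC, hFW⟩ := S.exists_abs_le_G (by linarith)
  obtain ⟨l, hl, -⟩ := S.exists_tendsto_energy hk hγ hp h₁ h₂
  have cG := S.continuous_G
  have ca := S.continuous_a
  have cb := S.continuous_b
  have hG0 : ∀ t, 0 ≤ S.G t := fun t => (S.a_nonneg 0 t).trans (S.moments_le_G t).1
  have ha : ∀ i j t, i ≤ 2 → j ≤ 2 → |S.a i j t| ≤ S.G t := by
    intro i j t hi hj
    obtain ⟨g0, g1, g2, -⟩ := S.moments_le_G t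
    have hd : ∀ i, i ≤ 2 → S.a i i t ≤ S.G t := fun i hi => by interval_cases i <;> assumption
    linarith [S.abs_a_le i j t, hd i hi, hd j hj]
  have hb : ∀ i j t, i ≤ 1 → j ≤ 1 → |S.b i j t| ≤ S.G t := by
    intro i j t hi hj
    obtain ⟨-, -, -, g0, g1, -⟩ := S.moments_le_G t
    have hd : ∀ i, i ≤ 1 → S.b i i t ≤ S.G t := fun i hi => by interval_cases i <;> assumption
    linarith [S.abs_b_le i j t, hd i hi, hd j hj]
  have ta : ∀ i j, i ≤ 1 → j ≤ 1 → Tendsto (S.a i j) atTop (𝓝 0) := fun i j hi hj =>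
    tendsto_zero_of_abs_le_of_abs_deriv_le (C := 2) (S.hasDerivAt_a i j)
      ((ca _ _).add (ca _ _)) cG
      (fun t => by linarith [ha i j t (by omega) (by omega), hG0 t])
      (fun t => (abs_add_le _ _).trans (by
        linarith [ha (i + 1) j t (by omega) (by omega), ha i (j + 1) t (by omega) (by omega)])) hG
  have tb : Tendsto (S.b 0 0) atTop (𝓝 0) :=
    tendsto_zero_of_abs_le_of_abs_deriv_le (C := 2) (S.hasDerivAt_b 0 0)
      ((cb _ _).add (cb _ _)) cG
      (fun t => by linarith [hb 0 0 t (by omega) (by omega), hG0 t])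
      (fun t => (abs_add_le _ _).trans (by
        linarith [hb (0 + 1) 0 t (by omega) (by omega), hb 0 (0 + 1) t (by omega) (by omega)])) hG
  have tV : Tendsto S.V atTop (𝓝 0) := by
    refine tendsto_zero_of_integral_tendsto_zero hk S.continuous_F S.hasDerivAt_V' ?_
    have h3 := hG.const_mul C
    rw [mul_zero] at h3
    refine squeeze_zero (fun t => intervalIntegral.integral_nonneg (by linarith)
      fun _ _ => abs_nonneg _) (fun t => ?_) h3
    rw [← intervalIntegral.integral_const_mul]
    refine (intervalIntegral.integral_mono_on (by linarith)
      (S.continuous_F.abs.intervalIntegrable _ _) ((cG.const_mul C).intervalIntegrable _ _)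
      fun τ _ => (hFW τ).1).trans ?_
    exact intervalIntegral.integral_mono_interval (by linarith) (by linarith) le_rfl
      (ae_of_all _ fun τ => mul_nonneg hC.le (hG0 τ)) ((cG.const_mul C).intervalIntegrable _ _)
  have tW : Tendsto S.W atTop (𝓝 l) := by simpa using hl.sub tV
  have hl0 : l = 0 := eq_zero_of_tendsto_of_abs_le cG (fun t => (hFW t).2) hG tW
  rw [hl0] at tW
  have t00 := ta 0 0 (by norm_num) (by norm_num)
  have t10 := ta 1 0 (by norm_num) (by norm_num)
  have t11 := ta 1 1 (by norm_num) (by norm_num)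
  refine ⟨tV, t00, t10, t11, tb, ?_⟩
  have := (((tW.add t11).sub (t10.const_mul γ)).sub (t00.const_mul γ)).sub tb
  simp only [mul_zero, sub_zero, add_zero] at this
  refine this.congr fun t => ?_
  simp only [W]
  rw [S.a_symm 1 2, S.a_symm 0 1, S.b_symm 0 1]
  ring

end SphericalMoments

section linDeriv

variable {F : Type*} [NormedAddCommGroup F] [NormedSpace ℝ F]

/-- The derivative of `f` along the linear vector field `x ↦ M x`. -/
noncomputable def linDeriv (M : F →L[ℝ] F) (f : F → ℝ) (x : F) : ℝ := fderiv ℝ f x (M x)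

variable {M N : F →L[ℝ] F} {f g : F → ℝ} {x : F}

lemma ContDiff.linDeriv (hf : ContDiff ℝ (⊤ : ℕ∞) f) (M : F →L[ℝ] F) :
    ContDiff ℝ (⊤ : ℕ∞) (linDeriv M f) :=
  (hf.fderiv_right (m := (⊤ : ℕ∞)) (by exact_mod_cast le_top)).clm_apply M.contDiff

lemma ContDiff.continuous_linDeriv (hf : ContDiff ℝ 1 f) (M : F →L[ℝ] F) :
    Continuous (_root_.linDeriv M f) :=
  (hf.continuous_fderiv one_ne_zero).clm_apply M.continuous

lemma linDeriv_add (hf : DifferentiableAt ℝ f x) (hg : DifferentiableAt ℝ g x) :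
    linDeriv M (fun y => f y + g y) x = linDeriv M f x + linDeriv M g x := by
  simp [linDeriv, fderiv_fun_add hf hg]

lemma linDeriv_const_mul (c : ℝ) (hf : DifferentiableAt ℝ f x) :
    linDeriv M (fun y => c * f y) x = c * linDeriv M f x := by
  simp [linDeriv, fderiv_const_mul hf]

lemma linDeriv_mul (hf : DifferentiableAt ℝ f x) (hg : DifferentiableAt ℝ g x) :
    linDeriv M (fun y => f y * g y) x = linDeriv M f x * g x + f x * linDeriv M g x := by
  simp [linDeriv, fderiv_fun_mul hf hg]
  ring

lemma linDeriv_fun_sum {ι : Type*} (s : Finset ι) {f : ι → F → ℝ}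
    (hf : ∀ i ∈ s, DifferentiableAt ℝ (f i) x) :
    linDeriv M (fun y => ∑ i ∈ s, f i y) x = ∑ i ∈ s, linDeriv M (f i) x := by
  simp [linDeriv, fderiv_fun_sum hf]

lemma linDeriv_linDeriv (hf : ContDiff ℝ (⊤ : ℕ∞) f) (M N : F →L[ℝ] F) (x : F) :
    linDeriv M (linDeriv N f) x = fderiv ℝ (fderiv ℝ f) x (M x) (N x) + fderiv ℝ f x (N (M x)) := by
  have h : DifferentiableAt ℝ (fderiv ℝ f) x :=
    (hf.fderiv_right (m := (⊤ : ℕ∞)) (by exact_mod_cast le_top)).contDiffAt.differentiableAt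
      (by simp)
  have := (h.hasFDerivAt.clm_apply N.hasFDerivAt).fderiv
  change fderiv ℝ (fun y => fderiv ℝ f y (N y)) x (M x) = _
  rw [this]
  simp [add_comm]

lemma linDeriv_id_comm (hf : ContDiff ℝ (⊤ : ℕ∞) f) (N : F →L[ℝ] F) :
    linDeriv (.id ℝ F) (linDeriv N f) = linDeriv N (linDeriv (.id ℝ F) f) := by
  ext x
  rw [linDeriv_linDeriv hf, linDeriv_linDeriv hf]
  have h : IsSymmSndFDerivAt ℝ f x := hf.contDiffAt.isSymmSndFDerivAt (by
    rw [minSmoothness_of_isRCLikeNormedField]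
    exact WithTop.coe_le_coe.2 le_top)
  simp [h.eq x (N x)]

end linDeriv

section angular

variable {n : ℕ}

/-- The generator `x ↦ xᵢ eⱼ - xⱼ eᵢ` of the rotations in the `(i, j)`-plane. -/
noncomputable def rotGen (i j : Fin n) : EuclideanSpace ℝ (Fin n) →L[ℝ] EuclideanSpace ℝ (Fin n) :=
  (EuclideanSpace.proj i : _ →L[ℝ] ℝ).smulRight (EuclideanSpace.single j 1) -
    (EuclideanSpace.proj j : _ →L[ℝ] ℝ).smulRight (EuclideanSpace.single i 1)

lemma rotGen_apply (i j : Fin n) (x : EuclideanSpace ℝ (Fin n)) :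
    rotGen i j x = x i • EuclideanSpace.single j 1 - x j • EuclideanSpace.single i 1 := by
  simp [rotGen]

/-- Minus the Laplace–Beltrami operator in the angular variables. -/
noncomputable def angLap (f : EuclideanSpace ℝ (Fin n) → ℝ) (x : EuclideanSpace ℝ (Fin n)) : ℝ :=
  -(1 / 2 * ∑ i, ∑ j, linDeriv (rotGen i j) (linDeriv (rotGen i j) f) x)

/-- The inner product of the angular gradients. -/
noncomputable def angInner (f g : EuclideanSpace ℝ (Fin n) → ℝ)
    (x : EuclideanSpace ℝ (Fin n)) : ℝ :=
  1 / 2 * ∑ i, ∑ j, linDeriv (rotGen i j) f x * linDeriv (rotGen i j) g x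

variable {f g : EuclideanSpace ℝ (Fin n) → ℝ}

lemma ContDiff.angLap (hf : ContDiff ℝ (⊤ : ℕ∞) f) : ContDiff ℝ (⊤ : ℕ∞) (angLap f) :=
  (contDiff_const.mul (ContDiff.sum fun i _ => ContDiff.sum fun j _ =>
    (hf.linDeriv (rotGen i j)).linDeriv (rotGen i j))).neg

lemma ContDiff.angInner (hf : ContDiff ℝ (⊤ : ℕ∞) f) (hg : ContDiff ℝ (⊤ : ℕ∞) g) :
    ContDiff ℝ (⊤ : ℕ∞) (angInner f g) :=
  contDiff_const.mul (ContDiff.sum fun i _ => ContDiff.sum fun j _ =>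
    (hf.linDeriv (rotGen i j)).mul (hg.linDeriv (rotGen i j)))

lemma angInner_comm (f g : EuclideanSpace ℝ (Fin n) → ℝ) : angInner f g = angInner g f := by
  ext x
  simp only [angInner, mul_comm]

lemma angInner_self_nonneg (f : EuclideanSpace ℝ (Fin n) → ℝ) (x : EuclideanSpace ℝ (Fin n)) :
    0 ≤ angInner f f x :=
  mul_nonneg (by norm_num) (Finset.sum_nonneg fun i _ => Finset.sum_nonneg fun j _ =>
    mul_self_nonneg _)

lemma ContDiff.differentiableAt_of_top {F : Type*} [NormedAddCommGroup F] [NormedSpace ℝ F]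
    {f : F → ℝ} (hf : ContDiff ℝ (⊤ : ℕ∞) f) (x : F) : DifferentiableAt ℝ f x :=
  hf.contDiffAt.differentiableAt (by simp)

lemma linDeriv_sum_sum {F : Type*} [NormedAddCommGroup F] [NormedSpace ℝ F] {M : F →L[ℝ] F}
    (c : ℝ) {φ : Fin n → Fin n → F → ℝ} (hφ : ∀ i j, ContDiff ℝ (⊤ : ℕ∞) (φ i j)) (x : F) :
    linDeriv M (fun y => c * ∑ i, ∑ j, φ i j y) x = c * ∑ i, ∑ j, linDeriv M (φ i j) x := by
  have h : ∀ i, ContDiff ℝ (⊤ : ℕ∞) fun y => ∑ j, φ i j y := fun i =>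
    ContDiff.sum fun j _ => hφ i j
  have h' : ContDiff ℝ (⊤ : ℕ∞) fun y => ∑ i, ∑ j, φ i j y := ContDiff.sum fun i _ => h i
  rw [linDeriv_const_mul _ (h'.differentiableAt_of_top x), linDeriv_fun_sum _ fun i _ =>
    (h i).differentiableAt_of_top x]
  simp_rw [linDeriv_fun_sum _ fun j _ => (hφ _ j).differentiableAt_of_top x]

lemma linDeriv_id_angLap (hf : ContDiff ℝ (⊤ : ℕ∞) f) :
    linDeriv (.id ℝ _) (angLap f) = angLap (linDeriv (.id ℝ _) f) := by
  ext x
  have e : angLap f = fun y => -(1 / 2) *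
      ∑ i, ∑ j, linDeriv (rotGen i j) (linDeriv (rotGen i j) f) y := by
    ext y
    rw [angLap]
    ring
  rw [e, linDeriv_sum_sum _ fun i j => (hf.linDeriv _).linDeriv _, angLap]
  simp_rw [linDeriv_id_comm (hf.linDeriv _), linDeriv_id_comm hf]
  ring

lemma linDeriv_id_angInner (hf : ContDiff ℝ (⊤ : ℕ∞) f) (hg : ContDiff ℝ (⊤ : ℕ∞) g)
    (x : EuclideanSpace ℝ (Fin n)) :
    linDeriv (.id ℝ _) (angInner f g) x =
      angInner (linDeriv (.id ℝ _) f) g x + angInner f (linDeriv (.id ℝ _) g) x := by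
  change linDeriv (.id ℝ _) (fun y => 1 / 2 *
    ∑ i, ∑ j, linDeriv (rotGen i j) f y * linDeriv (rotGen i j) g y) x = _
  rw [linDeriv_sum_sum _ fun i j => (hf.linDeriv _).mul (hg.linDeriv _)]
  simp_rw [linDeriv_mul ((hf.linDeriv _).differentiableAt_of_top x)
    ((hg.linDeriv _).differentiableAt_of_top x), linDeriv_id_comm hf, linDeriv_id_comm hg,
    angInner, Finset.sum_add_distrib, mul_add]

lemma angLap_add (hf : ContDiff ℝ (⊤ : ℕ∞) f) (hg : ContDiff ℝ (⊤ : ℕ∞) g) :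
    angLap (fun y => f y + g y) = fun y => angLap f y + angLap g y := by
  have h : ∀ i j : Fin n, linDeriv (rotGen i j) (fun y => f y + g y) =
      fun y => linDeriv (rotGen i j) f y + linDeriv (rotGen i j) g y := fun i j => by
    ext y
    exact linDeriv_add (hf.differentiableAt_of_top y) (hg.differentiableAt_of_top y)
  ext x
  simp_rw [angLap, h, linDeriv_add ((hf.linDeriv _).differentiableAt_of_top x)
    ((hg.linDeriv _).differentiableAt_of_top x), Finset.sum_add_distrib]
  ring

lemma angLap_const_mul (c : ℝ) (hf : ContDiff ℝ (⊤ : ℕ∞) f) :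
    angLap (fun y => c * f y) = fun y => c * angLap f y := by
  have h : ∀ i j : Fin n, linDeriv (rotGen i j) (fun y => c * f y) =
      fun y => c * linDeriv (rotGen i j) f y := fun i j => by
    ext y
    exact linDeriv_const_mul c (hf.differentiableAt_of_top y)
  ext x
  simp_rw [angLap, h, linDeriv_const_mul c ((hf.linDeriv _).differentiableAt_of_top x),
    ← Finset.mul_sum]
  ring

/-- The angular Laplacian commutes with multiplication by radial functions. -/
lemma angLap_mul_of_linDeriv_eq_zero (hf : ContDiff ℝ (⊤ : ℕ∞) f) (hg : ContDiff ℝ (⊤ : ℕ∞) g)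
    (h0 : ∀ i j, linDeriv (rotGen i j) g = 0) :
    angLap (fun y => g y * f y) = fun y => g y * angLap f y := by
  have h : ∀ i j : Fin n, ∀ {f}, ContDiff ℝ (⊤ : ℕ∞) f →
      linDeriv (rotGen i j) (fun y => g y * f y) =
      fun y => g y * linDeriv (rotGen i j) f y := fun i j f hf => by
    ext y
    rw [linDeriv_mul (hg.differentiableAt_of_top y) (hf.differentiableAt_of_top y), h0]
    simp
  ext x
  simp_rw [angLap, h _ _ hf, h _ _ (hf.linDeriv _), ← Finset.mul_sum]
  ring

lemma sum_coord_smul_single (x : EuclideanSpace ℝ (Fin n)) :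
    ∑ i, x i • EuclideanSpace.single i (1 : ℝ) = x := by
  simpa using (EuclideanSpace.basisFun (Fin n) ℝ).sum_repr x

lemma norm_sq_mul_lap (hf : ContDiff ℝ (⊤ : ℕ∞) f) (x : EuclideanSpace ℝ (Fin n)) :
    ‖x‖ ^ 2 * lap n f x = linDeriv (.id ℝ _) (linDeriv (.id ℝ _) f) x
      + ((n : ℝ) - 2) * linDeriv (.id ℝ _) f x - angLap f x := by
  set H := fderiv ℝ (fderiv ℝ f) x with hH
  set e : Fin n → EuclideanSpace ℝ (Fin n) := fun i => EuclideanSpace.single i 1 with he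
  have hx : ∑ i, x i • e i = x := sum_coord_smul_single x
  have hHx : ∀ v, ∑ i, x i * H (e i) v = H x v := fun v => by
    conv_rhs => rw [← hx]
    simp
  have hHx' : ∀ v, ∑ i, x i * H v (e i) = H v x := fun v => by
    conv_rhs => rw [← hx]
    simp
  have hgx : ∑ i, x i * fderiv ℝ f x (e i) = fderiv ℝ f x x := by
    conv_rhs => arg 2; rw [← hx]
    simp
  have hn : ∑ i, x i * x i = ‖x‖ ^ 2 := by
    rw [EuclideanSpace.norm_sq_eq]
    simp [sq]
  have hsum : ∀ i j, linDeriv (rotGen i j) (linDeriv (rotGen i j) f) x =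
      x i * x i * H (e j) (e j) - x i * (x j * H (e j) (e i)) - x j * (x i * H (e i) (e j))
      + x j * x j * H (e i) (e i)
      + (2 * (if i = j then x i * fderiv ℝ f x (e j) else 0) - x i * fderiv ℝ f x (e i)
      - x j * fderiv ℝ f x (e j)) := by
    intro i j
    rw [linDeriv_linDeriv hf]
    simp only [rotGen_apply, map_sub, map_smul, sub_apply,
      smul_apply, smul_eq_mul, ← hH]
    rcases eq_or_ne i j with rfl | hij
    · simp [he]
      ring
    · simp [he, hij, hij.symm]
      ring
  have s1 : ∑ i, ∑ j, x i * x i * H (e j) (e j) = ‖x‖ ^ 2 * ∑ i, H (e i) (e i) := by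
    rw [← hn, Finset.sum_mul_sum]
  have s2 : ∑ i, ∑ j, x i * (x j * H (e j) (e i)) = H x x := by
    simp_rw [← Finset.mul_sum, hHx, hHx']
  have s3 : ∑ i, ∑ j, x j * (x i * H (e i) (e j)) = H x x := Finset.sum_comm.trans s2
  have s4 : ∑ i, ∑ j, x j * x j * H (e i) (e i) = ‖x‖ ^ 2 * ∑ i, H (e i) (e i) :=
    Finset.sum_comm.trans s1
  have s5 : ∑ i, ∑ j, 2 * (if i = j then x i * fderiv ℝ f x (e j) else 0) =
      2 * fderiv ℝ f x x := by
    simp [← hgx, Finset.mul_sum]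
  have s6 : ∑ i, ∑ _j : Fin n, x i * fderiv ℝ f x (e i) = n * fderiv ℝ f x x := by
    simp [← hgx, Finset.mul_sum]
  have s7 : ∑ _i : Fin n, ∑ j, x j * fderiv ℝ f x (e j) = n * fderiv ℝ f x x :=
    Finset.sum_comm.trans s6
  rw [linDeriv_linDeriv hf, angLap]
  simp_rw [hsum, Finset.sum_add_distrib, Finset.sum_sub_distrib, s1, s2, s3, s4, s5, s6, s7]
  have hlap : lap n f x = ∑ i, H (e i) (e i) := by
    simp [lap, iteratedFDeriv_two_apply, hH, he]
  rw [hlap]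
  simp [linDeriv]
  ring

lemma angInner_self (f : EuclideanSpace ℝ (Fin n) → ℝ) (x : EuclideanSpace ℝ (Fin n)) :
    angInner f f x = ‖x‖ ^ 2 * ‖gradient f x‖ ^ 2 - linDeriv (.id ℝ _) f x ^ 2 := by
  set g := gradient f x with hg
  have h : ∀ v, fderiv ℝ f x v = ∑ i, g i * v i := fun v => by
    have : fderiv ℝ f x v = ⟪g, v⟫ := by simp [hg, gradient]
    rw [this, PiLp.inner_apply]
    simp [mul_comm]
  have hn : ‖x‖ ^ 2 = ∑ i, x i * x i := by
    rw [EuclideanSpace.norm_sq_eq]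
    simp [sq]
  have hgn : ‖g‖ ^ 2 = ∑ i, g i * g i := by
    rw [EuclideanSpace.norm_sq_eq]
    simp [sq]
  have hL : ∀ i j, linDeriv (rotGen i j) f x = x i * g j - x j * g i := fun i j => by
    have : ∀ k, fderiv ℝ f x (EuclideanSpace.single k 1) = g k := fun k => by simp [h]
    simp [linDeriv, rotGen_apply, this]
  have hX : linDeriv (.id ℝ _) f x = ∑ i, g i * x i := h x
  rw [hX, hn, hgn, angInner]
  have hs : ∀ i j, linDeriv (rotGen i j) f x * linDeriv (rotGen i j) f x =
      x i * x i * (g j * g j) + g i * g i * (x j * x j) - 2 * (g i * x i) * (g j * x j) :=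
    fun i j => by rw [hL]; ring
  simp_rw [hs, Finset.sum_sub_distrib, Finset.sum_add_distrib, ← Finset.mul_sum,
    ← Finset.sum_mul, ← Finset.mul_sum]
  ring

end angular

section eulerIter

variable {n : ℕ} {f u : EuclideanSpace ℝ (Fin n) → ℝ} {β : ℝ}

lemma contDiff_lap (hf : ContDiff ℝ (⊤ : ℕ∞) f) : ContDiff ℝ (⊤ : ℕ∞) (lap n f) := by
  have h2 : ContDiff ℝ (⊤ : ℕ∞) (fderiv ℝ (fderiv ℝ f)) :=
    (hf.fderiv_right (m := (⊤ : ℕ∞)) (by exact_mod_cast le_top)).fderiv_right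
      (m := (⊤ : ℕ∞)) (by exact_mod_cast le_top)
  have e : lap n f = fun x => ∑ i : Fin n, fderiv ℝ (fderiv ℝ f) x
      (EuclideanSpace.single i 1) (EuclideanSpace.single i 1) := by
    ext x
    simp [lap, iteratedFDeriv_two_apply]
  rw [e]
  exact ContDiff.sum fun i _ => (h2.clm_apply contDiff_const).clm_apply contDiff_const

/-- The iterates `(x · ∇ + β)ⁱ u`. -/
noncomputable def eulerIter (β : ℝ) (u : EuclideanSpace ℝ (Fin n) → ℝ) :
    ℕ → EuclideanSpace ℝ (Fin n) → ℝ
  | 0 => u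
  | i + 1 => fun x => linDeriv (.id ℝ _) (eulerIter β u i) x + β * eulerIter β u i x

lemma contDiff_eulerIter (hu : ContDiff ℝ (⊤ : ℕ∞) u) (i : ℕ) :
    ContDiff ℝ (⊤ : ℕ∞) (eulerIter β u i) := by
  induction i with
  | zero => exact hu
  | succ i ih => exact (ih.linDeriv _).add (contDiff_const.mul ih)

lemma linDeriv_id_eulerIter (β : ℝ) (u : EuclideanSpace ℝ (Fin n) → ℝ) (i : ℕ) :
    linDeriv (.id ℝ _) (eulerIter β u i) =
      fun x => eulerIter β u (i + 1) x + -β * eulerIter β u i x := by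
  ext x
  simp [eulerIter]

lemma linDeriv_id_angLap_eulerIter (hu : ContDiff ℝ (⊤ : ℕ∞) u) (i : ℕ) :
    linDeriv (.id ℝ _) (angLap (eulerIter β u i)) =
      fun x => angLap (eulerIter β u (i + 1)) x + -β * angLap (eulerIter β u i) x := by
  rw [linDeriv_id_angLap (contDiff_eulerIter hu i), linDeriv_id_eulerIter,
    angLap_add (contDiff_eulerIter hu _) (contDiff_const.mul (contDiff_eulerIter hu _)),
    angLap_const_mul _ (contDiff_eulerIter hu _)]

lemma norm_sq_mul_lap_eq_eulerIter (hu : ContDiff ℝ (⊤ : ℕ∞) u) (β : ℝ)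
    (x : EuclideanSpace ℝ (Fin n)) :
    ‖x‖ ^ 2 * lap n u x = eulerIter β u 2 x + (n - 2 - 2 * β) * eulerIter β u 1 x
      + -(β * (n - 2 - β)) * eulerIter β u 0 x + -1 * angLap (eulerIter β u 0) x := by
  have hs := contDiff_eulerIter (β := β) hu
  have h0 := linDeriv_id_eulerIter β u 0
  have h1 := linDeriv_id_eulerIter β u 1
  rw [norm_sq_mul_lap hu]
  change linDeriv (.id ℝ _) (linDeriv (.id ℝ _) (eulerIter β u 0)) x
      + ((n : ℝ) - 2) * linDeriv (.id ℝ _) (eulerIter β u 0) x - angLap (eulerIter β u 0) x = _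
  rw [h0, linDeriv_add ((hs _).differentiableAt_of_top x)
    ((contDiff_const.mul (hs _)).differentiableAt_of_top x),
    linDeriv_const_mul _ ((hs _).differentiableAt_of_top x), h0, h1]
  ring

lemma linDeriv_rotGen_norm_sq (i j : Fin n) :
    linDeriv (rotGen i j) (fun x : EuclideanSpace ℝ (Fin n) => ‖x‖ ^ 2) = 0 := by
  ext x
  have := (hasStrictFDerivAt_norm_sq x).hasFDerivAt.fderiv
  simp only [linDeriv, this, rotGen_apply]
  simp [inner_sub_right, inner_smul_right, EuclideanSpace.inner_single_right]
  ring

lemma linDeriv_id_norm_sq_mul (hf : ContDiff ℝ (⊤ : ℕ∞) f) :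
    linDeriv (.id ℝ _) (fun x : EuclideanSpace ℝ (Fin n) => ‖x‖ ^ 2 * f x) =
      fun x => ‖x‖ ^ 2 * (linDeriv (.id ℝ _) f x + 2 * f x) := by
  ext x
  have h2 : ContDiff ℝ (⊤ : ℕ∞) fun x : EuclideanSpace ℝ (Fin n) => ‖x‖ ^ 2 := contDiff_norm_sq ℝ
  have h3 : linDeriv (.id ℝ _) (fun x : EuclideanSpace ℝ (Fin n) => ‖x‖ ^ 2) x =
      2 * ‖x‖ ^ 2 := by
    simp [linDeriv, (hasStrictFDerivAt_norm_sq x).hasFDerivAt.fderiv]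
  rw [linDeriv_mul (h2.differentiableAt_of_top x) (hf.differentiableAt_of_top x), h3]
  ring

lemma norm_pow_four_mul_lap_lap (hu : ContDiff ℝ (⊤ : ℕ∞) u) {y : EuclideanSpace ℝ (Fin n) → ℝ}
    (hy : ∀ x, ‖x‖ ^ 2 * lap n u x = y x) (x : EuclideanSpace ℝ (Fin n)) :
    ‖x‖ ^ 4 * lap n (lap n u) x = linDeriv (.id ℝ _) (linDeriv (.id ℝ _) y) x
      + (n - 6) * linDeriv (.id ℝ _) y x - (2 * n - 8) * y x - angLap y x := by
  have hg := contDiff_lap hu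
  have h2 : ContDiff ℝ (⊤ : ℕ∞) fun x : EuclideanSpace ℝ (Fin n) => ‖x‖ ^ 2 := contDiff_norm_sq ℝ
  obtain rfl : (fun x => ‖x‖ ^ 2 * lap n u x) = y := funext hy
  rw [angLap_mul_of_linDeriv_eq_zero hg h2 linDeriv_rotGen_norm_sq, linDeriv_id_norm_sq_mul hg,
    linDeriv_id_norm_sq_mul ((hg.linDeriv _).add (contDiff_const.mul hg))]
  dsimp only
  rw [
    linDeriv_add ((hg.linDeriv _).differentiableAt_of_top x)
      ((contDiff_const.mul hg).differentiableAt_of_top x),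
    linDeriv_const_mul _ (hg.differentiableAt_of_top x)]
  have := norm_sq_mul_lap hg x
  linear_combination ‖x‖ ^ 2 * this

lemma linDeriv_comb {M} {f₁ f₂ f₃ f₄ : EuclideanSpace ℝ (Fin n) → ℝ} {b c d : ℝ}
    (h₁ : ContDiff ℝ (⊤ : ℕ∞) f₁) (h₂ : ContDiff ℝ (⊤ : ℕ∞) f₂) (h₃ : ContDiff ℝ (⊤ : ℕ∞) f₃)
    (h₄ : ContDiff ℝ (⊤ : ℕ∞) f₄) (x : EuclideanSpace ℝ (Fin n)) :
    linDeriv M (fun x => f₁ x + b * f₂ x + c * f₃ x + d * f₄ x) x = linDeriv M f₁ x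
      + b * linDeriv M f₂ x + c * linDeriv M f₃ x + d * linDeriv M f₄ x := by
  have k₂ := contDiff_const (c := b).mul h₂
  have k₃ := contDiff_const (c := c).mul h₃
  have k₄ := contDiff_const (c := d).mul h₄
  rw [linDeriv_add (((h₁.add k₂).add k₃).differentiableAt_of_top x)
      (k₄.differentiableAt_of_top x), linDeriv_add ((h₁.add k₂).differentiableAt_of_top x)
      (k₃.differentiableAt_of_top x), linDeriv_add (h₁.differentiableAt_of_top x)
      (k₂.differentiableAt_of_top x), linDeriv_const_mul _ (h₂.differentiableAt_of_top x),
    linDeriv_const_mul _ (h₃.differentiableAt_of_top x),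
    linDeriv_const_mul _ (h₄.differentiableAt_of_top x)]

lemma angLap_comb {f₁ f₂ f₃ f₄ : EuclideanSpace ℝ (Fin n) → ℝ} {b c d : ℝ}
    (h₁ : ContDiff ℝ (⊤ : ℕ∞) f₁) (h₂ : ContDiff ℝ (⊤ : ℕ∞) f₂) (h₃ : ContDiff ℝ (⊤ : ℕ∞) f₃)
    (h₄ : ContDiff ℝ (⊤ : ℕ∞) f₄) :
    angLap (fun x => f₁ x + b * f₂ x + c * f₃ x + d * f₄ x) = fun x => angLap f₁ x
      + b * angLap f₂ x + c * angLap f₃ x + d * angLap f₄ x := by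
  have k₂ := contDiff_const (c := b).mul h₂
  have k₃ := contDiff_const (c := c).mul h₃
  have k₄ := contDiff_const (c := d).mul h₄
  rw [angLap_add ((h₁.add k₂).add k₃) k₄, angLap_add (h₁.add k₂) k₃, angLap_add h₁ k₂,
    angLap_const_mul _ h₂, angLap_const_mul _ h₃, angLap_const_mul _ h₄]

lemma norm_pow_four_mul_lap_lap_eq_eulerIter (hu : ContDiff ℝ (⊤ : ℕ∞) u) {k γ : ℝ}
    (hk : k = n - 4 - 2 * β) (hγ : γ = β * (n - 2 - β)) (x : EuclideanSpace ℝ (Fin n)) :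
    ‖x‖ ^ 4 * lap n (lap n u) x = eulerIter β u 4 x + 2 * k * eulerIter β u 3 x
      + ((k + 2) * (k - 2) - 2 * γ - 2 * k) * eulerIter β u 2 x
      - 2 * angLap (eulerIter β u 2) x - (2 * k * γ + 2 * k * (k + 2)) * eulerIter β u 1 x
      - 2 * k * angLap (eulerIter β u 1) x + angLap (angLap (eulerIter β u 0)) x
      + (2 * γ + 2 * k) * angLap (eulerIter β u 0) x + γ * (γ + 2 * k) * eulerIter β u 0 x := by
  have hs := contDiff_eulerIter (β := β) hu
  have hA := fun i => (hs i).angLap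
  have h0 := linDeriv_id_eulerIter β u
  have hA0 := linDeriv_id_angLap_eulerIter (β := β) hu
  set Y : ℕ → EuclideanSpace ℝ (Fin n) → ℝ := fun i x => eulerIter β u (i + 2) x +
    (k + 2) * eulerIter β u (i + 1) x + -γ * eulerIter β u i x
    + -1 * angLap (eulerIter β u i) x with hY
  have hYs : ∀ i, ContDiff ℝ (⊤ : ℕ∞) (Y i) := fun i =>
    (((hs _).add (contDiff_const.mul (hs _))).add (contDiff_const.mul (hs _))).add
      (contDiff_const.mul (hA _))
  have hXY : ∀ i, linDeriv (.id ℝ _) (Y i) = fun x => Y (i + 1) x + -β * Y i x := fun i => by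
    ext x
    rw [hY, linDeriv_comb (hs _) (hs _) (hs _) (hA _), h0, h0, h0, hA0]
    ring
  have hAY : angLap (Y 0) = fun x => angLap (eulerIter β u 2) x +
      (k + 2) * angLap (eulerIter β u 1) x + -γ * angLap (eulerIter β u 0) x
      + -1 * angLap (angLap (eulerIter β u 0)) x :=
    angLap_comb (hs _) (hs _) (hs _) (hA _)
  rw [norm_pow_four_mul_lap_lap hu (y := Y 0) (fun x => by
    rw [norm_sq_mul_lap_eq_eulerIter hu β, hY, hk, hγ]; ring), hXY, hAY,
    linDeriv_add ((hYs _).differentiableAt_of_top x)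
      ((contDiff_const.mul (hYs _)).differentiableAt_of_top x),
    linDeriv_const_mul _ ((hYs _).differentiableAt_of_top x), hXY, hXY, hY, hγ, hk]
  ring

end eulerIter

section rotationInvariant

variable {E : Type*} [NormedAddCommGroup E] [InnerProductSpace ℝ E] [FiniteDimensional ℝ E]
  [MeasurableSpace E] [BorelSpace E]

/-- A measure concentrated on the unit sphere and invariant under linear isometries. -/
structure IsSphericalMeasure (μ : Measure E) : Prop where
  map_eq : ∀ R : E ≃ₗᵢ[ℝ] E, μ.map R = μ
  ae_norm : ∀ᵐ x ∂μ, ‖x‖ = 1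

namespace IsSphericalMeasure

variable {μ ν : Measure E}

omit [FiniteDimensional ℝ E] in
lemma integral_comp (hμ : IsSphericalMeasure μ) (R : E ≃ₗᵢ[ℝ] E) (f : E → ℝ) :
    ∫ x, f (R x) ∂μ = ∫ x, f x ∂μ := by
  conv_rhs => rw [← hμ.map_eq R]
  exact (integral_map_equiv R.toHomeomorph.toMeasurableEquiv f).symm

omit [FiniteDimensional ℝ E] [MeasurableSpace E] [BorelSpace E] in
lemma exists_isometry_apply_eq {x y : E} (h : ‖x‖ = ‖y‖) : ∃ R : E ≃ₗᵢ[ℝ] E, R x = y :=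
  ⟨_, Submodule.reflection_sub h⟩

omit [BorelSpace E] in
lemma exists_norm_le (hμ : IsSphericalMeasure μ) {f : E → ℝ} (hf : Continuous f) :
    ∃ C, ∀ᵐ x ∂μ, ‖f x‖ ≤ C := by
  obtain ⟨C, hC⟩ := (isCompact_sphere (0 : E) 1).exists_bound_of_continuousOn hf.continuousOn
  exact ⟨C, hμ.ae_norm.mono fun x hx => hC x (by simpa using hx)⟩

lemma integrable [IsFiniteMeasure μ] (hμ : IsSphericalMeasure μ) {f : E → ℝ}
    (hf : Continuous f) : Integrable f μ := by
  obtain ⟨C, hC⟩ := hμ.exists_norm_le hf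
  exact Integrable.of_bound hf.aestronglyMeasurable C hC

omit [FiniteDimensional ℝ E] [BorelSpace E] in
lemma ae_prod_norm [IsFiniteMeasure μ] [IsFiniteMeasure ν] (hμ : IsSphericalMeasure μ)
    (hν : IsSphericalMeasure ν) : ∀ᵐ z ∂(μ.prod ν), ‖z.1‖ = 1 ∧ ‖z.2‖ = 1 :=
  (Measure.quasiMeasurePreserving_fst.ae hμ.ae_norm).and
    (Measure.quasiMeasurePreserving_snd.ae hν.ae_norm)

lemma integrable_prod [IsFiniteMeasure μ] [IsFiniteMeasure ν] (hμ : IsSphericalMeasure μ)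
    (hν : IsSphericalMeasure ν) {f : E × E → ℝ} (hf : Continuous f) :
    Integrable f (μ.prod ν) := by
  obtain ⟨C, hC⟩ := ((isCompact_sphere (0 : E) 1).prod
    (isCompact_sphere (0 : E) 1)).exists_bound_of_continuousOn hf.continuousOn
  exact Integrable.of_bound hf.aestronglyMeasurable C ((hμ.ae_prod_norm hν).mono fun z hz =>
    hC z (by simpa using hz))

omit [FiniteDimensional ℝ E] in
lemma integral_kernel_eq (hμ : IsSphericalMeasure μ) (k : ℝ → ℝ) {y y' : E}
    (h : ‖y‖ = ‖y'‖) : ∫ x, k (dist x y) ∂μ = ∫ x, k (dist x y') ∂μ := by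
  obtain ⟨R, rfl⟩ := exists_isometry_apply_eq h
  rw [← hμ.integral_comp R fun x => k (dist x (R y))]
  simp

omit [FiniteDimensional ℝ E] in
lemma measure_ball_eq (hμ : IsSphericalMeasure μ) {y y' : E} (h : ‖y‖ = ‖y'‖) (ε : ℝ) :
    μ (ball y ε) = μ (ball y' ε) := by
  obtain ⟨R, rfl⟩ := exists_isometry_apply_eq h
  conv_lhs => rw [← hμ.map_eq R.symm]
  rw [Measure.map_apply R.symm.continuous.measurable measurableSet_ball]
  simp

omit [FiniteDimensional ℝ E] [BorelSpace E] in
lemma measure_compl_sphere (hμ : IsSphericalMeasure μ) : μ (sphere (0 : E) 1)ᶜ = 0 :=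
  measure_eq_zero_iff_ae_notMem.2 (hμ.ae_norm.mono fun x hx => by simp [hx])

lemma integral_kernel_pos [IsFiniteMeasure μ] (hμ : IsSphericalMeasure μ) (h0 : μ ≠ 0)
    {y : E} (hy : ‖y‖ = 1) {ε : ℝ} (hε : 0 < ε) : 0 < ∫ x, max 0 (ε - dist x y) ∂μ := by
  have hc : ∀ y : E, Continuous fun x => max 0 (ε - dist x y) := fun y => by fun_prop
  have hk : ∀ y x : E, 0 ≤ max 0 (ε - dist x y) := fun y x => le_max_left _ _
  refine (integral_nonneg (hk y)).lt_of_ne fun h => h0 ?_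
  have hS : μ (sphere (0 : E) 1) = 0 := by
    refine (isCompact_sphere (0 : E) 1).measure_zero_of_nhdsWithin fun x hx => ?_
    refine ⟨ball x ε, mem_nhdsWithin_of_mem_nhds (ball_mem_nhds x hε), ?_⟩
    have hx' : ∫ z, max 0 (ε - dist z x) ∂μ = 0 := by
      rw [hμ.integral_kernel_eq (fun d => max 0 (ε - d)) ((mem_sphere_zero_iff_norm.1 hx).trans hy.symm)]
      exact h.symm
    rw [integral_eq_zero_iff_of_nonneg (hk x) (hμ.integrable (hc x))] at hx'
    refine measure_eq_zero_iff_ae_notMem.2 (hx'.mono fun z hz hzx => ?_)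
    have : ε - dist z x ≤ 0 := by simpa using hz
    linarith [mem_ball.1 hzx]
  rw [← Measure.measure_univ_eq_zero, ← Set.union_compl_self (sphere (0 : E) 1)]
  exact measure_union_null hS hμ.measure_compl_sphere

lemma abs_kernel_sub_le [IsFiniteMeasure μ] [IsFiniteMeasure ν] (hμ : IsSphericalMeasure μ)
    (hν : IsSphericalMeasure ν) {f : E → ℝ} (hf : Continuous f) {y₀ : E} (hy₀ : ‖y₀‖ = 1)
    {ε ω : ℝ} (hfω : ∀ x y, ‖x‖ = 1 → ‖y‖ = 1 → dist y x < ε → |f y - f x| ≤ ω) :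
    |(∫ x, max 0 (ε - dist x y₀) ∂μ) * (∫ y, f y ∂ν) -
      (∫ y, max 0 (ε - dist y y₀) ∂ν) * (∫ x, f x ∂μ)| ≤
      ω * (∫ y, max 0 (ε - dist y y₀) ∂ν) * μ.real univ := by
  set k : ℝ → ℝ := fun d => max 0 (ε - d) with hk
  have hk0 : ∀ d, 0 ≤ k d := fun d => le_max_left _ _
  have hkc : Continuous k := by fun_prop
  have hKμ : ∀ y, ‖y‖ = 1 → ∫ x, k (dist x y) ∂μ = ∫ x, k (dist x y₀) ∂μ := fun y hy =>
    hμ.integral_kernel_eq k (hy.trans hy₀.symm)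
  have hKν : ∀ x, ‖x‖ = 1 → ∫ y, k (dist y x) ∂ν = ∫ y, k (dist y y₀) ∂ν := fun y hy =>
    hν.integral_kernel_eq k (hy.trans hy₀.symm)
  have e1 : (∫ x, k (dist x y₀) ∂μ) * (∫ y, f y ∂ν) =
      ∫ x, ∫ y, f y * k (dist y x) ∂ν ∂μ := by
    rw [integral_integral_swap (hμ.integrable_prod hν
      (f := fun z : E × E => f z.2 * k (dist z.2 z.1)) (by fun_prop)), ← integral_const_mul]
    refine integral_congr_ae (hν.ae_norm.mono fun y hy => ?_)
    simp only [integral_const_mul, dist_comm y, hKμ y hy]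
    ring
  have e2 : (∫ y, k (dist y y₀) ∂ν) * (∫ x, f x ∂μ) =
      ∫ x, ∫ y, f x * k (dist y x) ∂ν ∂μ := by
    rw [← integral_const_mul]
    refine integral_congr_ae (hμ.ae_norm.mono fun x hx => ?_)
    simp only [integral_const_mul, hKν x hx]
    ring
  have i1 : Integrable (fun x => ∫ y, f y * k (dist y x) ∂ν) μ :=
    (hμ.integrable_prod hν (f := fun z : E × E => f z.2 * k (dist z.2 z.1))
      (by fun_prop)).integral_prod_left
  have i2 : Integrable (fun x => ∫ y, f x * k (dist y x) ∂ν) μ :=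
    (hμ.integrable_prod hν (f := fun z : E × E => f z.1 * k (dist z.2 z.1))
      (by fun_prop)).integral_prod_left
  rw [e1, e2, ← integral_sub i1 i2, ← Real.norm_eq_abs]
  refine norm_integral_le_of_norm_le_const (hμ.ae_norm.mono fun x hx => ?_)
  rw [← integral_sub (hν.integrable (by fun_prop)) (hν.integrable (by fun_prop)),
    ← hKν x hx, ← integral_const_mul]
  refine norm_integral_le_of_norm_le (hν.integrable (by fun_prop))
    (hν.ae_norm.mono fun y hy => ?_)
  rw [← sub_mul, norm_mul, Real.norm_eq_abs, Real.norm_eq_abs, abs_of_nonneg (hk0 _)]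
  rcases lt_or_ge (dist y x) ε with h | h
  · exact mul_le_mul_of_nonneg_right (hfω x y hx hy h) (hk0 _)
  · have : k (dist y x) = 0 := max_eq_left (by linarith)
    simp [this]

lemma integral_eq_mul [IsFiniteMeasure μ] [IsFiniteMeasure ν] (hμ : IsSphericalMeasure μ)
    (hν : IsSphericalMeasure ν) (h0 : ν ≠ 0) {f : E → ℝ} (hf : Continuous f) :
    ∫ x, f x ∂μ = μ.real univ / ν.real univ * ∫ x, f x ∂ν := by
  have : NeZero ν := ⟨h0⟩
  obtain ⟨y₀, hy₀⟩ := hν.ae_norm.exists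
  have hν0 : 0 < ν.real univ := by
    rw [measureReal_def]
    exact ENNReal.toReal_pos (by simpa using h0) (measure_ne_top _ _)
  have key : ∀ ω > 0, |μ.real univ * (∫ x, f x ∂ν) - ν.real univ * ∫ x, f x ∂μ| ≤
      ω * (μ.real univ * ν.real univ) := by
    intro ω hω
    have huc := (isCompact_sphere (0 : E) 1).uniformContinuousOn_of_continuous hf.continuousOn
    obtain ⟨ε, hε, h⟩ := Metric.uniformContinuousOn_iff_le.1 huc ω hω
    have hC := hν.integral_kernel_pos h0 hy₀ hε
    have h1 := hμ.abs_kernel_sub_le hν hf hy₀ (ε := ε) (ω := ω) fun x y hx hy hxy =>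
      h y (by simpa using hy) x (by simpa using hx) hxy.le
    have h2 := hμ.abs_kernel_sub_le hν (continuous_const (y := (1 : ℝ))) hy₀ (ε := ε) (ω := 0)
      fun x y hx hy hxy => by simp
    set A := ∫ x, max 0 (ε - dist x y₀) ∂μ
    set B := ∫ x, max 0 (ε - dist x y₀) ∂ν
    simp only [integral_const, smul_eq_mul, mul_one, zero_mul] at h2
    have h3 : A * ν.real univ = B * μ.real univ := by
      have := abs_nonpos_iff.1 h2
      linarith
    have h4 := mul_le_mul_of_nonneg_left h1 hν0.le
    rw [← abs_of_pos hν0, ← abs_mul, abs_of_pos hν0,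
      show ν.real univ * (A * (∫ y, f y ∂ν) - B * ∫ x, f x ∂μ) =
      B * (μ.real univ * (∫ x, f x ∂ν) - ν.real univ * ∫ x, f x ∂μ) by
        linear_combination (∫ y, f y ∂ν) * h3, abs_mul, abs_of_pos hC] at h4
    refine le_of_mul_le_mul_left (h4.trans_eq (by ring)) hC
  have hz : |μ.real univ * (∫ x, f x ∂ν) - ν.real univ * ∫ x, f x ∂μ| ≤ 0 := by
    refine le_of_forall_pos_le_add fun δ hδ => ?_
    have hP : 0 ≤ μ.real univ * ν.real univ := by positivity
    refine (key (δ / (μ.real univ * ν.real univ + 1)) (by positivity)).trans ?_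
    rw [zero_add, div_mul_eq_mul_div, div_le_iff₀ (by positivity)]
    nlinarith
  have := abs_nonpos_iff.1 hz
  field_simp
  linarith

lemma measure_ball_eq_top (hμ : IsSphericalMeasure μ) (h : μ univ = ⊤) {x : E} (hx : ‖x‖ = 1)
    {ε : ℝ} (hε : 0 < ε) : μ (ball x ε) = ⊤ := by
  by_contra hb
  have hS : μ (sphere (0 : E) 1) < ⊤ := by
    refine (isCompact_sphere (0 : E) 1).measure_lt_top_of_nhdsWithin fun y hy => ?_
    refine ⟨ball y ε, mem_nhdsWithin_of_mem_nhds (ball_mem_nhds y hε), ?_⟩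
    rw [hμ.measure_ball_eq ((mem_sphere_zero_iff_norm.1 hy).trans hx.symm)]
    exact lt_top_iff_ne_top.2 hb
  refine (lt_top_iff_ne_top.1 ((measure_union_le (sphere (0 : E) 1) (sphere (0 : E) 1)ᶜ).trans_lt
    ?_)) (by rwa [Set.union_compl_self])
  rwa [hμ.measure_compl_sphere, add_zero]

lemma integral_eq_zero_of_measure_eq_top (hμ : IsSphericalMeasure μ) (h : μ univ = ⊤) {f : E → ℝ}
    (hf : Continuous f) : ∫ x, f x ∂μ = 0 := by
  by_cases h0 : ∀ x : E, ‖x‖ = 1 → f x = 0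
  · exact integral_eq_zero_of_ae (hμ.ae_norm.mono h0)
  push Not at h0
  obtain ⟨x, hx, hfx⟩ := h0
  refine integral_undef fun hi => ?_
  have hpos : 0 < ‖f x‖ := norm_pos_iff.2 hfx
  obtain ⟨ε, hε, hb⟩ := Metric.eventually_nhds_iff_ball.1
    (hf.norm.continuousAt.eventually (lt_mem_nhds (half_lt_self hpos)) :
      ∀ᶠ y in 𝓝 x, ‖f x‖ / 2 < ‖f y‖)
  have := hi.measure_norm_ge_lt_top (half_pos hpos)
  refine this.not_ge ?_
  rw [← hμ.measure_ball_eq_top h hx hε]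
  exact measure_mono fun y hy => (hb y hy).le

theorem exists_integral_eq_mul (hμ : IsSphericalMeasure μ) [IsFiniteMeasure ν]
    (hν : IsSphericalMeasure ν) (h0 : ν ≠ 0) :
    ∃ c : ℝ, ∀ f : E → ℝ, Continuous f → ∫ x, f x ∂μ = c * ∫ x, f x ∂ν := by
  by_cases h : μ univ = ⊤
  · exact ⟨0, fun f hf => by rw [hμ.integral_eq_zero_of_measure_eq_top h hf, zero_mul]⟩
  · have : IsFiniteMeasure μ := ⟨lt_top_iff_ne_top.2 h⟩
    exact ⟨_, fun f hf => hμ.integral_eq_mul hν h0 hf⟩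

end IsSphericalMeasure

end rotationInvariant

section sphereMeasure

variable {E : Type*} [NormedAddCommGroup E] [InnerProductSpace ℝ E] [FiniteDimensional ℝ E]
  [MeasurableSpace E] [BorelSpace E]

/-- The surface measure of the unit sphere, as a measure on the ambient space. -/
noncomputable def sphereMeasure (E : Type*) [NormedAddCommGroup E] [InnerProductSpace ℝ E]
    [FiniteDimensional ℝ E] [MeasurableSpace E] [BorelSpace E] : Measure E :=
  (volume : Measure E).toSphere.map (↑)

instance : IsFiniteMeasure (sphereMeasure E) := by
  unfold sphereMeasure
  infer_instance

open scoped Pointwise in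
lemma isSphericalMeasure_sphereMeasure : IsSphericalMeasure (sphereMeasure E) where
  map_eq R := by
    ext s hs
    have hR : Measurable R := R.continuous.measurable
    have hset (s : Set E) : Ioo (0 : ℝ) 1 • (R ⁻¹' s) = R ⁻¹' (Ioo (0 : ℝ) 1 • s) := by
      ext x
      simp only [Set.mem_smul, Set.mem_preimage]
      constructor
      · rintro ⟨t, ht, y, hy, rfl⟩
        exact ⟨t, ht, R y, hy, by simp⟩
      · rintro ⟨t, ht, y, hy, h⟩
        exact ⟨t, ht, R.symm y, by simpa using hy, by rw [← map_smul, h]; simp⟩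
    rw [Measure.map_apply hR hs, sphereMeasure, Measure.map_apply measurable_subtype_coe (hR hs),
      Measure.map_apply measurable_subtype_coe hs,
      Measure.toSphere_apply' _ (measurable_subtype_coe (hR hs)),
      Measure.toSphere_apply' _ (measurable_subtype_coe hs), Subtype.image_preimage_coe,
      Subtype.image_preimage_coe]
    have h : sphere (0 : E) 1 ∩ R ⁻¹' s = R ⁻¹' (sphere (0 : E) 1 ∩ s) := by
      ext x; simp
    rw [h, hset]
    congr 1
    exact (R.measurePreserving).measure_preimage_equiv (f := R.toMeasurableEquiv) _
  ae_norm := by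
    rw [sphereMeasure]
    refine (ae_map_iff measurable_subtype_coe.aemeasurable
      (isClosed_eq continuous_norm continuous_const).measurableSet).2 ?_
    exact Eventually.of_forall fun x => mem_sphere_zero_iff_norm.1 x.2

lemma sphereMeasure_ne_zero [Nontrivial E] : sphereMeasure E ≠ 0 := by
  rw [sphereMeasure, Ne, Measure.map_eq_zero_iff measurable_subtype_coe.aemeasurable]
  exact Measure.toSphere_ne_zero _

omit [FiniteDimensional ℝ E] in
lemma isSphericalMeasure_hausdorffMeasure (d : ℝ) :
    IsSphericalMeasure ((Measure.hausdorffMeasure d).restrict (sphere (0 : E) 1)) where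
  map_eq R := by
    have h : R ⁻¹' sphere (0 : E) 1 = sphere (0 : E) 1 := by ext x; simp
    have := Measure.restrict_map (μ := Measure.hausdorffMeasure d) R.continuous.measurable
      (isClosed_sphere (x := (0 : E)) (ε := 1)).measurableSet
    rw [h] at this
    rw [← this]
    congr 1
    exact R.toIsometryEquiv.map_hausdorffMeasure d
  ae_norm := (ae_restrict_mem isClosed_sphere.measurableSet).mono fun _ hx =>
    mem_sphere_zero_iff_norm.1 hx

omit [FiniteDimensional ℝ E] in
lemma setIntegral_sphere_hausdorffMeasure {d : ℝ} (hd : 0 ≤ d) {r : ℝ} (hr : 0 < r) (f : E → ℝ) :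
    ∫ x in sphere (0 : E) r, f x ∂(Measure.hausdorffMeasure d)
      = r ^ d * ∫ x in sphere (0 : E) 1, f (r • x) ∂(Measure.hausdorffMeasure d) := by
  have hmap : Measure.map (fun x : E => r • x) (Measure.hausdorffMeasure d)
      = (‖r‖₊⁻¹ ^ d) • Measure.hausdorffMeasure d := by
    rw [← map_homothety_hausdorffMeasure hd (0 : E) hr.ne']
    congr 1
    ext x
    simp [AffineMap.homothety_apply]
  have hpre : (fun x : E => r • x) ⁻¹' sphere (0 : E) r = sphere (0 : E) 1 := by
    ext x
    simp [norm_smul, abs_of_pos hr, hr.ne']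
  have he : MeasurableEmbedding fun x : E => r • x := measurableEmbedding_const_smul₀ hr.ne'
  have := he.setIntegral_map (μ := Measure.hausdorffMeasure d) f (sphere (0 : E) r)
  rw [hpre, hmap] at this
  rw [← this, Measure.restrict_smul, integral_smul_nnreal_measure, NNReal.smul_def, smul_eq_mul,
    ← mul_assoc, NNReal.coe_rpow, NNReal.coe_inv, coe_nnnorm, Real.norm_of_nonneg hr.le,
    Real.inv_rpow hr.le, mul_inv_cancel₀ (Real.rpow_pos_of_pos hr d).ne', one_mul]

end sphereMeasure

section radialIntegral

variable {E : Type*} [NormedAddCommGroup E] [InnerProductSpace ℝ E] [FiniteDimensional ℝ E]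
  [MeasurableSpace E] [BorelSpace E] {f g : E → ℝ}

/-- The integral over directions `θ` of `f (exp t • θ)`. -/
noncomputable def radialIntegral (f : E → ℝ) (t : ℝ) : ℝ :=
  ∫ θ, f (Real.exp t • θ) ∂(sphereMeasure E)

lemma integrable_radial (hf : Continuous f) (t : ℝ) :
    Integrable (fun θ => f (Real.exp t • θ)) (sphereMeasure E) :=
  isSphericalMeasure_sphereMeasure.integrable (hf.comp (continuous_const_smul _))

lemma radialIntegral_add (hf : Continuous f) (hg : Continuous g) (t : ℝ) :
    radialIntegral (fun x => f x + g x) t = radialIntegral f t + radialIntegral g t :=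
  integral_add (integrable_radial hf t) (integrable_radial hg t)

lemma radialIntegral_const_mul (c : ℝ) (f : E → ℝ) (t : ℝ) :
    radialIntegral (fun x => c * f x) t = c * radialIntegral f t :=
  integral_const_mul _ _

lemma radialIntegral_congr {t : ℝ} (h : ∀ x, ‖x‖ = Real.exp t → f x = g x) :
    radialIntegral f t = radialIntegral g t := by
  refine integral_congr_ae (isSphericalMeasure_sphereMeasure.ae_norm.mono fun θ hθ => h _ ?_)
  rw [norm_smul, hθ, mul_one, Real.norm_of_nonneg (Real.exp_pos t).le]

lemma radialIntegral_mono (hf : Continuous f) (hg : Continuous g) {t : ℝ}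
    (h : ∀ x, ‖x‖ = Real.exp t → f x ≤ g x) : radialIntegral f t ≤ radialIntegral g t := by
  refine integral_mono_ae (integrable_radial hf t) (integrable_radial hg t)
    (isSphericalMeasure_sphereMeasure.ae_norm.mono fun θ hθ => h _ ?_)
  rw [norm_smul, hθ, mul_one, Real.norm_of_nonneg (Real.exp_pos t).le]

lemma radialIntegral_nonneg (h : ∀ x, 0 ≤ f x) (t : ℝ) : 0 ≤ radialIntegral f t :=
  integral_nonneg fun _ => h _

lemma hasDerivAt_integral_flow (hf : ContDiff ℝ 1 f) {M : E →L[ℝ] E} {y : ℝ → E → E} {s₀ C : ℝ}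
    (hy : ∀ s, Continuous (y s)) (hC : ∀ s ∈ ball s₀ 1, ∀ θ, ‖θ‖ = 1 → ‖y s θ‖ ≤ C)
    (hd : ∀ s θ, HasDerivAt (fun s => y s θ) (M (y s θ)) s) :
    HasDerivAt (fun s => ∫ θ, f (y s θ) ∂(sphereMeasure E))
      (∫ θ, linDeriv M f (y s₀ θ) ∂(sphereMeasure E)) s₀ := by
  have hσ := isSphericalMeasure_sphereMeasure (E := E)
  have hf' := hf.continuous_linDeriv M
  obtain ⟨B, hB⟩ := (isCompact_closedBall (0 : E) C).exists_bound_of_continuousOn hf'.continuousOn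
  refine (hasDerivAt_integral_of_dominated_loc_of_deriv_le (F := fun s θ => f (y s θ))
    (F' := fun s θ => linDeriv M f (y s θ)) (bound := fun _ => B) (ball_mem_nhds s₀ one_pos)
    ?_ ?_ ?_ ?_ (integrable_const _) ?_).2
  · exact Eventually.of_forall fun s => (hf.continuous.comp (hy s)).aestronglyMeasurable
  · exact hσ.integrable (hf.continuous.comp (hy s₀))
  · exact (hf'.comp (hy s₀)).aestronglyMeasurable
  · exact hσ.ae_norm.mono fun θ hθ s hs => hB _ (mem_closedBall_zero_iff.2 (hC s hs θ hθ))
  · exact Eventually.of_forall fun θ s _ =>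
      ((hf.differentiable one_ne_zero (y s θ)).hasFDerivAt.comp_hasDerivAt s (hd s θ))

lemma hasDerivAt_radialIntegral (hf : ContDiff ℝ 1 f) (t : ℝ) :
    HasDerivAt (radialIntegral f) (radialIntegral (linDeriv (.id ℝ E) f) t) t := by
  refine hasDerivAt_integral_flow (y := fun s θ => Real.exp s • θ) (C := Real.exp (t + 1)) hf
    (fun s => continuous_const_smul _) (fun s hs θ hθ => ?_)
    (fun s θ => (Real.hasDerivAt_exp s).smul_const θ)
  rw [norm_smul, hθ, mul_one, Real.norm_of_nonneg (Real.exp_pos s).le, Real.exp_le_exp]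
  rw [Real.ball_eq_Ioo] at hs
  exact hs.2.le

lemma continuous_radialIntegral (hf : ContDiff ℝ 1 f) : Continuous (radialIntegral f) :=
  continuous_iff_continuousAt.2 fun t => (hasDerivAt_radialIntegral hf t).continuousAt

lemma radialIntegral_linDeriv_eq_zero {M : E →L[ℝ] E} (hM : M.adjoint = -M)
    (hf : ContDiff ℝ 1 f) (t : ℝ) : radialIntegral (linDeriv M f) t = 0 := by
  have hU (s : ℝ) : NormedSpace.exp (s • M) ∈ unitary (E →L[ℝ] E) := by
    have : NormedAlgebra ℚ (E →L[ℝ] E) := .restrictScalars ℚ ℝ _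
    refine NormedSpace.exp_mem_unitary_of_mem_skewAdjoint (skewAdjoint.mem_iff.2 ?_)
    rw [ContinuousLinearMap.star_eq_adjoint, map_smulₛₗ, hM, smul_neg]
    rfl
  have hconst (s : ℝ) : ∫ θ, f (NormedSpace.exp (s • M) (Real.exp t • θ)) ∂(sphereMeasure E)
      = radialIntegral f t := by
    have := isSphericalMeasure_sphereMeasure.integral_comp
      (Unitary.linearIsometryEquiv ⟨_, hU s⟩) (fun θ => f (Real.exp t • θ))
    rw [radialIntegral, ← this]
    refine integral_congr_ae (Eventually.of_forall fun θ => ?_)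
    simp only [map_smul]
    rfl
  have h := hasDerivAt_integral_flow (M := M) (s₀ := 0) (C := Real.exp t)
    (y := fun s θ => NormedSpace.exp (s • M) (Real.exp t • θ)) hf (fun s => by fun_prop)
    (fun s _ θ hθ => ?_) (fun s θ => ?_)
  · simp only [hconst] at h
    have h0 := h.unique (hasDerivAt_const _ _)
    simpa [radialIntegral] using h0
  · rw [Unitary.norm_map ⟨_, hU s⟩, norm_smul, hθ, mul_one, Real.norm_of_nonneg (Real.exp_pos t).le]
  · simpa using (hasDerivAt_exp_smul_const' M s).clm_apply (hasDerivAt_const s (Real.exp t • θ))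

end radialIntegral

section angularParts

variable {n : ℕ} {f g : EuclideanSpace ℝ (Fin n) → ℝ}

lemma adjoint_rotGen (i j : Fin n) :
    (rotGen i j).adjoint = -rotGen i j := by
  refine ((ContinuousLinearMap.eq_adjoint_iff _ _).2 fun x y => ?_).symm
  simp [rotGen_apply, inner_sub_left, inner_sub_right, inner_smul_left, inner_smul_right,
    EuclideanSpace.inner_single_left, EuclideanSpace.inner_single_right]
  ring

lemma angInner_sub_mul_angLap (hf : ContDiff ℝ (⊤ : ℕ∞) f) (hg : ContDiff ℝ (⊤ : ℕ∞) g)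
    (x : EuclideanSpace ℝ (Fin n)) : angInner f g x - f x * angLap g x
      = 1 / 2 * ∑ i, ∑ j, linDeriv (rotGen i j) (fun y => f y * linDeriv (rotGen i j) g y) x := by
  have h (i j : Fin n) : linDeriv (rotGen i j) (fun y => f y * linDeriv (rotGen i j) g y) x
      = linDeriv (rotGen i j) f x * linDeriv (rotGen i j) g x
        + f x * linDeriv (rotGen i j) (linDeriv (rotGen i j) g) x := by
    rw [linDeriv_mul (hf.differentiableAt_of_top x)
      ((hg.linDeriv _).differentiableAt_of_top x)]
  simp only [h, Finset.sum_add_distrib, ← Finset.mul_sum, angInner, angLap]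
  ring

lemma radialIntegral_mul_angLap (hf : ContDiff ℝ (⊤ : ℕ∞) f) (hg : ContDiff ℝ (⊤ : ℕ∞) g)
    (t : ℝ) : radialIntegral (fun x => f x * angLap g x) t = radialIntegral (angInner f g) t := by
  have hsm (i j : Fin n) : ContDiff ℝ (⊤ : ℕ∞) fun y => f y * linDeriv (rotGen i j) g y :=
    hf.mul (hg.linDeriv _)
  have h0 : radialIntegral (fun x => angInner f g x - f x * angLap g x) t = 0 := by
    simp only [angInner_sub_mul_angLap hf hg, radialIntegral_const_mul]
    refine mul_eq_zero_of_right _ ?_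
    rw [radialIntegral, integral_finsetSum _ fun i _ => integrable_finsetSum _ fun j _ =>
      integrable_radial ((hsm i j).linDeriv _).continuous t]
    refine Finset.sum_eq_zero fun i _ => ?_
    rw [integral_finsetSum _ fun j _ => integrable_radial ((hsm i j).linDeriv _).continuous t]
    exact Finset.sum_eq_zero fun j _ => radialIntegral_linDeriv_eq_zero (adjoint_rotGen i j)
      ((hsm i j).of_le (by exact_mod_cast le_top)) t
  have h1 := radialIntegral_add (f := fun x => f x * angLap g x)
    (g := fun x => angInner f g x - f x * angLap g x) (hf.mul hg.angLap).continuous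
    ((hf.angInner hg).sub (hf.mul hg.angLap)).continuous t
  rw [h0, add_zero] at h1
  rw [← h1]
  simp

end angularParts

section polar

variable {E : Type*} [NormedAddCommGroup E] [InnerProductSpace ℝ E] [FiniteDimensional ℝ E]
  [MeasurableSpace E] [BorelSpace E]

lemma integrable_polar {f : E → ℝ} (hf : Integrable f) :
    Integrable (fun z : sphere (0 : E) 1 × Ioi (0 : ℝ) => f (z.2.1 • z.1.1))
      ((volume : Measure E).toSphere.prod (Measure.volumeIoiPow (Module.finrank ℝ E - 1))) := by
  rw [← (volume : Measure E).measurePreserving_homeomorphUnitSphereProd.integrable_comp_emb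
    (Homeomorph.measurableEmbedding _)]
  have e : ((fun z : sphere (0 : E) 1 × Ioi (0 : ℝ) => f (z.2.1 • z.1.1)) ∘
      homeomorphUnitSphereProd E) = f ∘ Subtype.val := by
    ext x
    have := congrArg Subtype.val ((homeomorphUnitSphereProd E).symm_apply_apply x)
    rw [homeomorphUnitSphereProd_symm_apply_coe] at this
    simp only [Function.comp_apply, this]
  rw [e, ← integrableOn_iff_comap_subtypeVal (measurableSet_singleton _).compl]
  exact hf.integrableOn

lemma integral_polar [Nontrivial E] (f : E → ℝ) :
    ∫ z : sphere (0 : E) 1 × Ioi (0 : ℝ), f (z.2.1 • z.1.1)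
      ∂((volume : Measure E).toSphere.prod (Measure.volumeIoiPow (Module.finrank ℝ E - 1))) = ∫ x, f x := by
  have h : ∫ x, f x = ∫ x : ({0}ᶜ : Set E), f x ∂(volume : Measure E).comap (↑) := by
    rw [integral_subtype_comap (measurableSet_singleton _).compl f, restrict_compl_singleton]
  rw [h, ← (volume : Measure E).measurePreserving_homeomorphUnitSphereProd.integral_comp
    (Homeomorph.measurableEmbedding _)]
  refine integral_congr_ae (Eventually.of_forall fun x => ?_)
  have := congrArg Subtype.val ((homeomorphUnitSphereProd E).symm_apply_apply x)
  rw [homeomorphUnitSphereProd_symm_apply_coe] at this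
  simp only [this]

lemma integral_sphereMeasure (g : E → ℝ) :
    ∫ θ, g θ ∂(sphereMeasure E) = ∫ θ : sphere (0 : E) 1, g θ ∂(volume : Measure E).toSphere :=
  (MeasurableEmbedding.subtype_coe (isClosed_sphere (x := (0 : E))).measurableSet).integral_map _

lemma measurable_ofReal_pow (m : ℕ) : Measurable fun r : Ioi (0 : ℝ) => ENNReal.ofReal (r.1 ^ m) :=
  (measurable_subtype_coe.pow_const _).ennreal_ofReal

lemma image_exp_univ : Real.exp '' univ = Ioi 0 := by
  rw [image_univ, Real.range_exp]

lemma exp_mul_pow {m : ℕ} (hm : m ≠ 0) (t : ℝ) :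
    Real.exp t * Real.exp t ^ (m - 1) = Real.exp (m * t) := by
  rw [← pow_succ', Nat.sub_add_cancel (Nat.one_le_iff_ne_zero.2 hm), ← Real.exp_nat_mul]

variable [Nontrivial E]

lemma integrable_exp_mul_radialIntegral {f : E → ℝ} (hf : Integrable f) :
    Integrable fun t => Real.exp (Module.finrank ℝ E * t) * radialIntegral f t := by
  have h := (integrable_polar hf).integral_prod_right
  rw [Measure.volumeIoiPow, integrable_withDensity_iff_integrable_smul' (measurable_ofReal_pow _)
    (by simp)] at h
  have h1 : IntegrableOn (fun r : ℝ => (ENNReal.ofReal (r ^ (Module.finrank ℝ E - 1))).toReal •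
      ∫ θ : sphere (0 : E) 1, f (r • θ.1) ∂(volume : Measure E).toSphere) (Ioi 0) :=
    (integrableOn_iff_comap_subtypeVal measurableSet_Ioi).2 h
  rw [← image_exp_univ, integrableOn_image_iff_integrableOn_abs_deriv_smul MeasurableSet.univ
    (fun x _ => (Real.hasDerivAt_exp x).hasDerivWithinAt) Real.exp_injective.injOn,
    integrableOn_univ] at h1
  refine h1.congr (Eventually.of_forall fun t => ?_)
  dsimp only
  rw [radialIntegral, integral_sphereMeasure, smul_eq_mul, smul_eq_mul, abs_of_pos (Real.exp_pos t),
    ENNReal.toReal_ofReal (by positivity), ← mul_assoc, exp_mul_pow Module.finrank_pos.ne']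

lemma integral_eq_integral_exp_mul_radialIntegral {f : E → ℝ} (hf : Integrable f) :
    ∫ x, f x = ∫ t, Real.exp (Module.finrank ℝ E * t) * radialIntegral f t := by
  rw [← integral_polar, integral_prod_symm _ (integrable_polar hf), Measure.volumeIoiPow,
    integral_withDensity_eq_integral_toReal_smul (measurable_ofReal_pow _) (by simp),
    integral_subtype_comap measurableSet_Ioi fun r : ℝ =>
      (ENNReal.ofReal (r ^ (Module.finrank ℝ E - 1))).toReal •
        ∫ θ : sphere (0 : E) 1, f (r • θ.1) ∂(volume : Measure E).toSphere,
    ← image_exp_univ, integral_image_eq_integral_abs_deriv_smul MeasurableSet.univ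
    (fun x _ => (Real.hasDerivAt_exp x).hasDerivWithinAt) Real.exp_injective.injOn,
    Measure.restrict_univ]
  refine integral_congr_ae (Eventually.of_forall fun t => ?_)
  dsimp only
  rw [radialIntegral, integral_sphereMeasure, smul_eq_mul, smul_eq_mul, abs_of_pos (Real.exp_pos t),
    ENNReal.toReal_ofReal (by positivity), ← mul_assoc, exp_mul_pow Module.finrank_pos.ne']

lemma hasDerivAt_integral_ball {f : E → ℝ} (hf : ContDiff ℝ 1 f) (t : ℝ) :
    HasDerivAt (fun t => ∫ x in ball 0 (Real.exp t), f x)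
      (Real.exp (Module.finrank ℝ E * t) * radialIntegral f t) t := by
  set g : ℝ → ℝ := fun t => Real.exp (Module.finrank ℝ E * t) * radialIntegral f t with hg
  have hgc : Continuous g := by
    have := continuous_radialIntegral hf
    fun_prop
  have hrad (t s : ℝ) : Real.exp (Module.finrank ℝ E * s) * radialIntegral ((ball 0 (Real.exp t)).indicator f) s
      = (Iio t).indicator g s := by
    by_cases hs : s < t
    · rw [Set.indicator_of_mem (mem_Iio.2 hs), hg]
      refine congrArg _ (radialIntegral_congr fun x hx => Set.indicator_of_mem ?_ _)
      rwa [mem_ball_zero_iff, hx, Real.exp_lt_exp]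
    · rw [Set.indicator_of_notMem (by simpa using hs)]
      refine mul_eq_zero_of_right _ ((radialIntegral_congr (g := fun _ => 0) fun x hx =>
        Set.indicator_of_notMem ?_ _).trans (by simp [radialIntegral]))
      rwa [mem_ball_zero_iff, hx, Real.exp_lt_exp]
  have hfi (t : ℝ) : Integrable ((ball (0 : E) (Real.exp t)).indicator f) :=
    (integrable_indicator_iff measurableSet_ball).2
      ((hf.continuous.continuousOn.integrableOn_compact (isCompact_closedBall 0 _)).mono_set
        ball_subset_closedBall)
  have hI (t : ℝ) : IntegrableOn g (Iic t) := by
    have := integrable_exp_mul_radialIntegral (hfi t)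
    simp only [hrad] at this
    rw [integrableOn_Iic_iff_integrableOn_Iio]
    exact (integrable_indicator_iff measurableSet_Iio).1 this
  have heq (t : ℝ) : ∫ x in ball 0 (Real.exp t), f x = ∫ s in Iic t, g s := by
    rw [← integral_indicator measurableSet_ball,
      integral_eq_integral_exp_mul_radialIntegral (hfi t)]
    simp only [hrad]
    rw [integral_indicator measurableSet_Iio, integral_Iic_eq_integral_Iio]
  have h0 (s : ℝ) : ∫ x in ball 0 (Real.exp s), f x = (∫ x in Iic t, g x) + ∫ x in t..s, g x := by
    rw [heq, ← intervalIntegral.integral_Iic_sub_Iic (hI t) (hI s)]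
    ring
  simp only [h0]
  exact (intervalIntegral.integral_hasDerivAt_right (hgc.intervalIntegrable _ _)
    (hgc.stronglyMeasurableAtFilter _ _) hgc.continuousAt).const_add _

end polar

section weightedIntegral

variable {E : Type*} [NormedAddCommGroup E] [InnerProductSpace ℝ E] [FiniteDimensional ℝ E]
  [MeasurableSpace E] [BorelSpace E] {f g h : E → ℝ} {q : ℝ}

/-- The spherical integral of `f` at radius `exp t`, rescaled by `exp (q * t)`. -/
noncomputable def weightedIntegral (q : ℝ) (f : E → ℝ) (t : ℝ) : ℝ :=
  Real.exp (q * t) * radialIntegral f t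

lemma weightedIntegral_add (hf : Continuous f) (hg : Continuous g) (t : ℝ) :
    weightedIntegral q (fun x => f x + g x) t = weightedIntegral q f t + weightedIntegral q g t := by
  simp only [weightedIntegral, radialIntegral_add hf hg, mul_add]

lemma weightedIntegral_const_mul (c : ℝ) (f : E → ℝ) (t : ℝ) :
    weightedIntegral q (fun x => c * f x) t = c * weightedIntegral q f t := by
  simp only [weightedIntegral, radialIntegral_const_mul]
  ring

lemma weightedIntegral_nonneg (h : ∀ x, 0 ≤ f x) (t : ℝ) : 0 ≤ weightedIntegral q f t :=
  mul_nonneg (Real.exp_pos _).le (radialIntegral_nonneg h t)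

lemma weightedIntegral_congr {q' : ℝ} {t : ℝ} (h : ∀ x, ‖x‖ = Real.exp t →
      Real.exp (q * t) * f x = Real.exp (q' * t) * g x) :
    weightedIntegral q f t = weightedIntegral q' g t := by
  rw [weightedIntegral, weightedIntegral, ← radialIntegral_const_mul, ← radialIntegral_const_mul]
  exact radialIntegral_congr h

lemma hasDerivAt_weightedIntegral (hf : ContDiff ℝ 1 f)
    (h : ∀ x, linDeriv (.id ℝ E) f x + q * f x = g x) (t : ℝ) :
    HasDerivAt (weightedIntegral q f) (weightedIntegral q g t) t := by
  have he : HasDerivAt (fun t => Real.exp (q * t)) (Real.exp (q * t) * q) t := by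
    simpa using ((hasDerivAt_id t).const_mul q).exp
  refine (he.mul (hasDerivAt_radialIntegral hf t)).congr_deriv ?_
  have hg : g = fun x => linDeriv (.id ℝ E) f x + q * f x := funext fun x => (h x).symm
  rw [weightedIntegral, hg, radialIntegral_add (hf.continuous_linDeriv _)
    (g := fun x => q * f x) (continuous_const.mul hf.continuous), radialIntegral_const_mul]
  ring

/-- Cauchy–Schwarz for a family of integrals that depends on a quadratic form. -/
lemma weightedIntegral_sq_le (hf : Continuous f) (hg : Continuous g) (hh : Continuous h)
    (hq : ∀ s x, 0 ≤ f x + (2 * s * g x + s ^ 2 * h x)) (t : ℝ) :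
    weightedIntegral q g t ^ 2 ≤ weightedIntegral q f t * weightedIntegral q h t := by
  have key (s : ℝ) : 0 ≤ weightedIntegral q h t * (s * s) + 2 * weightedIntegral q g t * s
      + weightedIntegral q f t := by
    have := weightedIntegral_nonneg (q := q) (hq s) t
    rw [weightedIntegral_add hf (by fun_prop), weightedIntegral_add (by fun_prop) (by fun_prop),
      weightedIntegral_const_mul, weightedIntegral_const_mul] at this
    linarith
  have := discrim_le_zero key
  rw [discrim] at this
  linarith

end weightedIntegral

section moments

variable {n : ℕ} {u : EuclideanSpace ℝ (Fin n) → ℝ} {β : ℝ}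

/-- The moment `∫ ∂ₜⁱw ∂ₜʲw` over the sphere, `w` being the Emden–Fowler transform of `u`. -/
noncomputable def momentA (β : ℝ) (u : EuclideanSpace ℝ (Fin n) → ℝ) (i j : ℕ) : ℝ → ℝ :=
  weightedIntegral (2 * β) fun x => eulerIter β u i x * eulerIter β u j x

/-- The moment `∫ ⟪∇∂ₜⁱw, ∇∂ₜʲw⟫` of angular gradients. -/
noncomputable def momentB (β : ℝ) (u : EuclideanSpace ℝ (Fin n) → ℝ) (i j : ℕ) : ℝ → ℝ :=
  weightedIntegral (2 * β) (angInner (eulerIter β u i) (eulerIter β u j))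

/-- The moment `∫ Δw Δ∂ₜʲw` of angular Laplacians. -/
noncomputable def momentC (β : ℝ) (u : EuclideanSpace ℝ (Fin n) → ℝ) (j : ℕ) : ℝ → ℝ :=
  weightedIntegral (2 * β) fun x => angLap (eulerIter β u 0) x * angLap (eulerIter β u j) x

lemma momentA_comm (i j : ℕ) : momentA β u i j = momentA β u j i := by
  simp only [momentA, mul_comm]

lemma momentB_comm (i j : ℕ) : momentB β u i j = momentB β u j i := by
  rw [momentB, angInner_comm, momentB]

lemma weightedIntegral_mul_angLap (hu : ContDiff ℝ (⊤ : ℕ∞) u) (i j : ℕ) (t : ℝ) :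
    weightedIntegral (2 * β) (fun x => eulerIter β u i x * angLap (eulerIter β u j) x) t
      = momentB β u i j t := by
  rw [momentB, weightedIntegral, weightedIntegral,
    radialIntegral_mul_angLap (contDiff_eulerIter hu i) (contDiff_eulerIter hu j)]

lemma weightedIntegral_mul_angLap_angLap (hu : ContDiff ℝ (⊤ : ℕ∞) u) (j : ℕ) (t : ℝ) :
    weightedIntegral (2 * β) (fun x => eulerIter β u j x * angLap (angLap (eulerIter β u 0)) x) t
      = momentC β u j t := by
  have h0 := (contDiff_eulerIter (β := β) hu 0).angLap
  have hj := contDiff_eulerIter (β := β) hu j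
  rw [momentC, weightedIntegral, weightedIntegral, radialIntegral_mul_angLap hj h0, angInner_comm,
    radialIntegral_mul_angLap h0 hj]

lemma hasDerivAt_momentA (hu : ContDiff ℝ (⊤ : ℕ∞) u) (i j : ℕ) (t : ℝ) :
    HasDerivAt (momentA β u i j) (momentA β u (i + 1) j t + momentA β u i (j + 1) t) t := by
  have hs := contDiff_eulerIter (β := β) hu
  have hc (i) : Continuous (eulerIter β u i) := (hs i).continuous
  refine (hasDerivAt_weightedIntegral (((hs i).mul (hs j)).of_le (by exact_mod_cast le_top))
    (fun x => ?_) t).congr_deriv (weightedIntegral_add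
      (f := fun x => eulerIter β u (i + 1) x * eulerIter β u j x)
      (g := fun x => eulerIter β u i x * eulerIter β u (j + 1) x) (by fun_prop) (by fun_prop) t)
  rw [linDeriv_mul ((hs i).differentiableAt_of_top x) ((hs j).differentiableAt_of_top x),
    linDeriv_id_eulerIter, linDeriv_id_eulerIter]
  ring

lemma angInner_eulerIter_succ (hu : ContDiff ℝ (⊤ : ℕ∞) u) (i : ℕ)
    (g : EuclideanSpace ℝ (Fin n) → ℝ) (x : EuclideanSpace ℝ (Fin n)) :
    angInner (linDeriv (.id ℝ _) (eulerIter β u i)) g x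
      = angInner (eulerIter β u (i + 1)) g x - β * angInner (eulerIter β u i) g x := by
  have hs := contDiff_eulerIter (β := β) hu
  rw [linDeriv_id_eulerIter]
  simp only [angInner, linDeriv_add ((hs _).differentiableAt_of_top x)
    ((contDiff_const.mul (hs _)).differentiableAt_of_top x),
    linDeriv_const_mul _ ((hs _).differentiableAt_of_top x), add_mul, Finset.sum_add_distrib,
    mul_assoc, ← Finset.mul_sum]
  ring

lemma hasDerivAt_momentB (hu : ContDiff ℝ (⊤ : ℕ∞) u) (i j : ℕ) (t : ℝ) :
    HasDerivAt (momentB β u i j) (momentB β u (i + 1) j t + momentB β u i (j + 1) t) t := by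
  have hs := contDiff_eulerIter (β := β) hu
  have hc (i j) : Continuous (angInner (eulerIter β u i) (eulerIter β u j)) :=
    ((hs i).angInner (hs j)).continuous
  refine (hasDerivAt_weightedIntegral (((hs i).angInner (hs j)).of_le (by exact_mod_cast le_top))
    (fun x => ?_) t).congr_deriv (weightedIntegral_add (hc _ _) (hc _ _) t)
  rw [linDeriv_id_angInner (hs i) (hs j), angInner_eulerIter_succ hu,
    angInner_comm _ (linDeriv _ _), angInner_eulerIter_succ hu, angInner_comm (eulerIter β u (j + 1)),
    angInner_comm (eulerIter β u j)]
  ring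

lemma hasDerivAt_momentC (hu : ContDiff ℝ (⊤ : ℕ∞) u) (t : ℝ) :
    HasDerivAt (momentC β u 0) (2 * momentC β u 1 t) t := by
  have hs (i) := (contDiff_eulerIter (β := β) hu i).angLap
  refine (hasDerivAt_weightedIntegral (((hs 0).mul (hs 0)).of_le (by exact_mod_cast le_top))
    (fun x => ?_) t).congr_deriv (weightedIntegral_const_mul 2 _ t)
  rw [linDeriv_mul ((hs 0).differentiableAt_of_top x) ((hs 0).differentiableAt_of_top x),
    linDeriv_id_angLap_eulerIter hu]
  ring

lemma momentA_nonneg (i : ℕ) (t : ℝ) : 0 ≤ momentA β u i i t :=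
  weightedIntegral_nonneg (fun _ => mul_self_nonneg _) t

lemma momentB_nonneg (i : ℕ) (t : ℝ) : 0 ≤ momentB β u i i t :=
  weightedIntegral_nonneg (fun _ => angInner_self_nonneg _ _) t

lemma momentC_nonneg (t : ℝ) : 0 ≤ momentC β u 0 t :=
  weightedIntegral_nonneg (fun _ => mul_self_nonneg _) t

lemma momentA_sq_le (hu : ContDiff ℝ (⊤ : ℕ∞) u) (i j : ℕ) (t : ℝ) :
    momentA β u i j t ^ 2 ≤ momentA β u i i t * momentA β u j j t := by
  have hc (i) : Continuous (eulerIter β u i) := (contDiff_eulerIter hu i).continuous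
  refine weightedIntegral_sq_le (by fun_prop) (by fun_prop) (by fun_prop) (fun s x => ?_) t
  nlinarith [sq_nonneg (eulerIter β u i x + s * eulerIter β u j x)]

lemma momentB_sq_le (hu : ContDiff ℝ (⊤ : ℕ∞) u) (i j : ℕ) (t : ℝ) :
    momentB β u i j t ^ 2 ≤ momentB β u i i t * momentB β u j j t := by
  have hs := contDiff_eulerIter (β := β) hu
  refine weightedIntegral_sq_le ((hs i).angInner (hs i)).continuous
    ((hs i).angInner (hs j)).continuous ((hs j).angInner (hs j)).continuous (fun s x => ?_) t
  have h := angInner_self_nonneg (fun y => eulerIter β u i y + s * eulerIter β u j y) x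
  have h' (k l : Fin n) : linDeriv (rotGen k l) (fun y => eulerIter β u i y + s * eulerIter β u j y) x
      = linDeriv (rotGen k l) (eulerIter β u i) x + s * linDeriv (rotGen k l) (eulerIter β u j) x := by
    rw [linDeriv_add ((hs _).differentiableAt_of_top x)
      ((contDiff_const.mul (hs _)).differentiableAt_of_top x),
      linDeriv_const_mul _ ((hs _).differentiableAt_of_top x)]
  refine h.trans_eq ?_
  simp only [angInner, h', Finset.mul_sum, ← Finset.sum_add_distrib]
  refine Finset.sum_congr rfl fun k _ => Finset.sum_congr rfl fun l _ => ?_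
  ring

lemma momentB_sq_le_momentA_mul_momentC (hu : ContDiff ℝ (⊤ : ℕ∞) u) (i : ℕ) (t : ℝ) :
    momentB β u i 0 t ^ 2 ≤ momentA β u i i t * momentC β u 0 t := by
  have hc (i) : Continuous (eulerIter β u i) := (contDiff_eulerIter hu i).continuous
  have hA : Continuous (angLap (eulerIter β u 0)) := (contDiff_eulerIter hu 0).angLap.continuous
  rw [← weightedIntegral_mul_angLap hu]
  refine weightedIntegral_sq_le (by fun_prop) (by fun_prop) (by fun_prop) (fun s x => ?_) t
  nlinarith [sq_nonneg (eulerIter β u i x + s * angLap (eulerIter β u 0) x)]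

end moments

section expansions

variable {n : ℕ} {u : EuclideanSpace ℝ (Fin n) → ℝ} {β : ℝ}

lemma weightedIntegral_mul (i j : ℕ) (t : ℝ) :
    weightedIntegral (2 * β) (fun x => eulerIter β u i x * eulerIter β u j x) t
      = momentA β u i j t := rfl

lemma weightedIntegral_angLap_mul (j : ℕ) (t : ℝ) :
    weightedIntegral (2 * β) (fun x => angLap (eulerIter β u 0) x * angLap (eulerIter β u j) x) t
      = momentC β u j t := rfl

lemma weightedIntegral_mul_lap_lap (hu : ContDiff ℝ (⊤ : ℕ∞) u) {k γ : ℝ}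
    (hk : k = n - 4 - 2 * β) (hγ : γ = β * (n - 2 - β)) (j : ℕ) (t : ℝ) :
    weightedIntegral (2 * β) (fun x => eulerIter β u j x * (‖x‖ ^ 4 * lap n (lap n u) x)) t
      = momentA β u 4 j t + 2 * k * momentA β u 3 j t
        + ((k + 2) * (k - 2) - 2 * γ - 2 * k) * momentA β u 2 j t - 2 * momentB β u 2 j t
        - (2 * k * γ + 2 * k * (k + 2)) * momentA β u 1 j t - 2 * k * momentB β u 1 j t
        + momentC β u j t + (2 * γ + 2 * k) * momentB β u 0 j t
        + γ * (γ + 2 * k) * momentA β u 0 j t := by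
  have hc (i) : Continuous (eulerIter β u i) := (contDiff_eulerIter hu i).continuous
  have hA (i) : Continuous (angLap (eulerIter β u i)) := (contDiff_eulerIter hu i).angLap.continuous
  have hAA : Continuous (angLap (angLap (eulerIter β u 0))) :=
    (contDiff_eulerIter hu 0).angLap.angLap.continuous
  have e : (fun x => eulerIter β u j x * (‖x‖ ^ 4 * lap n (lap n u) x)) = fun x =>
      eulerIter β u 4 x * eulerIter β u j x + (2 * k * (eulerIter β u 3 x * eulerIter β u j x)
      + (((k + 2) * (k - 2) - 2 * γ - 2 * k) * (eulerIter β u 2 x * eulerIter β u j x)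
      + (-2 * (eulerIter β u j x * angLap (eulerIter β u 2) x)
      + (-(2 * k * γ + 2 * k * (k + 2)) * (eulerIter β u 1 x * eulerIter β u j x)
      + (-(2 * k) * (eulerIter β u j x * angLap (eulerIter β u 1) x)
      + (eulerIter β u j x * angLap (angLap (eulerIter β u 0)) x
      + ((2 * γ + 2 * k) * (eulerIter β u j x * angLap (eulerIter β u 0) x)
      + γ * (γ + 2 * k) * (eulerIter β u 0 x * eulerIter β u j x)))))))) := by
    ext x
    rw [norm_pow_four_mul_lap_lap_eq_eulerIter hu hk hγ]
    ring
  rw [e]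
  simp (disch := fun_prop) only [weightedIntegral_add, weightedIntegral_const_mul,
    weightedIntegral_mul_angLap hu, weightedIntegral_mul_angLap_angLap hu, weightedIntegral_mul,
    momentB_comm j]
  ring

lemma weightedIntegral_sq (hu : ContDiff ℝ (⊤ : ℕ∞) u) (c₁ c₀ : ℝ) (t : ℝ) :
    weightedIntegral (2 * β) (fun x => (eulerIter β u 2 x + c₁ * eulerIter β u 1 x
        + c₀ * eulerIter β u 0 x - angLap (eulerIter β u 0) x) ^ 2) t
      = momentA β u 2 2 t + c₁ ^ 2 * momentA β u 1 1 t + c₀ ^ 2 * momentA β u 0 0 t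
        + momentC β u 0 t + 2 * c₁ * momentA β u 2 1 t + 2 * c₀ * momentA β u 2 0 t
        - 2 * momentB β u 2 0 t + 2 * c₁ * c₀ * momentA β u 1 0 t - 2 * c₁ * momentB β u 1 0 t
        - 2 * c₀ * momentB β u 0 0 t := by
  have hc (i) : Continuous (eulerIter β u i) := (contDiff_eulerIter hu i).continuous
  have hA (i) : Continuous (angLap (eulerIter β u i)) := (contDiff_eulerIter hu i).angLap.continuous
  have e : (fun x => (eulerIter β u 2 x + c₁ * eulerIter β u 1 x
        + c₀ * eulerIter β u 0 x - angLap (eulerIter β u 0) x) ^ 2) = fun x =>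
      eulerIter β u 2 x * eulerIter β u 2 x + (c₁ ^ 2 * (eulerIter β u 1 x * eulerIter β u 1 x)
      + (c₀ ^ 2 * (eulerIter β u 0 x * eulerIter β u 0 x)
      + (angLap (eulerIter β u 0) x * angLap (eulerIter β u 0) x
      + (2 * c₁ * (eulerIter β u 2 x * eulerIter β u 1 x)
      + (2 * c₀ * (eulerIter β u 2 x * eulerIter β u 0 x)
      + (-2 * (eulerIter β u 2 x * angLap (eulerIter β u 0) x)
      + (2 * c₁ * c₀ * (eulerIter β u 1 x * eulerIter β u 0 x)
      + (-(2 * c₁) * (eulerIter β u 1 x * angLap (eulerIter β u 0) x)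
      + -(2 * c₀) * (eulerIter β u 0 x * angLap (eulerIter β u 0) x))))))))) := by
    ext x
    ring
  rw [e]
  simp (disch := fun_prop) only [weightedIntegral_add, weightedIntegral_const_mul,
    weightedIntegral_mul_angLap hu, weightedIntegral_angLap_mul, weightedIntegral_mul]
  ring

lemma weightedIntegral_comb_sq (hu : ContDiff ℝ (⊤ : ℕ∞) u) (κ e₀ e₁ e₂ : ℝ) (t : ℝ) :
    weightedIntegral (2 * β) (fun x => ((eulerIter β u 2 x + 2 * eulerIter β u 1 x
        + -κ * eulerIter β u 0 x - angLap (eulerIter β u 0) x) * e₀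
        + (2 * eulerIter β u 1 x + 2 * eulerIter β u 0 x) * e₁ + eulerIter β u 0 x * e₂) ^ 2) t
      = (momentA β u 2 2 t + 4 * momentA β u 1 1 t + κ ^ 2 * momentA β u 0 0 t + momentC β u 0 t
          + 4 * momentA β u 2 1 t - 2 * κ * momentA β u 2 0 t - 2 * momentB β u 2 0 t
          - 4 * κ * momentA β u 1 0 t - 4 * momentB β u 1 0 t + 2 * κ * momentB β u 0 0 t) * e₀ ^ 2
        + 2 * (2 * (momentA β u 2 1 t + 2 * momentA β u 1 1 t - κ * momentA β u 1 0 t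
            - momentB β u 1 0 t)
          + 2 * (momentA β u 2 0 t + 2 * momentA β u 1 0 t - κ * momentA β u 0 0 t
            - momentB β u 0 0 t)) * (e₀ * e₁)
        + 2 * (momentA β u 2 0 t + 2 * momentA β u 1 0 t - κ * momentA β u 0 0 t
            - momentB β u 0 0 t) * (e₀ * e₂)
        + (4 * momentA β u 1 1 t + 8 * momentA β u 1 0 t + 4 * momentA β u 0 0 t) * e₁ ^ 2
        + 2 * (2 * momentA β u 1 0 t + 2 * momentA β u 0 0 t) * (e₁ * e₂)
        + momentA β u 0 0 t * e₂ ^ 2 := by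
  have hc (i) : Continuous (eulerIter β u i) := (contDiff_eulerIter hu i).continuous
  have hA (i) : Continuous (angLap (eulerIter β u i)) := (contDiff_eulerIter hu i).angLap.continuous
  have e : (fun x => ((eulerIter β u 2 x + 2 * eulerIter β u 1 x
        + -κ * eulerIter β u 0 x - angLap (eulerIter β u 0) x) * e₀
        + (2 * eulerIter β u 1 x + 2 * eulerIter β u 0 x) * e₁ + eulerIter β u 0 x * e₂) ^ 2)
      = fun x => e₀ ^ 2 * (eulerIter β u 2 x + 2 * eulerIter β u 1 x
        + -κ * eulerIter β u 0 x - angLap (eulerIter β u 0) x) ^ 2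
      + (4 * e₀ * e₁ * (eulerIter β u 2 x * eulerIter β u 1 x)
      + (8 * e₀ * e₁ * (eulerIter β u 1 x * eulerIter β u 1 x)
      + (-4 * κ * e₀ * e₁ * (eulerIter β u 1 x * eulerIter β u 0 x)
      + (-4 * e₀ * e₁ * (eulerIter β u 1 x * angLap (eulerIter β u 0) x)
      + ((4 * e₀ * e₁ + 2 * e₀ * e₂) * (eulerIter β u 2 x * eulerIter β u 0 x)
      + ((8 * e₀ * e₁ + 4 * e₀ * e₂) * (eulerIter β u 1 x * eulerIter β u 0 x)
      + (-κ * (4 * e₀ * e₁ + 2 * e₀ * e₂) * (eulerIter β u 0 x * eulerIter β u 0 x)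
      + (-(4 * e₀ * e₁ + 2 * e₀ * e₂) * (eulerIter β u 0 x * angLap (eulerIter β u 0) x)
      + (4 * e₁ ^ 2 * (eulerIter β u 1 x * eulerIter β u 1 x)
      + ((8 * e₁ ^ 2 + 4 * e₁ * e₂) * (eulerIter β u 1 x * eulerIter β u 0 x)
      + (4 * e₁ ^ 2 + 4 * e₁ * e₂ + e₂ ^ 2)
        * (eulerIter β u 0 x * eulerIter β u 0 x))))))))))) := by
    ext x
    ring
  rw [e]
  simp (disch := fun_prop) only [weightedIntegral_add, weightedIntegral_const_mul,
    weightedIntegral_mul_angLap hu, weightedIntegral_mul, weightedIntegral_sq hu]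
  ring

end expansions

section nonlinear

variable {n : ℕ} {u : EuclideanSpace ℝ (Fin n) → ℝ} {β a p : ℝ}

/-- The moment `∫ |w|^(p+1)` of the Emden–Fowler transform `w` of `u`. -/
noncomputable def momentN (p β : ℝ) (u : EuclideanSpace ℝ (Fin n) → ℝ) : ℝ → ℝ :=
  weightedIntegral (β * (p + 1)) fun x => |u x| ^ (p + 1)

/-- The rescaled energy of `u` in the ball of radius `exp t`. -/
noncomputable def bulkEnergy (k a p : ℝ) (u : EuclideanSpace ℝ (Fin n) → ℝ) (t : ℝ) : ℝ :=
  Real.exp (-k * t) * ∫ y in ball 0 (Real.exp t),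
    ((1 / 2) * lap n u y ^ 2 - (1 / (p + 1)) * ‖y‖ ^ a * |u y| ^ (p + 1))

lemma abs_rpow_sub_one_mul_mul_self (hp : 1 < p) (s : ℝ) : |s| ^ (p - 1) * s * s = |s| ^ (p + 1) := by
  rw [mul_assoc, ← abs_mul_abs_self s, ← mul_assoc]
  rcases eq_or_ne s 0 with rfl | hs
  · simp [Real.zero_rpow (show p + 1 ≠ 0 by linarith)]
  · rw [← Real.rpow_add_one (abs_ne_zero.2 hs), ← Real.rpow_add_one (abs_ne_zero.2 hs)]
    ring_nf

lemma contDiff_abs_rpow (hp : 1 < p) (hu : ContDiff ℝ (⊤ : ℕ∞) u) :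
    ContDiff ℝ 1 fun x => |u x| ^ (p + 1) :=
  (contDiff_norm_rpow (E := ℝ) (show 1 < p + 1 by linarith)).comp (hu.of_le (by exact_mod_cast le_top))

lemma exp_mul_norm_pow_four_mul_lap_lap (hsol : IsSolutionOn n a p u univ)
    (hβ : β * (p - 1) = 4 + a) {t : ℝ} {x : EuclideanSpace ℝ (Fin n)} (hx : ‖x‖ = Real.exp t) :
    Real.exp (2 * β * t) * (‖x‖ ^ 4 * lap n (lap n u) x)
      = Real.exp (β * (p + 1) * t) * (|u x| ^ (p - 1) * u x) := by
  rw [hsol x (mem_univ x), hx, ← Real.exp_mul, ← Real.exp_nat_mul, ← mul_assoc, mul_assoc _ _ (u x),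
    ← mul_assoc, ← Real.exp_add, ← Real.exp_add]
  congr 2
  push_cast
  linear_combination (-t) * hβ

lemma momentN_eq (hsol : IsSolutionOn n a p u univ) (hp : 1 < p) (hβ : β * (p - 1) = 4 + a) (t : ℝ) :
    momentN p β u t = weightedIntegral (2 * β)
      (fun x => eulerIter β u 0 x * (‖x‖ ^ 4 * lap n (lap n u) x)) t := by
  refine weightedIntegral_congr fun x hx => ?_
  have h := exp_mul_norm_pow_four_mul_lap_lap hsol hβ hx
  rw [← abs_rpow_sub_one_mul_mul_self hp]
  change _ = _ * (u x * _)
  linear_combination (-u x) * h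

lemma hasDerivAt_momentN (hu : ContDiff ℝ (⊤ : ℕ∞) u) (hsol : IsSolutionOn n a p u univ)
    (hp : 1 < p) (hβ : β * (p - 1) = 4 + a) (t : ℝ) :
    HasDerivAt (momentN p β u) ((p + 1) * weightedIntegral (2 * β)
      (fun x => eulerIter β u 1 x * (‖x‖ ^ 4 * lap n (lap n u) x)) t) t := by
  refine (hasDerivAt_weightedIntegral (contDiff_abs_rpow hp hu)
    (g := fun x => (p + 1) * (eulerIter β u 1 x * (|u x| ^ (p - 1) * u x)))
    (fun x => ?_) t).congr_deriv ?_
  · have h1 := (hasDerivAt_abs_rpow (u x) (show 1 < p + 1 by linarith)).comp_hasFDerivAt x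
      (hu.differentiableAt_of_top x).hasFDerivAt
    rw [linDeriv, show (fun x => |u x| ^ (p + 1)) = (fun s : ℝ => |s| ^ (p + 1)) ∘ u from rfl,
      h1.fderiv, ← abs_rpow_sub_one_mul_mul_self hp]
    change _ = (p + 1) * ((linDeriv _ u x + β * u x) * _)
    rw [show p + 1 - 2 = p - 1 by ring]
    simp only [FunLike.coe_smul, Pi.smul_apply, smul_eq_mul, linDeriv]
    ring
  · rw [weightedIntegral_const_mul]
    refine congrArg _ (weightedIntegral_congr fun x hx => ?_)
    have h := exp_mul_norm_pow_four_mul_lap_lap hsol hβ hx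
    linear_combination (-eulerIter β u 1 x) * h

lemma sq_le_rpow_add_rpow (hp : 1 < p) {s w : ℝ} (hs : 0 < s) (hw : 0 ≤ w) :
    w ^ 2 ≤ s ^ (p - 1) * w ^ (p + 1) + s ^ (-2 : ℝ) := by
  rcases le_total (s * w) 1 with h | h
  · have h1 : w ≤ s⁻¹ := by rwa [← one_div, le_div_iff₀' hs]
    have h2 : s ^ (-2 : ℝ) = s⁻¹ ^ 2 := by
      rw [Real.rpow_neg hs.le, inv_pow]
      norm_cast
    have h3 : 0 ≤ s ^ (p - 1) * w ^ (p + 1) := by positivity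
    rw [h2]
    nlinarith
  · have hw0 : 0 < w := by
      rcases hw.eq_or_lt with rfl | h'
      · norm_num at h
      · exact h'
    have h1 := Real.one_le_rpow h (show 0 ≤ p - 1 by linarith)
    have h2 : s ^ (p - 1) * w ^ (p + 1) = (s * w) ^ (p - 1) * w ^ 2 := by
      rw [Real.mul_rpow hs.le hw, mul_assoc, show p + 1 = p - 1 + (2 : ℕ) by push_cast; ring,
        Real.rpow_add_natCast hw0.ne']
    have h3 := Real.rpow_pos_of_pos hs (-2)
    rw [h2]
    nlinarith [sq_nonneg w]

lemma momentA_le_momentN (hu : ContDiff ℝ (⊤ : ℕ∞) u) (hp : 1 < p) {s : ℝ} (hs : 0 < s) (t : ℝ) :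
    momentA β u 0 0 t ≤ s ^ (p - 1) * momentN p β u t
      + s ^ (-2 : ℝ) * (sphereMeasure (EuclideanSpace ℝ (Fin n))).real univ := by
  have hN := (contDiff_abs_rpow hp hu).continuous
  have hc := hu.continuous
  have e : s ^ (-2 : ℝ) * (sphereMeasure (EuclideanSpace ℝ (Fin n))).real univ
      = radialIntegral (fun _ : EuclideanSpace ℝ (Fin n) => s ^ (-2 : ℝ)) t := by
    simp [radialIntegral, mul_comm]
  rw [e, momentN, momentA, weightedIntegral, weightedIntegral, ← radialIntegral_const_mul,
    ← radialIntegral_const_mul, ← radialIntegral_const_mul, ← radialIntegral_add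
      (f := fun x => s ^ (p - 1) * (Real.exp (β * (p + 1) * t) * |u x| ^ (p + 1)))
      (by fun_prop) continuous_const]
  refine radialIntegral_mono (g := fun x => _) (by simp only [eulerIter]; fun_prop)
    (by fun_prop) fun x _ => ?_
  have h := sq_le_rpow_add_rpow hp hs (w := Real.exp (β * t) * |u x|) (by positivity)
  rw [Real.mul_rpow (Real.exp_pos _).le (abs_nonneg _), ← Real.exp_mul, mul_pow, sq_abs,
    ← Real.exp_nat_mul] at h
  rw [show ((2 : ℕ) : ℝ) * (β * t) = 2 * β * t by push_cast; ring,
    show β * t * (p + 1) = β * (p + 1) * t by ring, sq (u x)] at h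
  exact h

lemma hasDerivAt_bulkEnergy [NeZero n] (hu : ContDiff ℝ (⊤ : ℕ∞) u) (hsol : IsSolutionOn n a p u univ)
    (hp : 1 < p) (hβ : β * (p - 1) = 4 + a) {k γ : ℝ} (hk : k = n - 4 - 2 * β)
    (hγ : γ = β * (n - 2 - β)) (t : ℝ) :
    HasDerivAt (bulkEnergy k a p u) (-k * bulkEnergy k a p u t
      + 1 / 2 * weightedIntegral (2 * β) (fun x => (eulerIter β u 2 x + (k + 2) * eulerIter β u 1 x
        + -γ * eulerIter β u 0 x - angLap (eulerIter β u 0) x) ^ 2) t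
      - momentN p β u t / (p + 1)) t := by
  have hL := contDiff_lap hu
  have hLL := contDiff_lap hL
  set F : EuclideanSpace ℝ (Fin n) → ℝ := fun y =>
    (1 / 2) * lap n u y ^ 2 - (1 / (p + 1)) * ‖y‖ ^ a * |u y| ^ (p + 1) with hF
  have hF' : F = fun y => (1 / 2) * lap n u y ^ 2 + -(1 / (p + 1)) * (u y * lap n (lap n u) y) := by
    ext y
    rw [hF, hsol y (mem_univ y)]
    dsimp only
    rw [← abs_rpow_sub_one_mul_mul_self hp]
    ring
  have hFs : ContDiff ℝ 1 F := by
    rw [hF']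
    exact ((contDiff_const.mul (hL.pow 2)).add (contDiff_const.mul (hu.mul hLL))).of_le
      (by exact_mod_cast le_top)
  have he : HasDerivAt (fun t => Real.exp (-k * t)) (Real.exp (-k * t) * -k) t := by
    simpa using ((hasDerivAt_id t).const_mul (-k)).exp
  refine (he.mul (hasDerivAt_integral_ball hFs t)).congr_deriv ?_
  have hI : Real.exp (-k * t) * (Real.exp (n * t) * radialIntegral F t)
      = 1 / 2 * weightedIntegral (2 * β) (fun x => (eulerIter β u 2 x + (k + 2) * eulerIter β u 1 x
        + -γ * eulerIter β u 0 x - angLap (eulerIter β u 0) x) ^ 2) t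
        - momentN p β u t / (p + 1) := by
    have hc (i) : Continuous (eulerIter β u i) := (contDiff_eulerIter hu i).continuous
    have hA := (contDiff_eulerIter (β := β) hu 0).angLap.continuous
    have hLc := hLL.continuous
    have e : Real.exp (-k * t) * (Real.exp (n * t) * radialIntegral F t)
        = weightedIntegral (n - k) F t := by
      rw [weightedIntegral, ← mul_assoc, ← Real.exp_add]
      ring_nf
    have hu0 : eulerIter β u 0 = u := rfl
    rw [e, momentN_eq hsol hp hβ, sub_eq_add_neg (1 / 2 * _), div_eq_inv_mul _ (p + 1), ← neg_mul,
      ← weightedIntegral_const_mul, ← weightedIntegral_const_mul,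
      ← weightedIntegral_add (by fun_prop) (by fun_prop), hF']
    refine weightedIntegral_congr fun x hx => ?_
    have h := norm_sq_mul_lap_eq_eulerIter hu β x
    rw [show eulerIter β u 2 x + (k + 2) * eulerIter β u 1 x + -γ * eulerIter β u 0 x
      - angLap (eulerIter β u 0) x = ‖x‖ ^ 2 * lap n u x by rw [h, hk, hγ]; ring]
    have e2 : Real.exp ((n - k) * t) = Real.exp (2 * β * t) * ‖x‖ ^ 4 := by
      rw [hx, ← Real.exp_nat_mul, ← Real.exp_add, hk]
      push_cast
      ring_nf
    rw [e2, hu0]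
    ring
  rw [finrank_euclideanSpace_fin, hI, bulkEnergy]
  ring

end nonlinear

section stability

variable {n : ℕ} {u : EuclideanSpace ℝ (Fin n) → ℝ} {β a p : ℝ} {ζ η : ℝ → ℝ}

lemma contDiff_comp_log_norm (hζ : ContDiff ℝ (⊤ : ℕ∞) ζ) (h : tsupport ζ ⊆ Ioi 0) :
    ContDiff ℝ (⊤ : ℕ∞) fun x : EuclideanSpace ℝ (Fin n) => ζ (Real.log ‖x‖) := by
  rw [contDiff_iff_contDiffAt]
  intro x
  rcases eq_or_ne x 0 with rfl | hx
  · have : (fun x : EuclideanSpace ℝ (Fin n) => ζ (Real.log ‖x‖)) =ᶠ[𝓝 0] fun _ => 0 := by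
      filter_upwards [ball_mem_nhds (0 : EuclideanSpace ℝ (Fin n)) one_pos] with y hy
      rw [mem_ball_zero_iff] at hy
      exact image_eq_zero_of_notMem_tsupport fun h' =>
        absurd (h h') (not_lt.2 (Real.log_nonpos (norm_nonneg _) hy.le))
    exact contDiffAt_const.congr_of_eventuallyEq this
  · exact hζ.contDiffAt.comp x ((contDiffAt_norm ℝ hx).log (norm_ne_zero_iff.2 hx))

lemma linDeriv_comp_log_norm (hζ : ContDiff ℝ (⊤ : ℕ∞) ζ) {x : EuclideanSpace ℝ (Fin n)}
    (hx : x ≠ 0) (M) :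
    linDeriv M (fun x => ζ (Real.log ‖x‖)) x
      = deriv ζ (Real.log ‖x‖) * ((‖x‖ ^ 2)⁻¹ * ⟪x, M x⟫) := by
  have hx' : ‖x‖ ^ 2 ≠ 0 := by simpa using hx
  have h1 := ((hasStrictFDerivAt_norm_sq x).hasFDerivAt.log hx').const_mul (1 / 2)
  have h2 := (hζ.differentiable (by simp)).differentiableAt (x := Real.log ‖x‖) |>.hasDerivAt
  have e : (fun y : EuclideanSpace ℝ (Fin n) => 1 / 2 * Real.log (‖y‖ ^ 2)) = fun y => Real.log ‖y‖ := by
    ext y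
    rw [Real.log_pow]
    push_cast
    ring
  rw [e] at h1
  have h3 := (h2.comp_hasFDerivAt x h1).fderiv
  change fderiv ℝ (ζ ∘ fun x => Real.log ‖x‖) x (M x) = _
  rw [h3]
  simp
  left
  ring

lemma linDeriv_id_comp_log_norm (hζ : ContDiff ℝ (⊤ : ℕ∞) ζ) (h : tsupport ζ ⊆ Ioi 0) :
    linDeriv (.id ℝ (EuclideanSpace ℝ (Fin n))) (fun x => ζ (Real.log ‖x‖))
      = fun x => deriv ζ (Real.log ‖x‖) := by
  ext x
  rcases eq_or_ne x 0 with rfl | hx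
  · have : deriv ζ 0 = 0 := by
      by_contra h'
      exact lt_irrefl (0 : ℝ) (mem_Ioi.1 (h (support_deriv_subset h')))
    simp [linDeriv, this]
  · have hx' : ‖x‖ ^ 2 ≠ 0 := by simpa using hx
    rw [linDeriv_comp_log_norm hζ hx, ContinuousLinearMap.id_apply, real_inner_self_eq_norm_sq,
      inv_mul_cancel₀ hx', mul_one]

lemma linDeriv_rotGen_comp_log_norm (hζ : ContDiff ℝ (⊤ : ℕ∞) ζ) (i j : Fin n) :
    linDeriv (rotGen i j) (fun x : EuclideanSpace ℝ (Fin n) => ζ (Real.log ‖x‖)) = 0 := by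
  ext x
  rcases eq_or_ne x 0 with rfl | hx
  · simp [linDeriv]
  · have : ⟪x, rotGen i j x⟫ = 0 := by
      simp [rotGen_apply, inner_sub_right, inner_smul_right, EuclideanSpace.inner_single_right]
      ring
    rw [linDeriv_comp_log_norm hζ hx, this, mul_zero, mul_zero, Pi.zero_apply]

lemma norm_sq_mul_lap_cutoff (hu : ContDiff ℝ (⊤ : ℕ∞) u) (hη : ContDiff ℝ (⊤ : ℕ∞) η)
    (h : tsupport η ⊆ Ioi 0) {κ s : ℝ} (hs : s = β - (n - 4) / 2) (hκ : κ = n * (n - 4) / 4)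
    (x : EuclideanSpace ℝ (Fin n)) :
    ‖x‖ ^ 2 * lap n (fun x => Real.exp (s * Real.log ‖x‖) * η (Real.log ‖x‖) * u x) x
      = Real.exp (s * Real.log ‖x‖) * ((eulerIter β u 2 x + 2 * eulerIter β u 1 x
        + -κ * eulerIter β u 0 x - angLap (eulerIter β u 0) x) * η (Real.log ‖x‖)
        + (2 * eulerIter β u 1 x + 2 * eulerIter β u 0 x) * deriv η (Real.log ‖x‖)
        + eulerIter β u 0 x * deriv (deriv η) (Real.log ‖x‖)) := by
  set ζ : ℝ → ℝ := fun t => Real.exp (s * t) * η t with hζd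
  have hη' : ContDiff ℝ (⊤ : ℕ∞) (deriv η) := (contDiff_infty_iff_deriv.1 hη).2
  have hζ : ContDiff ℝ (⊤ : ℕ∞) ζ := (Real.contDiff_exp.comp (contDiff_const.mul contDiff_id)).mul hη
  have hζ' : ContDiff ℝ (⊤ : ℕ∞) (deriv ζ) := (contDiff_infty_iff_deriv.1 hζ).2
  have hts : tsupport ζ ⊆ Ioi 0 := (tsupport_mul_subset_right).trans h
  have hts' : tsupport (deriv ζ) ⊆ Ioi 0 := (closure_minimal support_deriv_subset isClosed_closure).trans hts
  have he (t : ℝ) : HasDerivAt (fun t => Real.exp (s * t)) (Real.exp (s * t) * s) t := by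
    simpa using ((hasDerivAt_id t).const_mul s).exp
  have d1 : deriv ζ = fun t => Real.exp (s * t) * (s * η t + deriv η t) := by
    ext t
    refine (((he t).mul (hη.differentiable (by simp) t).hasDerivAt).congr_deriv ?_).deriv
    ring
  have d2 : deriv (deriv ζ) = fun t => Real.exp (s * t) *
      (s ^ 2 * η t + 2 * s * deriv η t + deriv (deriv η) t) := by
    ext t
    rw [d1]
    refine (((he t).mul (((hη.differentiable (by simp) t).hasDerivAt.const_mul s).add
      (hη'.differentiable (by simp) t).hasDerivAt)).congr_deriv ?_).deriv
    simp only [Pi.add_apply]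
    ring
  have hρ := contDiff_comp_log_norm (n := n) hζ hts
  have hρ' := contDiff_comp_log_norm (n := n) hζ' hts'
  have hX := linDeriv_id_comp_log_norm (n := n) hζ hts
  have hX' := linDeriv_id_comp_log_norm (n := n) hζ' hts'
  have hu1 := contDiff_eulerIter (β := β) hu 1
  have hXu : linDeriv (.id ℝ _) u = fun x => eulerIter β u 1 x + -β * u x := linDeriv_id_eulerIter β u 0
  have hXu' := hu.linDeriv (.id ℝ _)
  have e1 : linDeriv (.id ℝ _) (fun x => ζ (Real.log ‖x‖) * u x) = fun x =>
      deriv ζ (Real.log ‖x‖) * u x + ζ (Real.log ‖x‖) * linDeriv (.id ℝ _) u x := by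
    ext y
    rw [linDeriv_mul (hρ.differentiableAt_of_top y) (hu.differentiableAt_of_top y), hX]
  have e2 : linDeriv (.id ℝ _) (linDeriv (.id ℝ _) (fun x => ζ (Real.log ‖x‖) * u x)) x =
      deriv (deriv ζ) (Real.log ‖x‖) * u x + 2 * deriv ζ (Real.log ‖x‖) * linDeriv (.id ℝ _) u x
        + ζ (Real.log ‖x‖) * linDeriv (.id ℝ _) (linDeriv (.id ℝ _) u) x := by
    rw [e1, linDeriv_add ((hρ'.mul hu).differentiableAt_of_top x) ((hρ.mul hXu').differentiableAt_of_top x),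
      linDeriv_mul (hρ'.differentiableAt_of_top x) (hu.differentiableAt_of_top x), hX',
      linDeriv_mul (hρ.differentiableAt_of_top x) (hXu'.differentiableAt_of_top x), hX]
    ring
  have e3 : linDeriv (.id ℝ _) (linDeriv (.id ℝ _) u) x
      = eulerIter β u 2 x - 2 * β * eulerIter β u 1 x + β ^ 2 * u x := by
    rw [hXu, linDeriv_add (hu1.differentiableAt_of_top x)
      ((contDiff_const.mul hu).differentiableAt_of_top x), linDeriv_const_mul _
      (hu.differentiableAt_of_top x), hXu, linDeriv_id_eulerIter]
    ring
  have hu0 : eulerIter β u 0 = u := rfl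
  rw [show (fun x : EuclideanSpace ℝ (Fin n) => Real.exp (s * Real.log ‖x‖) * η (Real.log ‖x‖) * u x)
    = fun x => ζ (Real.log ‖x‖) * u x from rfl, norm_sq_mul_lap (hρ.mul hu), e2, e3, e1, hXu,
    angLap_mul_of_linDeriv_eq_zero hu hρ fun i j => linDeriv_rotGen_comp_log_norm hζ i j, d2, d1,
    hu0, hζd, hs, hκ]
  ring

lemma hasCompactSupport_lap {ψ : EuclideanSpace ℝ (Fin n) → ℝ} (h : HasCompactSupport ψ) :
    HasCompactSupport (lap n ψ) := by
  refine (h.iteratedFDeriv (𝕜 := ℝ) 2).mono fun x hx hx' => hx ?_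
  simp [lap, hx']

/-- The stability inequality for test functions `r ^ s * η (log r) * u`. -/
lemma stability_inequality [NeZero n] (hu : ContDiff ℝ (⊤ : ℕ∞) u) (hp : 1 < p) (ha : 0 ≤ a)
    (hβ : β * (p - 1) = 4 + a) {K : Set (EuclideanSpace ℝ (Fin n))} (hK : StableOn n a p u Kᶜ)
    {T : ℝ} (hT : 0 ≤ T) (hKT : ∀ x ∈ K, ‖x‖ ≤ Real.exp T) {κ : ℝ} (hκ : κ = n * (n - 4) / 4)
    (hη : ContDiff ℝ (⊤ : ℕ∞) η) (hηc : HasCompactSupport η) (hηT : tsupport η ⊆ Ioi T) :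
    p * ∫ t, momentN p β u t * η t ^ 2 ≤ ∫ t, weightedIntegral (2 * β) (fun x =>
        ((eulerIter β u 2 x + 2 * eulerIter β u 1 x
        + -κ * eulerIter β u 0 x - angLap (eulerIter β u 0) x) * η t
        + (2 * eulerIter β u 1 x + 2 * eulerIter β u 0 x) * deriv η t
        + eulerIter β u 0 x * deriv (deriv η) t) ^ 2) t := by
  have h0 : tsupport η ⊆ Ioi 0 := hηT.trans (Ioi_subset_Ioi hT)
  set s := β - (n - 4) / 2 with hs
  set ψ : EuclideanSpace ℝ (Fin n) → ℝ :=
    fun x => Real.exp (s * Real.log ‖x‖) * η (Real.log ‖x‖) * u x with hψ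
  have hψs : ContDiff ℝ (⊤ : ℕ∞) ψ :=
    (contDiff_comp_log_norm (ζ := fun t => Real.exp (s * t) * η t)
      ((Real.contDiff_exp.comp (contDiff_const.mul contDiff_id)).mul hη)
      (tsupport_mul_subset_right.trans h0)).mul hu
  set C : Set (EuclideanSpace ℝ (Fin n)) := norm ⁻¹' (Real.exp '' tsupport η) with hC
  have hexp : IsCompact (Real.exp '' tsupport η) := hηc.isCompact.image Real.continuous_exp
  have hCc : IsCompact C := by
    refine Metric.isCompact_of_isClosed_isBounded (hexp.isClosed.preimage continuous_norm) ?_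
    obtain ⟨R, hR⟩ := hexp.isBounded.subset_closedBall 0
    refine isBounded_iff_forall_norm_le.2 ⟨R, fun x hx => ?_⟩
    simpa using hR hx
  have hsupp : Function.support ψ ⊆ C := by
    intro x hx
    have h1 : η (Real.log ‖x‖) ≠ 0 := fun h => hx (by simp [hψ, h])
    have h2 : Real.log ‖x‖ ∈ tsupport η := subset_tsupport _ h1
    refine ⟨_, h2, Real.exp_log (norm_pos_iff.2 ?_)⟩
    rintro rfl
    have := h0 h2
    simp at this
  have hψc : HasCompactSupport ψ := HasCompactSupport.of_support_subset_isCompact hCc hsupp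
  have hψK : tsupport ψ ⊆ Kᶜ := by
    refine (closure_minimal hsupp hCc.isClosed).trans fun x hx hxK => ?_
    obtain ⟨t, ht, htx⟩ := hx
    have h1 := hKT x hxK
    rw [← htx, Real.exp_le_exp] at h1
    exact absurd (hηT ht) (not_lt.2 h1)
  have hfi : Integrable fun x => ‖x‖ ^ a * |u x| ^ (p - 1) * ψ x ^ 2 := by
    refine Continuous.integrable_of_hasCompactSupport ?_ ?_
    · exact ((continuous_norm.rpow_const fun _ => Or.inr ha).mul
        (hu.continuous.abs.rpow_const fun _ => Or.inr (by linarith))).mul (hψs.continuous.pow 2)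
    · exact hψc.mono fun x hx h => hx (by simp [h])
  have hfi' : Integrable fun x => lap n ψ x ^ 2 :=
    ((contDiff_lap hψs).continuous.pow 2).integrable_of_hasCompactSupport
      ((hasCompactSupport_lap hψc).mono fun x hx h => hx (by simp [h]))
  have key := hK ψ hψs hψc hψK
  rw [integral_eq_integral_exp_mul_radialIntegral hfi,
    integral_eq_integral_exp_mul_radialIntegral hfi', finrank_euclideanSpace_fin] at key
  refine le_of_eq_of_le (congrArg (p * ·) (integral_congr_ae (.of_forall fun t => ?_)))
    (key.trans_eq (integral_congr_ae (.of_forall fun t => ?_)))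
  · dsimp only
    rw [mul_comm (momentN p β u t), momentN, ← weightedIntegral_const_mul]
    refine weightedIntegral_congr (q' := n) fun x hx => ?_
    have hψx : ψ x = Real.exp (s * t) * η t * u x := by rw [hψ, ← Real.log_exp t, ← hx]
    rw [hψx, hx, ← abs_rpow_sub_one_mul_mul_self hp, ← Real.exp_mul]
    have : Real.exp (β * (p + 1) * t) = Real.exp (n * t) * Real.exp (t * a) * Real.exp (s * t) ^ 2 := by
      rw [← Real.exp_nat_mul, ← Real.exp_add, ← Real.exp_add, hs]
      congr 1
      push_cast
      linear_combination t * hβ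
    rw [this]
    ring
  · refine weightedIntegral_congr (q := n) fun x hx => ?_
    have h := norm_sq_mul_lap_cutoff hu hη h0 hs hκ x
    rw [← hψ, hx, Real.log_exp] at h
    have : Real.exp (2 * β * t) * Real.exp t ^ 4 = Real.exp (n * t) * Real.exp (s * t) ^ 2 := by
      rw [← Real.exp_nat_mul, ← Real.exp_nat_mul, ← Real.exp_add, ← Real.exp_add, hs]
      congr 1
      push_cast
      ring
    have hpos : Real.exp t ^ 4 ≠ 0 := by positivity
    apply mul_left_cancel₀ hpos
    set Q := (eulerIter β u 2 x + 2 * eulerIter β u 1 x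
        + -κ * eulerIter β u 0 x - angLap (eulerIter β u 0) x) * η t
        + (2 * eulerIter β u 1 x + 2 * eulerIter β u 0 x) * deriv η t
        + eulerIter β u 0 x * deriv (deriv η) t
    linear_combination -Q ^ 2 * this
      + Real.exp (n * t) * (Real.exp t ^ 2 * lap n ψ x + Real.exp (s * t) * Q) * h

end stability

section assembly

variable {n : ℕ} {u : EuclideanSpace ℝ (Fin n) → ℝ} {β a p : ℝ}

lemma exists_sphericalMoments [NeZero n] (hu : ContDiff ℝ (⊤ : ℕ∞) u)
    (hsol : IsSolutionOn n a p u univ) (hp : 1 < p) (ha : 0 ≤ a) (hβ : β * (p - 1) = 4 + a)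
    {K : Set (EuclideanSpace ℝ (Fin n))} (hKc : IsCompact K) (hK : StableOn n a p u Kᶜ)
    {k γ κ : ℝ} (hk : k = n - 4 - 2 * β) (hγ : γ = β * (n - 2 - β)) (hκ : κ = n * (n - 4) / 4) :
    ∃ S : SphericalMoments k γ κ p,
      S.a = momentA β u ∧ S.b = momentB β u ∧ S.V = bulkEnergy k a p u := by
  obtain ⟨R, hR⟩ := isBounded_iff_forall_norm_le.1 hKc.isBounded
  have hKT : ∀ x ∈ K, ‖x‖ ≤ Real.exp (max 0 R) := fun x hx =>
    (hR x hx).trans (by linarith [Real.add_one_le_exp (max 0 R), le_max_right 0 R])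
  exact ⟨{
    a := momentA β u
    b := momentB β u
    c := momentC β u 0
    c' := momentC β u 1
    N := momentN p β u
    V := bulkEnergy k a p u
    area := (sphereMeasure (EuclideanSpace ℝ (Fin n))).real univ
    area_nonneg := measureReal_nonneg
    a_symm := momentA_comm
    b_symm := momentB_comm
    a_nonneg := momentA_nonneg
    b_nonneg := momentB_nonneg
    c_nonneg := momentC_nonneg
    N_nonneg := weightedIntegral_nonneg fun x => Real.rpow_nonneg (abs_nonneg _) _
    a_sq_le := momentA_sq_le hu
    b_sq_le := momentB_sq_le hu
    b_sq_le_a_mul_c := momentB_sq_le_momentA_mul_momentC hu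
    hasDerivAt_a := hasDerivAt_momentA hu
    hasDerivAt_b := hasDerivAt_momentB hu
    hasDerivAt_c := hasDerivAt_momentC hu
    N_eq := fun t => by
      rw [momentN_eq hsol hp hβ, weightedIntegral_mul_lap_lap hu hk hγ]
    hasDerivAt_N := fun t => by
      have h := hasDerivAt_momentN hu hsol hp hβ t
      rwa [weightedIntegral_mul_lap_lap hu hk hγ] at h
    hasDerivAt_V := fun t => by
      refine (hasDerivAt_bulkEnergy hu hsol hp hβ hk hγ t).congr_deriv ?_
      rw [weightedIntegral_sq hu]
      ring
    a_le_N := fun s hs t => momentA_le_momentN hu hp hs t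
    T₀ := max 0 R
    stable := fun η hη hηc hηT => by
      have h := stability_inequality hu hp ha hβ hK (le_max_left 0 R) hKT hκ hη hηc hηT
      simpa only [weightedIntegral_comb_sq hu] using h }, rfl, rfl, rfl⟩

end assembly

section energy

variable {n : ℕ} {u : EuclideanSpace ℝ (Fin n) → ℝ} {β a p : ℝ}

lemma exists_rpow_mul_sphInt_eq (n : ℕ) [NeZero n] : ∃ c : ℝ, ∀ {β α e m ρ : ℝ}
    {f g : EuclideanSpace ℝ (Fin n) → ℝ}, 0 < ρ → Continuous g →
    (∀ x, ‖x‖ = ρ → f x = ρ ^ e * g x) → α + e + n - 1 = m + 2 * β →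
    ρ ^ α * sphInt n 0 ρ f = c * (ρ ^ m * weightedIntegral (2 * β) g (Real.log ρ)) := by
  obtain ⟨c, hc⟩ := (isSphericalMeasure_hausdorffMeasure (E := EuclideanSpace ℝ (Fin n))
    ((n : ℝ) - 1)).exists_integral_eq_mul isSphericalMeasure_sphereMeasure sphereMeasure_ne_zero
  refine ⟨c, fun {β α e m ρ f g} hρ hg h hm => ?_⟩
  have hn : (0 : ℝ) ≤ n - 1 := by
    have : (1 : ℝ) ≤ n := by exact_mod_cast NeZero.one_le
    linarith
  have h1 : sphInt n 0 ρ f = ∫ x in sphere 0 ρ, ρ ^ e * g x ∂(Measure.hausdorffMeasure ((n : ℝ) - 1)) :=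
    setIntegral_congr_fun isClosed_sphere.measurableSet fun x hx => h x (by simpa using hx)
  rw [h1, integral_const_mul, setIntegral_sphere_hausdorffMeasure hn hρ,
    hc (fun x => g (ρ • x)) (hg.comp (continuous_const_smul _)), weightedIntegral, radialIntegral,
    Real.exp_log hρ, mul_comm (2 * β), Real.exp_mul, Real.exp_log hρ]
  have h2 : ρ ^ α * ρ ^ e * ρ ^ ((n : ℝ) - 1) = ρ ^ m * ρ ^ (2 * β) := by
    rw [← Real.rpow_add hρ, ← Real.rpow_add hρ, ← Real.rpow_add hρ]
    congr 1
    linarith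
  linear_combination c * (∫ x, g (ρ • x) ∂(sphereMeasure (EuclideanSpace ℝ (Fin n)))) * h2

lemma deriv_of_eq_rpow_mul_comp_log {F W : ℝ → ℝ} {c m W' r : ℝ} (hr : 0 < r)
    (hF : ∀ ρ > 0, F ρ = c * (ρ ^ m * W (Real.log ρ))) (hW : HasDerivAt W W' (Real.log r)) :
    deriv F r = c * (r ^ (m - 1) * (m * W (Real.log r) + W')) := by
  have h1 : F =ᶠ[𝓝 r] fun ρ => c * (ρ ^ m * W (Real.log ρ)) :=
    (eventually_gt_nhds hr).mono hF
  have h2 := (((Real.hasDerivAt_rpow_const (p := m) (Or.inl hr.ne')).mul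
    (hW.comp r (Real.hasDerivAt_log hr.ne'))).const_mul c)
  rw [h1.deriv_eq]
  refine (h2.congr_deriv ?_).deriv
  rw [Function.comp_apply, Real.rpow_sub_one hr.ne']
  ring

lemma radDeriv_zero (u : EuclideanSpace ℝ (Fin n) → ℝ) (x : EuclideanSpace ℝ (Fin n)) :
    radDeriv n 0 u x = ‖x‖⁻¹ * linDeriv (.id ℝ _) u x := by
  simp [radDeriv, linDeriv, gradient, inner_smul_right]

lemma exists_energyE_eq [NeZero n] (hu : ContDiff ℝ (⊤ : ℕ∞) u) (hβ : (4 + a) / (p - 1) = β)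
    {k γ : ℝ} (hk : k = n - 4 - 2 * β) (hγ : γ = β * (n - 2 - β)) :
    ∃ c : ℝ, ∀ r > 0, energyE n a p u 0 r = bulkEnergy k a p u (Real.log r)
      + c * (γ * r⁻¹ * momentA β u 1 0 (Real.log r)
        + γ / 2 * (momentA β u 0 0 (Real.log r) + 2 * momentA β u 1 0 (Real.log r))
        - momentA β u 1 1 (Real.log r) + momentB β u 0 0 (Real.log r)
        + (momentA β u 2 1 (Real.log r) + momentB β u 1 0 (Real.log r))) := by
  obtain ⟨c, hc⟩ := exists_rpow_mul_sphInt_eq n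
  have hs (i) := contDiff_eulerIter (β := β) hu i
  have hcA (i) : Continuous fun x => eulerIter β u i x * eulerIter β u i x :=
    (hs i).continuous.mul (hs i).continuous
  have hcB : Continuous (angInner (eulerIter β u 0) (eulerIter β u 0)) :=
    ((hs 0).angInner (hs 0)).continuous
  have f1 {α m : ℝ} (h : α + 0 + n - 1 = m + 2 * β) : ∀ ρ > 0, ρ ^ α * (sphInt n 0 ρ fun y => u y ^ 2)
      = c * (ρ ^ m * momentA β u 0 0 (Real.log ρ)) := fun ρ hρ =>
    hc hρ (hcA 0) (fun x _ => by
      rw [Real.rpow_zero, one_mul, sq]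
      rfl) h
  have f2 {α m : ℝ} (h : α + -2 + n - 1 = m + 2 * β) : ∀ ρ > 0,
      ρ ^ α * (sphInt n 0 ρ fun y => (β * ρ⁻¹ * u y + radDeriv n 0 u y) ^ 2)
      = c * (ρ ^ m * momentA β u 1 1 (Real.log ρ)) := fun ρ hρ =>
    hc hρ (hcA 1) (fun x hx => by
      rw [radDeriv_zero, hx, Real.rpow_neg hρ.le, Real.rpow_two]
      simp only [eulerIter]
      field_simp
      ring) h
  have f3 {α m : ℝ} (h : α + -2 + n - 1 = m + 2 * β) : ∀ ρ > 0,
      ρ ^ α * (sphInt n 0 ρ fun y => ‖gradient u y‖ ^ 2 - radDeriv n 0 u y ^ 2)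
      = c * (ρ ^ m * momentB β u 0 0 (Real.log ρ)) := fun ρ hρ =>
    hc hρ hcB (fun x hx => by
      rw [radDeriv_zero, angInner_self, hx, Real.rpow_neg hρ.le, Real.rpow_two]
      simp only [eulerIter]
      field_simp) h
  refine ⟨c, fun r hr => ?_⟩
  simp only [energyE]
  rw [hβ, deriv_of_eq_rpow_mul_comp_log hr (f1 (m := 0) (by ring)) (hasDerivAt_momentA hu 0 0 _),
    deriv_of_eq_rpow_mul_comp_log hr (f1 (m := 1) (by ring)) (hasDerivAt_momentA hu 0 0 _),
    deriv_of_eq_rpow_mul_comp_log hr (f2 (m := -2) (by ring)) (hasDerivAt_momentA hu 1 1 _),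
    deriv_of_eq_rpow_mul_comp_log hr (f3 (m := 1) (by ring)) (hasDerivAt_momentB hu 0 0 _),
    mul_assoc (1 / 2), f3 (m := 0) (by ring) r hr, bulkEnergy, Real.exp_log hr,
    momentA_comm 0 1, momentA_comm (1 : ℕ) (1 + 1), momentB_comm 0 1]
  have e1 : r ^ (2 * β + 4 - n) = Real.exp (-k * Real.log r) := by
    rw [Real.rpow_def_of_pos hr, hk]
    ring_nf
  have e2 : r ^ (0 - 1 : ℝ) = r⁻¹ := by rw [zero_sub, Real.rpow_neg_one]
  have e3 : r ^ (1 - 1 : ℝ) = 1 := by rw [sub_self, Real.rpow_zero]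
  have e4 : r ^ 3 * r ^ (-2 - 1 : ℝ) = 1 := by
    rw [show (-2 - 1 : ℝ) = -(3 : ℕ) by norm_num, Real.rpow_neg hr.le, Real.rpow_natCast,
      mul_inv_cancel₀ (pow_pos hr 3).ne']
  rw [e1, e2, e3, Real.rpow_zero, hγ]
  linear_combination c * (momentA β u (1 + 1) 1 (Real.log r) - momentA β u 1 1 (Real.log r)) * e4

end energy

/-- Claim II in the proof of Theorem 1.2, supercritical case: for a
smooth solution stable outside a compact set in the supercritical range,
`E(r;0,u) → 0` as `r → ∞`. -/
theorem stmt19 (n : ℕ) (hn : 5 ≤ n) (a p : ℝ) (ha : 0 ≤ a)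
    (hpc : ((n : ℝ) + 4 + 2 * a) / ((n : ℝ) - 4) < p)
    (hl1 : p * ell1 n a p > (n : ℝ) * ((n : ℝ) - 4) / 2)
    (hl2 : p * ell2 n a p > (n : ℝ) ^ 2 * ((n : ℝ) - 4) ^ 2 / 16)
    (u : EuclideanSpace ℝ (Fin n) → ℝ) (hu : ContDiff ℝ (⊤ : ℕ∞) u)
    (hsol : IsSolutionOn n a p u Set.univ)
    (hstab : ∃ K : Set (EuclideanSpace ℝ (Fin n)), IsCompact K ∧ StableOn n a p u Kᶜ) :
    Tendsto (fun r : ℝ => energyE n a p u 0 r) atTop (𝓝 0) := by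
  have : NeZero n := ⟨by omega⟩
  obtain ⟨K, hKc, hK⟩ := hstab
  have hn' : (5 : ℝ) ≤ n := by exact_mod_cast hn
  have hn4 : (0 : ℝ) < n - 4 := by linarith
  rw [div_lt_iff₀ hn4] at hpc
  have hp : 1 < p := by
    by_contra! h
    nlinarith
  have hp1 : 0 < p - 1 := by linarith
  obtain ⟨β, hβ⟩ : ∃ β, (4 + a) / (p - 1) = β := ⟨_, rfl⟩
  have hβ' : β * (p - 1) = 4 + a := by rw [← hβ, div_mul_cancel₀ _ hp1.ne']
  have hβ0 : 0 < β := by rw [← hβ]; positivity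
  simp only [ell1, ell2, hβ] at hl1 hl2
  have hk : (0 : ℝ) < n - 4 - 2 * β := by
    by_contra! h
    nlinarith
  have hγ : 0 ≤ β * (n - 2 - β) := mul_nonneg hβ0.le (by linarith)
  obtain ⟨S, hSa, hSb, hSV⟩ := exists_sphericalMoments hu hsol hp ha hβ' hKc hK rfl rfl rfl
  obtain ⟨c, hc⟩ := exists_energyE_eq (p := p) hu hβ rfl rfl
  obtain ⟨hV, h00, h10, h11, hb, h21⟩ := S.tendsto_moments hk hγ hp (by linarith) (by linarith)
  rw [hSV] at hV
  simp only [hSa, hSb] at h00 h10 h11 hb h21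
  have hlog := Real.tendsto_log_atTop
  have hbdry := ((((tendsto_inv_atTop_zero.const_mul (β * (n - 2 - β))).mul (h10.comp hlog)).add
    (((h00.comp hlog).add ((h10.comp hlog).const_mul 2)).const_mul (β * (n - 2 - β) / 2))).sub
    (h11.comp hlog)).add (hb.comp hlog) |>.add (h21.comp hlog)
  have hlim := (hV.comp hlog).add (hbdry.const_mul c)
  simp only [mul_zero, add_zero, sub_zero] at hlim
  exact hlim.congr' ((eventually_gt_atTop 0).mono fun r hr => (hc r hr).symm)
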